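/- Fix α > 0. There exists a constant C > 0 depending only on α such that for every integer d ≥ C the following holds: for every probability space (Ω, ℙ) carrying a white-noise Gaussian process (h_n(x)) as in the context, ℙ-almost surely, for every box B = [a_1,b_1] × … × [a_d,b_d] ⊂ ℝ^d with a_i < b_i for all i, and every coordinate i_0 ∈ {1,…,d}, there exists a continuous map φ : [0,1] → B whose image is contained in 𝒯^W_α ∩ B and which satisfies φ(0)_{i_0} = a_{i_0} and φ(1)_{i_0} = b_{i_0} (i.e., 𝒯^W_α ∩ B contains a path connecting the two opposite faces of B in direction i_0). -/

import Mathlib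

open MeasureTheory ProbabilityTheory

/-- The covariance kernel of the white-noise approximation of the log-correlated field:
`K((n,x),(m,y)) = ∫_{2^{−min(n,m)}}^{1} [vol(B_t(x) ∩ B_t(y)) / vol(B_t(0))] t⁻¹ dt`. -/
noncomputable def wnKernel (d : ℕ) (n m : ℕ) (x y : EuclideanSpace ℝ (Fin d)) : ℝ :=
  ∫ t in Set.Ioc ((2 : ℝ) ^ (-(min n m : ℤ))) 1,
    (volume (Metric.ball x t ∩ Metric.ball y t)).toReal /
      (volume (Metric.ball (0 : EuclideanSpace ℝ (Fin d)) t)).toReal * t⁻¹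

/-- `(h_n(x))_{n ≥ 1}` is a centered Gaussian process with covariance kernel `wnKernel`,
each `h_n(·)(ω)` being continuous. -/
def IsWhiteNoiseField (d : ℕ) {Ω : Type} [MeasurableSpace Ω] (P : Measure Ω)
    (h : ℕ → EuclideanSpace ℝ (Fin d) → Ω → ℝ) : Prop :=
  (∀ n x, Measurable (h n x)) ∧
  (∀ (N : ℕ) (idx : Fin N → ℕ × EuclideanSpace ℝ (Fin d)) (c : Fin N → ℝ),
    (∀ i, 1 ≤ (idx i).1) →
    P.map (fun ω => ∑ i, c i * h (idx i).1 (idx i).2 ω) =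
      gaussianReal 0 (Real.toNNReal (∑ i, ∑ j,
        c i * c j * wnKernel d (idx i).1 (idx j).1 (idx i).2 (idx j).2))) ∧
  (∀ ω n, Continuous (fun x => h n x ω))

namespace WhiteNoise

/-- The Euclidean space on which the field lives. -/
abbrev Pt (d : ℕ) := EuclideanSpace ℝ (Fin d)

/-- The normalized volume of the intersection of two balls of radius `t` whose centers differ
by `x`. -/
noncomputable def overlap (d : ℕ) (t : ℝ) (x : Pt d) : ℝ :=
  (volume (Metric.ball (0 : Pt d) t ∩ Metric.ball x t)).toReal /
    (volume (Metric.ball (0 : Pt d) t)).toReal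

/-- The covariance kernel of the increments of the field between the scales `r` and `R`. -/
noncomputable def bandKernel (d : ℕ) (r R : ℝ) (x : Pt d) : ℝ :=
  ∫ t in r..R, overlap d t x * t⁻¹

section overlap

variable {d : ℕ} {t : ℝ} {x y : Pt d}

lemma volume_ball_ne_top : volume (Metric.ball x t) ≠ ⊤ := measure_ball_lt_top.ne

lemma volume_inter_ne_top : volume (Metric.ball y t ∩ Metric.ball x t) ≠ ⊤ :=
  measure_ne_top_of_subset Set.inter_subset_left volume_ball_ne_top

lemma volume_ball_toReal_pos (ht : 0 < t) : 0 < (volume (Metric.ball x t)).toReal :=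
  ENNReal.toReal_pos (Metric.measure_ball_pos _ _ ht).ne' volume_ball_ne_top

lemma overlap_nonneg : 0 ≤ overlap d t x := by unfold overlap; positivity

lemma overlap_le_one : overlap d t x ≤ 1 := by
  unfold overlap
  refine div_le_one_of_le₀ ?_ ENNReal.toReal_nonneg
  exact ENNReal.toReal_mono volume_ball_ne_top (measure_mono Set.inter_subset_left)

lemma overlap_zero (ht : 0 < t) : overlap d t 0 = 1 := by
  unfold overlap
  rw [Set.inter_self, div_self (volume_ball_toReal_pos ht).ne']

lemma volume_inter_translate (x y : Pt d) (t : ℝ) :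
    volume (Metric.ball x t ∩ Metric.ball y t) =
      volume (Metric.ball 0 t ∩ Metric.ball (y - x) t) := by
  rw [← measure_preimage_add_right volume x (Metric.ball x t ∩ Metric.ball y t)]
  congr 1
  ext z
  simp [dist_eq_norm, sub_sub_eq_add_sub]

lemma overlap_map (f : Pt d ≃ₗᵢ[ℝ] Pt d) : overlap d t (f x) = overlap d t x := by
  unfold overlap
  have h := f.measurePreserving.measure_preimage
    (s := Metric.ball 0 t ∩ Metric.ball (f x) t)
    (Metric.isOpen_ball.inter Metric.isOpen_ball).measurableSet.nullMeasurableSet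
  have h2 : f ⁻¹' (Metric.ball 0 t ∩ Metric.ball (f x) t) =
      Metric.ball 0 t ∩ Metric.ball x t := by
    ext z
    simp [dist_eq_norm]
  rw [← h, h2]

lemma overlap_eq_of_norm_eq (h : ‖x‖ = ‖y‖) : overlap d t x = overlap d t y := by
  rw [← Submodule.reflection_sub h, overlap_map]

lemma overlap_smul_le {c : ℝ} (h0 : 0 ≤ c) (h1 : c ≤ 1) :
    overlap d t x ≤ overlap d t (c • x) := by
  unfold overlap
  refine div_le_div_of_nonneg_right (ENNReal.toReal_mono volume_inter_ne_top ?_)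
    ENNReal.toReal_nonneg
  have e1 : volume (Metric.ball 0 t ∩ Metric.ball x t) =
      volume (Metric.ball (-(1/2 : ℝ) • x) t ∩ Metric.ball ((1/2 : ℝ) • x) t) := by
    rw [volume_inter_translate (-(1/2 : ℝ) • x)]
    congr 3
    module
  have e2 : volume (Metric.ball 0 t ∩ Metric.ball (c • x) t) =
      volume (Metric.ball (-(c/2 : ℝ) • x) t ∩ Metric.ball ((c/2 : ℝ) • x) t) := by
    rw [volume_inter_translate (-(c/2 : ℝ) • x)]
    congr 3
    module
  rw [e1, e2]
  refine measure_mono fun z hz => ?_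
  simp only [Set.mem_inter_iff, Metric.mem_ball'] at hz
  have hc := convex_ball z t
  have k1 : -(1/2 : ℝ) • x ∈ Metric.ball z t := hz.1
  have k2 : (1/2 : ℝ) • x ∈ Metric.ball z t := hz.2
  simp only [Set.mem_inter_iff, Metric.mem_ball']
  constructor
  · have := hc k1 k2 (a := (1 + c)/2) (b := (1-c)/2) (by linarith) (by linarith) (by ring)
    rw [← Metric.mem_ball]
    convert this using 1
    module
  · have := hc k1 k2 (a := (1 - c)/2) (b := (1+c)/2) (by linarith) (by linarith) (by ring)
    rw [← Metric.mem_ball]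
    convert this using 1
    module

lemma overlap_antitone (h : ‖x‖ ≤ ‖y‖) : overlap d t y ≤ overlap d t x := by
  rcases eq_or_ne y 0 with rfl | hy
  · have : x = 0 := by simpa using h
    rw [this]
  have hy' : 0 < ‖y‖ := norm_pos_iff.2 hy
  refine (overlap_smul_le (c := ‖x‖ / ‖y‖) (by positivity)
    (div_le_one_of_le₀ h hy'.le)).trans (le_of_eq (overlap_eq_of_norm_eq ?_))
  rw [norm_smul, Real.norm_of_nonneg (by positivity), div_mul_cancel₀ _ hy'.ne']

open scoped Pointwise in
lemma overlap_smul_smul {c : ℝ} (hc : 0 < c) : overlap d (c * t) (c • x) = overlap d t x := by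
  have hb (z : Pt d) : Metric.ball (c • z) (c * t) = c • Metric.ball z t := by
    rw [smul_ball hc.ne', Real.norm_of_nonneg hc.le]
  have h0 := hb 0
  rw [smul_zero] at h0
  unfold overlap
  rw [hb, h0, ← Set.smul_set_inter₀ hc.ne', Measure.addHaar_smul, Measure.addHaar_smul,
    ENNReal.toReal_mul, ENNReal.toReal_mul, mul_div_mul_left]
  rw [ENNReal.toReal_ofReal (abs_nonneg _)]
  positivity

lemma overlap_eq_zero (h : 2 * t ≤ ‖x‖) : overlap d t x = 0 := by
  unfold overlap
  have : Metric.ball (0 : Pt d) t ∩ Metric.ball x t = ∅ := by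
    apply Set.disjoint_iff_inter_eq_empty.1
    apply Metric.ball_disjoint_ball
    rw [dist_zero_left]
    linarith
  simp [this]

lemma one_sub_overlap_le (ht : 0 < t) : 1 - overlap d t x ≤ d * ‖x‖ / (2 * t) := by
  rcases le_or_gt (2 * t) ‖x‖ with h | h
  · rw [overlap_eq_zero h]
    rcases Nat.eq_zero_or_pos d with rfl | hd
    · have : x = 0 := Subsingleton.elim _ _
      rw [this, norm_zero] at h
      linarith
    · have : (1 : ℝ) ≤ d := by exact_mod_cast hd
      rw [sub_zero, le_div_iff₀ (by positivity)]
      nlinarith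
  · set s : ℝ := t - ‖x‖ / 2 with hs
    have hs0 : 0 < s := by rw [hs]; linarith
    have hsub : Metric.ball ((1/2 : ℝ) • x) s ⊆ Metric.ball 0 t ∩ Metric.ball x t := by
      refine Set.subset_inter (Metric.ball_subset_ball' ?_) (Metric.ball_subset_ball' ?_)
      · rw [dist_zero_right, norm_smul, Real.norm_of_nonneg (by norm_num)]
        linarith
      · have : dist ((1/2 : ℝ) • x) x = ‖x‖ / 2 := by
          rw [dist_eq_norm, show (1/2 : ℝ) • x - x = (-(1/2) : ℝ) • x by module, norm_smul,
            Real.norm_eq_abs, abs_neg, abs_of_nonneg (by norm_num)]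
          ring
        rw [this]
        linarith
    have hv : (volume (Metric.ball ((1/2 : ℝ) • x) s)).toReal ≤
        (volume (Metric.ball 0 t ∩ Metric.ball x t)).toReal :=
      ENNReal.toReal_mono volume_inter_ne_top (measure_mono hsub)
    have hv1 : 0 < (volume (Metric.ball (0 : Pt d) 1)).toReal := volume_ball_toReal_pos one_pos
    have hq : (s / t) ^ d ≤ overlap d t x := by
      unfold overlap
      rw [le_div_iff₀ (volume_ball_toReal_pos ht)]
      refine le_trans (le_of_eq ?_) hv
      rw [Measure.addHaar_ball_of_pos volume _ hs0, Measure.addHaar_ball_of_pos volume _ ht,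
        ENNReal.toReal_mul, ENNReal.toReal_mul, ENNReal.toReal_ofReal (by positivity),
        ENNReal.toReal_ofReal (by positivity), finrank_euclideanSpace_fin,
        div_pow]
      field_simp
    have hst : s / t = 1 + (-(‖x‖ / (2 * t))) := by
      rw [hs]; field_simp; ring
    have hb := one_add_mul_le_pow (a := -(‖x‖ / (2 * t))) (by
      have : ‖x‖ / (2 * t) ≤ 1 := div_le_one_of_le₀ h.le (by positivity)
      linarith) d
    rw [← hst] at hb
    have : d * ‖x‖ / (2 * t) = d * (‖x‖ / (2 * t)) := by ring
    rw [this]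
    linarith

lemma measurable_overlap (x : Pt d) : Measurable fun t => overlap d t x := by
  unfold overlap
  refine Measurable.div (Monotone.measurable fun s t hst => ?_)
    (Monotone.measurable fun s t hst => ?_)
  · exact ENNReal.toReal_mono volume_inter_ne_top (measure_mono
      (Set.inter_subset_inter (Metric.ball_subset_ball hst) (Metric.ball_subset_ball hst)))
  · exact ENNReal.toReal_mono volume_ball_ne_top (measure_mono (Metric.ball_subset_ball hst))

end overlap

section bandKernel

variable {d : ℕ} {r R : ℝ} {x y : Pt d}

lemma intervalIntegrable_inv_of_pos (hr : 0 < r) (hR : 0 < R) :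
    IntervalIntegrable (fun t : ℝ => t⁻¹) volume r R := by
  apply intervalIntegral.intervalIntegrable_inv
  · intro t ht h
    exact absurd (h ▸ ht) (by simp [Set.mem_uIcc, hr, hR])
  · exact continuousOn_id

lemma intervalIntegrable_band (hr : 0 < r) (hR : 0 < R) (x : Pt d) :
    IntervalIntegrable (fun t => overlap d t x * t⁻¹) volume r R := by
  refine (intervalIntegrable_inv_of_pos hr hR).mono_fun
    (((measurable_overlap x).mul measurable_inv).aestronglyMeasurable) (.of_forall fun t => ?_)
  simp only [norm_mul]
  refine mul_le_of_le_one_left (norm_nonneg _) ?_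
  rw [Real.norm_of_nonneg overlap_nonneg]
  exact overlap_le_one

lemma wnKernel_eq (n m : ℕ) (x y : Pt d) :
    wnKernel d n m x y = bandKernel d ((2 : ℝ) ^ (-(min n m : ℤ))) 1 (y - x) := by
  unfold wnKernel bandKernel
  rw [intervalIntegral.integral_of_le]
  · simp only [overlap, volume_inter_translate x y]
  · rw [← Nat.cast_min, zpow_neg, zpow_natCast]
    exact inv_le_one_of_one_le₀ (one_le_pow₀ (by norm_num))

lemma bandKernel_add {s : ℝ} (hr : 0 < r) (hs : 0 < s) (hR : 0 < R) :
    bandKernel d r s x + bandKernel d s R x = bandKernel d r R x :=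
  intervalIntegral.integral_add_adjacent_intervals (intervalIntegrable_band hr hs x)
    (intervalIntegrable_band hs hR x)

lemma bandKernel_zero (hr : 0 < r) (hrR : r ≤ R) : bandKernel d r R 0 = Real.log (R / r) := by
  have hR := hr.trans_le hrR
  rw [← integral_inv_of_pos hr hR]
  unfold bandKernel
  refine intervalIntegral.integral_congr fun t ht => ?_
  rw [Set.uIcc_of_le hrR] at ht
  simp [overlap_zero (hr.trans_le ht.1)]

lemma bandKernel_nonneg (hr : 0 < r) (hrR : r ≤ R) : 0 ≤ bandKernel d r R x := by
  refine intervalIntegral.integral_nonneg hrR fun t ht => ?_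
  have := hr.trans_le ht.1
  exact mul_nonneg overlap_nonneg (by positivity)

lemma bandKernel_antitone (hr : 0 < r) (hrR : r ≤ R) (h : ‖x‖ ≤ ‖y‖) :
    bandKernel d r R y ≤ bandKernel d r R x := by
  refine intervalIntegral.integral_mono_on hrR (intervalIntegrable_band hr (hr.trans_le hrR) y)
    (intervalIntegrable_band hr (hr.trans_le hrR) x) fun t ht => ?_
  have := hr.trans_le ht.1
  exact mul_le_mul_of_nonneg_right (overlap_antitone h) (by positivity)

lemma bandKernel_eq_of_norm_eq (h : ‖x‖ = ‖y‖) : bandKernel d r R x = bandKernel d r R y := by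
  unfold bandKernel
  simp only [overlap_eq_of_norm_eq h]

lemma bandKernel_zero_sub_le (hr : 0 < r) (hrR : r ≤ R) :
    bandKernel d r R 0 - bandKernel d r R x ≤ d * ‖x‖ / (2 * r) := by
  have hR := hr.trans_le hrR
  have hint : ∫ t in r..R, (t ^ 2)⁻¹ = r⁻¹ - R⁻¹ := by
    have hd : ∀ t ∈ Set.uIcc r R, HasDerivAt (fun t : ℝ => -t⁻¹) ((t ^ 2)⁻¹) t := by
      intro t ht
      rw [Set.uIcc_of_le hrR] at ht
      exact (hasDerivAt_inv (hr.trans_le ht.1).ne').neg.congr_deriv (neg_neg _)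
    rw [intervalIntegral.integral_eq_sub_of_hasDerivAt hd]
    · ring
    · refine ContinuousOn.intervalIntegrable fun t ht => ?_
      rw [Set.uIcc_of_le hrR] at ht
      have := hr.trans_le ht.1
      exact ((continuousAt_id.pow 2).inv₀ (by simp; positivity)).continuousWithinAt
  unfold bandKernel
  rw [← intervalIntegral.integral_sub (intervalIntegrable_band hr hR 0)
    (intervalIntegrable_band hr hR x)]
  calc ∫ t in r..R, (overlap d t 0 * t⁻¹ - overlap d t x * t⁻¹)
      ≤ ∫ t in r..R, (d * ‖x‖ / 2) * (t ^ 2)⁻¹ := by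
        refine intervalIntegral.integral_mono_on hrR
          ((intervalIntegrable_band hr hR 0).sub (intervalIntegrable_band hr hR x)) ?_ ?_
        · refine ContinuousOn.intervalIntegrable fun t ht => ?_
          rw [Set.uIcc_of_le hrR] at ht
          have := hr.trans_le ht.1
          exact (continuousAt_const.mul
            ((continuousAt_id.pow 2).inv₀ (by simp; positivity))).continuousWithinAt
        · intro t ht
          have ht0 := hr.trans_le ht.1
          rw [overlap_zero ht0, ← sub_mul]
          calc (1 - overlap d t x) * t⁻¹ ≤ (d * ‖x‖ / (2 * t)) * t⁻¹ :=
                mul_le_mul_of_nonneg_right (one_sub_overlap_le ht0) (by positivity)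
            _ = _ := by field_simp
    _ = (d * ‖x‖ / 2) * (r⁻¹ - R⁻¹) := by
        rw [intervalIntegral.integral_const_mul, hint]
    _ ≤ (d * ‖x‖ / 2) * r⁻¹ := by
        have : 0 < R⁻¹ := by positivity
        gcongr; linarith
    _ = _ := by field_simp

lemma log_le_bandKernel_zero_sub {c : ℝ} (hr : 0 < r) (hc : 1 ≤ c) (hcR : c * r ≤ R)
    (hx : 2 * (c * r) ≤ ‖x‖) :
    Real.log c ≤ bandKernel d r R 0 - bandKernel d r R x := by
  have hcr : r ≤ c * r := le_mul_of_one_le_left hr.le hc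
  have h0 := hr.trans_le hcr
  have hR := h0.trans_le hcR
  rw [← bandKernel_add hr h0 hR (x := 0), ← bandKernel_add hr h0 hR (x := x)]
  have h1 : bandKernel d r (c * r) x = 0 := by
    unfold bandKernel
    rw [intervalIntegral.integral_congr (g := fun _ => 0)]
    · simp
    · intro t ht
      rw [Set.uIcc_of_le hcr] at ht
      have := ht.2
      simp [overlap_eq_zero (show 2 * t ≤ ‖x‖ by linarith)]
  have h2 : bandKernel d (c * r) R x ≤ bandKernel d (c * r) R 0 :=
    bandKernel_antitone h0 hcR (by simp)
  rw [h1, bandKernel_zero hr hcr, mul_div_cancel_right₀ _ hr.ne']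
  linarith

lemma bandKernel_scale {c : ℝ} (hc : 0 < c) :
    bandKernel d (c * r) (c * R) (c • x) = bandKernel d r R x := by
  unfold bandKernel
  rw [← intervalIntegral.smul_integral_comp_mul_left, smul_eq_mul,
    ← intervalIntegral.integral_const_mul]
  refine intervalIntegral.integral_congr fun t _ => ?_
  rw [overlap_smul_smul hc, mul_inv]
  field_simp

/-- Quantitative strict monotonicity of the band kernel in the norm, in the range where the
overlap is zero at the lower end of the band and at least one half at the upper end. -/
lemma half_log_le_bandKernel_sub {c : ℝ} (hr : 0 < r) (hc : 1 ≤ c) (hrR : r * c ≤ R)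
    (hx : 2 * r ≤ ‖x‖) (hR : d * ‖x‖ * c ≤ R) (hy : ‖y‖ = c * ‖x‖) :
    Real.log c / 2 ≤ bandKernel d r R x - bandKernel d r R y := by
  have hc0 : 0 < c := by linarith
  have hyx : bandKernel d r R y = bandKernel d (r / c) (R / c) x := by
    rw [bandKernel_eq_of_norm_eq (y := c • x) (by rw [norm_smul, Real.norm_of_nonneg hc0.le, hy]),
      ← bandKernel_scale (r := r / c) (R := R / c) hc0, mul_div_cancel₀ _ hc0.ne',
      mul_div_cancel₀ _ hc0.ne']
  have h1 : 0 < r / c := by positivity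
  have hrle : r ≤ R / c := by rwa [le_div_iff₀ hc0]
  have h2 : 0 < R / c := hr.trans_le hrle
  have hR0 : 0 < R := by
    have := mul_pos h2 hc0
    rwa [div_mul_cancel₀ _ hc0.ne'] at this
  have hRc : R / c ≤ R := div_le_self hR0.le hc
  rw [hyx, ← bandKernel_add hr h2 hR0 (x := x), ← bandKernel_add h1 hr h2 (x := x)]
  have hz : bandKernel d (r / c) r x = 0 := by
    have hle : r / c ≤ r := div_le_self hr.le hc
    unfold bandKernel
    rw [intervalIntegral.integral_congr (g := fun _ => 0)]
    · simp
    · intro t ht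
      rw [Set.uIcc_of_le hle] at ht
      have := ht.2
      simp [overlap_eq_zero (show 2 * t ≤ ‖x‖ by linarith)]
  have hl : Real.log c / 2 ≤ bandKernel d (R / c) R x := by
    have : Real.log c / 2 = ∫ t in (R / c)..R, (1 / 2) * t⁻¹ := by
      rw [intervalIntegral.integral_const_mul, integral_inv_of_pos h2 hR0]
      rw [show R / (R / c) = c by field_simp]
      ring
    rw [this]
    refine intervalIntegral.integral_mono_on hRc
      ((intervalIntegrable_inv_of_pos h2 hR0).const_mul _) (intervalIntegrable_band h2 hR0 x)
      fun t ht => ?_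
    have ht0 : 0 < t := h2.trans_le ht.1
    refine mul_le_mul_of_nonneg_right ?_ (by positivity)
    have h3 := one_sub_overlap_le (x := x) ht0
    have h4 : d * ‖x‖ / (2 * t) ≤ 1 / 2 := by
      rw [div_le_div_iff₀ (by positivity) (by norm_num)]
      have := ht.1
      rw [div_le_iff₀ hc0] at this
      have : d * ‖x‖ ≤ t := le_of_mul_le_mul_right (hR.trans this) hc0
      linarith
    linarith
  rw [hz]
  linarith

end bandKernel

/-- A linear space of centered, jointly Gaussian random variables. -/
structure IsGaussianSpace {Ω : Type} [MeasurableSpace Ω] (P : Measure Ω)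
    (S : Submodule ℝ (Ω → ℝ)) : Prop where
  gaussian : IsGaussianProcess (fun Y : S => (Y : Ω → ℝ)) P
  measurable : ∀ Y ∈ S, Measurable Y
  centered : ∀ Y ∈ S, ∫ ω, Y ω ∂P = 0

namespace IsGaussianSpace

variable {Ω : Type} [MeasurableSpace Ω] {P : Measure Ω} {S : Submodule ℝ (Ω → ℝ)}
  {X Y Z : Ω → ℝ}

lemma hasGaussianLaw (h : IsGaussianSpace P S) (hY : Y ∈ S) : HasGaussianLaw Y P :=
  h.gaussian.hasGaussianLaw_eval ⟨Y, hY⟩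

lemma memLp (h : IsGaussianSpace P S) (hY : Y ∈ S) : MemLp Y 2 P :=
  (h.hasGaussianLaw hY).memLp_two

lemma map_eq (h : IsGaussianSpace P S) (hY : Y ∈ S) :
    P.map Y = gaussianReal 0 (Var[Y; P]).toNNReal := by
  rw [(h.hasGaussianLaw hY).map_eq_gaussianReal, h.centered Y hY]

lemma measure_ge_le [IsProbabilityMeasure P] (h : IsGaussianSpace P S) (hY : Y ∈ S) {v t : ℝ}
    (hv : Var[Y; P] ≤ v) (ht : 0 ≤ t) :
    P {ω | t ≤ Y ω} ≤ ENNReal.ofReal (Real.exp (-t ^ 2 / (2 * v))) := by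
  have hsub : HasSubgaussianMGF Y v.toNNReal P := by
    refine ⟨fun s => ?_, fun s => ?_⟩
    · refine (integrable_map_measure (f := Y) (g := fun x => Real.exp (s * x))
        (by fun_prop) (h.measurable Y hY).aemeasurable).1 ?_
      rw [h.map_eq hY]
      exact integrable_exp_mul_gaussianReal s
    · rw [mgf_gaussianReal (h.map_eq hY), zero_mul, zero_add]
      gcongr
  have := hsub.measure_ge_le ht
  rw [Real.coe_toNNReal _ ((variance_nonneg _ _).trans hv)] at this
  rw [← ofReal_measureReal]
  exact ENNReal.ofReal_le_ofReal this

lemma measure_le_neg_le [IsProbabilityMeasure P] (h : IsGaussianSpace P S) (hY : Y ∈ S) {v t : ℝ}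
    (hv : Var[Y; P] ≤ v) (ht : 0 ≤ t) :
    P {ω | Y ω ≤ -t} ≤ ENNReal.ofReal (Real.exp (-t ^ 2 / (2 * v))) := by
  have := h.measure_ge_le (S.neg_mem hY) (v := v) (by rwa [variance_neg]) ht
  convert this using 3
  ext ω
  simp [le_neg]

lemma measure_abs_ge_le [IsProbabilityMeasure P] (h : IsGaussianSpace P S) (hY : Y ∈ S) {v t : ℝ}
    (hv : Var[Y; P] ≤ v) (ht : 0 ≤ t) :
    P {ω | t ≤ |Y ω|} ≤ 2 * ENNReal.ofReal (Real.exp (-t ^ 2 / (2 * v))) := by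
  have : {ω | t ≤ |Y ω|} = {ω | t ≤ Y ω} ∪ {ω | Y ω ≤ -t} := by
    ext ω
    simp [le_abs, le_neg]
  rw [this, two_mul]
  exact (measure_union_le _ _).trans
    (add_le_add (h.measure_ge_le hY hv ht) (h.measure_le_neg_le hY hv ht))

lemma cov_sub_left [IsProbabilityMeasure P] (h : IsGaussianSpace P S) (hX : X ∈ S) (hY : Y ∈ S)
    (hZ : Z ∈ S) : cov[X - Y, Z; P] = cov[X, Z; P] - cov[Y, Z; P] :=
  covariance_sub_left (h.memLp hX) (h.memLp hY) (h.memLp hZ)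

lemma cov_sub_right [IsProbabilityMeasure P] (h : IsGaussianSpace P S) (hX : X ∈ S) (hY : Y ∈ S)
    (hZ : Z ∈ S) : cov[Z, X - Y; P] = cov[Z, X; P] - cov[Z, Y; P] :=
  covariance_sub_right (h.memLp hZ) (h.memLp hX) (h.memLp hY)

lemma iIndepFun [IsProbabilityMeasure P] (h : IsGaussianSpace P S) {T : Type*} {A : T → Type*}
    (F : (t : T) → A t → Ω → ℝ) (hF : ∀ t a, F t a ∈ S)
    (hcov : ∀ t₁ t₂, t₁ ≠ t₂ → ∀ a₁ a₂, cov[F t₁ a₁, F t₂ a₂; P] = 0) :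
    iIndepFun (fun t ω a => F t a ω) P := by
  refine IsGaussianProcess.iIndepFun_of_covariance_eq_zero ?_
    (fun t a => (h.measurable _ (hF t a)).aemeasurable) hcov
  exact h.gaussian.comp_right (fun p : (t : T) × A t => ⟨F p.1 p.2, hF p.1 p.2⟩)

lemma indepFun [IsProbabilityMeasure P] (h : IsGaussianSpace P S) {A B : Type*}
    (F : A → Ω → ℝ) (G : B → Ω → ℝ) (hF : ∀ a, F a ∈ S) (hG : ∀ b, G b ∈ S)
    (hcov : ∀ a b, cov[F a, G b; P] = 0) :
    IndepFun (fun ω a => F a ω) (fun ω b => G b ω) P := by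
  refine IsGaussianProcess.indepFun_of_covariance_eq_zero ?_
    (fun a => (h.measurable _ (hF a)).aemeasurable)
    (fun b => (h.measurable _ (hG b)).aemeasurable) hcov
  have := h.gaussian.comp_right
    (Sum.elim (fun a => (⟨F a, hF a⟩ : S)) (fun b => ⟨G b, hG b⟩))
  have he : (fun Y : S => (Y : Ω → ℝ)) ∘
      Sum.elim (fun a => (⟨F a, hF a⟩ : S)) (fun b => ⟨G b, hG b⟩) = Sum.elim F G := by
    ext p ω
    rcases p with a | b <;> rfl
  rwa [he] at this

end IsGaussianSpace

section field

/-- The linear span of the random variables `h_n(x)` with `n ≥ 1`. -/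
def fieldSpan {d : ℕ} {Ω : Type} (h : ℕ → Pt d → Ω → ℝ) : Submodule ℝ (Ω → ℝ) :=
  Submodule.span ℝ (Set.range fun p : {p : ℕ × Pt d // 1 ≤ p.1} => h p.1.1 p.1.2)

lemma mem_fieldSpan {d : ℕ} {Ω : Type} {h : ℕ → Pt d → Ω → ℝ} {n : ℕ} (hn : 1 ≤ n) (x : Pt d) :
    h n x ∈ fieldSpan h :=
  Submodule.subset_span ⟨⟨(n, x), hn⟩, rfl⟩

variable {d : ℕ} {Ω : Type} [MeasurableSpace Ω] {P : Measure Ω} {h : ℕ → Pt d → Ω → ℝ}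

lemma wnKernel_nonneg (n m : ℕ) (x y : Pt d) : 0 ≤ wnKernel d n m x y := by
  rw [wnKernel_eq]
  apply bandKernel_nonneg (by positivity)
  rw [← Nat.cast_min, zpow_neg, zpow_natCast]
  exact inv_le_one_of_one_le₀ (one_le_pow₀ (by norm_num))

lemma wnKernel_comm (n m : ℕ) (x y : Pt d) : wnKernel d n m x y = wnKernel d m n y x := by
  unfold wnKernel
  simp only [min_comm (n : ℤ), Set.inter_comm (Metric.ball x _)]

lemma isGaussianProcess_field [IsProbabilityMeasure P] (hf : IsWhiteNoiseField d P h) :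
    IsGaussianProcess (fun p : {p : ℕ × Pt d // 1 ≤ p.1} => h p.1.1 p.1.2) P := by
  classical
  obtain ⟨hm, hg, -⟩ := hf
  refine ⟨fun I => ⟨isGaussian_of_map_eq_gaussianReal fun L => ?_⟩⟩
  have hmeas : Measurable fun ω => I.restrict
      fun p : {p : ℕ × Pt d // 1 ≤ p.1} => h p.1.1 p.1.2 ω :=
    measurable_pi_lambda _ fun i => hm _ _
  rw [Measure.map_map L.continuous.measurable hmeas]
  have key := hg I.card (fun i => (I.equivFin.symm i).1.1)
    (fun i => L (Pi.single (I.equivFin.symm i) 1)) (fun i => (I.equivFin.symm i).1.2)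
  refine ⟨_, _, (Eq.trans ?_ key)⟩
  congr 1
  ext ω
  have hL (x : I → ℝ) : L x = ∑ i, L (Pi.single i 1) * x i := by
    conv_lhs => rw [pi_eq_sum_univ' x, map_sum]
    simp [mul_comm]
  rw [Function.comp_apply, hL,
    Equiv.sum_comp I.equivFin.symm (fun i => L (Pi.single i 1) * h i.1.1.1 i.1.1.2 ω)]
  rfl

lemma map_field (hf : IsWhiteNoiseField d P h) {n : ℕ} (hn : 1 ≤ n) (x : Pt d) :
    P.map (h n x) = gaussianReal 0 (wnKernel d n n x x).toNNReal := by
  have := hf.2.1 1 (fun _ => (n, x)) (fun _ => 1) (by simpa using hn)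
  simpa using this

lemma map_field_add (hf : IsWhiteNoiseField d P h) {n m : ℕ} (hn : 1 ≤ n) (hm : 1 ≤ m)
    (x y : Pt d) :
    P.map (h n x + h m y) = gaussianReal 0
      (wnKernel d n n x x + 2 * wnKernel d n m x y + wnKernel d m m y y).toNNReal := by
  have := hf.2.1 2 ![(n, x), (m, y)] (fun _ => 1) (by
    intro i; fin_cases i <;> simpa)
  simp only [Fin.sum_univ_two, one_mul, Matrix.cons_val_zero, Matrix.cons_val_one] at this
  rw [wnKernel_comm m n y x] at this
  rw [show wnKernel d n n x x + 2 * wnKernel d n m x y + wnKernel d m m y y =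
    wnKernel d n n x x + wnKernel d n m x y + (wnKernel d n m x y + wnKernel d m m y y) by ring]
  exact this

lemma isGaussianSpace_fieldSpan [IsProbabilityMeasure P] (hf : IsWhiteNoiseField d P h) :
    IsGaussianSpace P (fieldSpan h) := by
  have hp := isGaussianProcess_field hf
  refine ⟨?_, ?_, ?_⟩
  · refine hp.of_isGaussianProcess fun Y => ?_
    obtain ⟨c, hc⟩ := Finsupp.mem_span_range_iff_exists_finsupp.1 Y.2
    refine ⟨c.support, ∑ i, c i.1 • ContinuousLinearMap.proj (R := ℝ) i, fun ω => ?_⟩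
    rw [← hc, Finsupp.sum, Finset.sum_apply, ← Finset.sum_coe_sort c.support]
    simp
  · intro Y hY
    induction hY using Submodule.span_induction with
    | mem x hx => obtain ⟨p, rfl⟩ := hx; exact hf.1 _ _
    | zero => exact measurable_zero
    | add x y _ _ hx hy => exact hx.add hy
    | smul a x _ hx => exact hx.const_smul a
  · intro Y hY
    suffices Integrable Y P ∧ ∫ ω, Y ω ∂P = 0 from this.2
    induction hY using Submodule.span_induction with
    | mem x hx =>
      obtain ⟨p, rfl⟩ := hx
      refine ⟨(hp.hasGaussianLaw_eval p).integrable, ?_⟩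
      have := integral_map (hf.1 p.1.1 p.1.2).aemeasurable (μ := P) (f := id) (by fun_prop)
      simp only [id] at this
      rw [← this, map_field hf p.2, integral_id_gaussianReal]
    | zero => simp
    | add x y _ _ hx hy => exact ⟨hx.1.add hy.1, by simp [integral_add hx.1 hy.1, hx.2, hy.2]⟩
    | smul a x _ hx => exact ⟨hx.1.smul a, by simp [integral_const_mul, hx.2]⟩

lemma variance_of_map_eq [IsProbabilityMeasure P] {Y : Ω → ℝ} (hY : Measurable Y) {v : ℝ}
    (hv : 0 ≤ v) (h : P.map Y = gaussianReal 0 v.toNNReal) : Var[Y; P] = v := by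
  have := variance_map (μ := P) (X := id) (Y := Y) (by fun_prop) hY.aemeasurable
  rw [Function.id_comp] at this
  rw [← this, h, variance_id_gaussianReal, Real.coe_toNNReal _ hv]

lemma covariance_field [IsProbabilityMeasure P] (hf : IsWhiteNoiseField d P h) {n m : ℕ}
    (hn : 1 ≤ n) (hm : 1 ≤ m) (x y : Pt d) :
    cov[h n x, h m y; P] = wnKernel d n m x y := by
  have hG := isGaussianSpace_fieldSpan hf
  have hx := mem_fieldSpan (h := h) hn x
  have hy := mem_fieldSpan (h := h) hm y
  have h1 := variance_of_map_eq (hf.1 n x) (wnKernel_nonneg _ _ _ _) (map_field hf hn x)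
  have h2 := variance_of_map_eq (hf.1 m y) (wnKernel_nonneg _ _ _ _) (map_field hf hm y)
  have h3 := variance_of_map_eq ((hf.1 n x).add (hf.1 m y))
    (by have := wnKernel_nonneg n n x x; have := wnKernel_nonneg n m x y
        have := wnKernel_nonneg m m y y; linarith) (map_field_add hf hn hm x y)
  rw [variance_add (hG.memLp hx) (hG.memLp hy)] at h3
  linarith

end field

/-- The `σ`-algebra generated by a random field. -/
abbrev fieldSigma {d : ℕ} {Ω : Type} (X : Pt d → Ω → ℝ) : MeasurableSpace Ω :=
  MeasurableSpace.comap (fun ω x => X x ω) MeasurableSpace.pi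

lemma measurable_fieldSigma {d : ℕ} {Ω : Type} (X : Pt d → Ω → ℝ) (x : Pt d) :
    Measurable[fieldSigma X] (X x) := by
  have h1 : Measurable[fieldSigma X] (fun ω x => X x ω) := comap_measurable _
  exact (measurable_pi_apply x).comp h1

lemma norm_le_sqrt_mul {d : ℕ} {x : Pt d} {c : ℝ} (hc : 0 ≤ c) (h : ∀ i, |x i| ≤ c) :
    ‖x‖ ≤ Real.sqrt d * c := by
  rw [EuclideanSpace.norm_eq, ← Real.sqrt_sq hc, ← Real.sqrt_mul (Nat.cast_nonneg _)]
  apply Real.sqrt_le_sqrt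
  calc ∑ i, ‖x i‖ ^ 2 ≤ ∑ _i : Fin d, c ^ 2 :=
        Finset.sum_le_sum fun i _ => by
          rw [Real.norm_eq_abs]; exact pow_le_pow_left₀ (abs_nonneg _) (h i) 2
    _ = d * c ^ 2 := by simp

section chaining

variable {d : ℕ}

/-- The vertex with integer coordinates `u` of the grid of mesh `v / 2 ^ l` with origin `z`. -/
noncomputable def gridPt (z : Pt d) (v : ℝ) (l : ℕ) (u : Fin d → ℕ) : Pt d :=
  WithLp.toLp 2 fun i => z i + v / 2 ^ l * u i

lemma norm_gridPt_sub_parent_le (z : Pt d) {v : ℝ} (hv : 0 ≤ v) (l : ℕ) (u : Fin d → ℕ) :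
    ‖gridPt z v (l + 1) u - gridPt z v l (fun i => u i / 2)‖ ≤ Real.sqrt d * (v / 2 ^ (l + 1)) := by
  refine norm_le_sqrt_mul (by positivity) fun i => ?_
  have h1 : ((u i % 2 : ℕ) : ℝ) = u i - 2 * ((u i / 2 : ℕ) : ℝ) := by
    have := Nat.mod_add_div (u i) 2
    rw [eq_sub_iff_add_eq]
    exact_mod_cast this
  have h2 : ((u i % 2 : ℕ) : ℝ) ≤ 1 := by
    have := Nat.mod_lt (u i) two_pos
    exact_mod_cast Nat.lt_succ_iff.1 this
  have h3 : (gridPt z v (l + 1) u - gridPt z v l (fun i => u i / 2)) i =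
      v / 2 ^ (l + 1) * ((u i % 2 : ℕ) : ℝ) := by
    rw [h1]
    simp only [gridPt, PiLp.sub_apply]
    field_simp
    ring
  rw [h3, abs_of_nonneg (by positivity)]
  exact mul_le_of_le_one_right (by positivity) h2

/-- The integer coordinates of the grid vertex below `x`. -/
noncomputable def gridIdx (z : Pt d) (v : ℝ) (l : ℕ) (x : Pt d) : Fin d → ℕ :=
  fun i => ⌊2 ^ l * ((x i - z i) / v)⌋₊

lemma gridIdx_parent (z : Pt d) (v : ℝ) (l : ℕ) (x : Pt d) :
    (fun i => gridIdx z v (l + 1) x i / 2) = gridIdx z v l x := by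
  ext i
  simp only [gridIdx]
  rw [← Nat.floor_div_natCast]
  congr 1
  push_cast
  ring

lemma tendsto_gridPt_gridIdx {z x : Pt d} {v : ℝ} (hv : 0 < v) (hx : ∀ i, z i ≤ x i) :
    Filter.Tendsto (fun l => gridPt z v l (gridIdx z v l x)) Filter.atTop (nhds x) := by
  rw [tendsto_iff_norm_sub_tendsto_zero]
  refine squeeze_zero (fun _ => norm_nonneg _)
    (g := fun l => Real.sqrt d * (v * (1 / 2 : ℝ) ^ l)) (fun l => ?_) ?_
  · refine norm_le_sqrt_mul (by positivity) fun i => ?_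
    simp only [gridPt, gridIdx, PiLp.sub_apply]
    set a : ℝ := 2 ^ l * ((x i - z i) / v) with ha
    have h0 : 0 ≤ a := by
      have := hx i
      rw [ha]
      have : 0 ≤ x i - z i := by linarith
      positivity
    have h1 := Nat.floor_le h0
    have h2 := Nat.lt_floor_add_one a
    have h3 : z i + v / 2 ^ l * (⌊a⌋₊ : ℝ) - x i = v / 2 ^ l * (⌊a⌋₊ - a) := by
      rw [ha]; field_simp; ring
    rw [h3, abs_mul, abs_of_nonneg (show 0 ≤ v / 2 ^ l by positivity), one_div, inv_pow,
      ← div_eq_mul_inv]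
    refine mul_le_of_le_one_right (by positivity) ?_
    rw [abs_le]
    constructor <;> linarith
  · have := tendsto_pow_atTop_nhds_zero_of_lt_one (r := (1 / 2 : ℝ)) (by norm_num) (by norm_num)
    have := (this.const_mul v).const_mul (Real.sqrt d)
    simpa using this

lemma abs_sub_le_of_chain {X : Pt d → ℝ} (hc : Continuous X) {z x : Pt d} {v s : ℝ} (hv : 0 < v)
    (hs : 0 ≤ s) (hx : ∀ i, z i ≤ x i) (hx' : ∀ i, x i < z i + v)
    (h : ∀ l : ℕ, ∀ u : Fin d → ℕ, (∀ i, u i < 2 ^ (l + 1)) →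
      |X (gridPt z v (l + 1) u) - X (gridPt z v l (fun i => u i / 2))| ≤ s * (3 / 4) ^ l) :
    |X x - X z| ≤ 4 * s := by
  have hfin (l : ℕ) : |X (gridPt z v l (gridIdx z v l x)) - X z| ≤
      s * ∑ k ∈ Finset.range l, (3 / 4 : ℝ) ^ k := by
    induction l with
    | zero =>
      have : gridPt z v 0 (gridIdx z v 0 x) = z := by
        ext i
        have h0 : ⌊(x i - z i) / v⌋₊ = 0 := by
          rw [Nat.floor_eq_zero, div_lt_one hv]
          linarith [hx' i]
        simp [gridPt, gridIdx, h0]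
      simp [this]
    | succ l ih =>
      have h1 := h l (gridIdx z v (l + 1) x) fun i => by
        simp only [gridIdx]
        have h2 := hx i
        have h3 := hx' i
        rw [Nat.floor_lt]
        · push_cast
          refine mul_lt_of_lt_one_right (by positivity) ?_
          rw [div_lt_one hv]
          linarith
        · have : 0 ≤ x i - z i := by linarith
          positivity
      rw [gridIdx_parent] at h1
      rw [Finset.sum_range_succ, mul_add]
      have := abs_sub_le (X (gridPt z v (l + 1) (gridIdx z v (l + 1) x)))
        (X (gridPt z v l (gridIdx z v l x))) (X z)
      linarith
  have hlim : Filter.Tendsto (fun l => |X (gridPt z v l (gridIdx z v l x)) - X z|) Filter.atTop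
      (nhds |X x - X z|) :=
    (((hc.tendsto x).comp (tendsto_gridPt_gridIdx hv hx)).sub_const _).abs
  refine le_of_tendsto' hlim fun l => (hfin l).trans ?_
  have : ∑ k ∈ Finset.range l, (3 / 4 : ℝ) ^ k ≤ 4 := by
    have := (summable_geometric_of_lt_one (r := (3 / 4 : ℝ)) (by norm_num)
      (by norm_num)).sum_le_tsum
      (Finset.range l) (fun _ _ => by positivity)
    rw [tsum_geometric_of_lt_one (by norm_num) (by norm_num)] at this
    norm_num at this
    exact this
  nlinarith

variable {Ω : Type} [MeasurableSpace Ω] {P : Measure Ω}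

lemma measure_chain_level_le {X : Pt d → Ω → ℝ} {κ w lam B : ℝ} (hκ : 0 < κ) (hw : 0 < w)
    (hlam : 0 < lam)
    (htail : ∀ x y t v, 0 ≤ t → κ * ‖x - y‖ ≤ v →
      P {ω | t ≤ |X x ω - X y ω|} ≤ 2 * ENNReal.ofReal (Real.exp (-t ^ 2 / (2 * v))))
    (hd : 0 < d) (hB : B ≤ lam ^ 2 / (128 * κ * Real.sqrt d * w)) (hB' : 16 * ((d : ℝ) + 1) ≤ B)
    (z : Pt d) (l : ℕ) (u : Fin d → ℕ) :
    P {ω | lam / 8 * (3 / 4) ^ l ≤ |X (gridPt z (2 * w) (l + 1) u) ω -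
      X (gridPt z (2 * w) l (fun i => u i / 2)) ω|} ≤
      2 * (ENNReal.ofReal (Real.exp (-B)) * (2⁻¹) ^ (l * (d + 1))) := by
  have hd' : (0 : ℝ) < Real.sqrt d := Real.sqrt_pos.2 (by exact_mod_cast hd)
  have h1 := norm_gridPt_sub_parent_le z (v := 2 * w) (by positivity) l u
  refine (htail _ _ _ _ (by positivity) (mul_le_mul_of_nonneg_left h1 hκ.le)).trans ?_
  gcongr
  have h2 : ((2 : ENNReal)⁻¹) ^ (l * (d + 1)) = ENNReal.ofReal ((1 / 2 : ℝ) ^ (l * (d + 1))) := by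
    rw [ENNReal.ofReal_pow (by norm_num), one_div, ENNReal.ofReal_inv_of_pos (by norm_num)]
    simp
  rw [h2, ← ENNReal.ofReal_mul (Real.exp_pos _).le]
  apply ENNReal.ofReal_le_ofReal
  set C := lam ^ 2 / (128 * κ * Real.sqrt d * w) with hC
  have h3 : -(lam / 8 * (3 / 4) ^ l) ^ 2 / (2 * (κ * (Real.sqrt d * (2 * w / 2 ^ (l + 1))))) =
      -(C * (9 / 8) ^ l) := by
    rw [hC, show (9 / 8 : ℝ) = (3 / 4) ^ 2 * 2 by norm_num, mul_pow ((3 / 4 : ℝ) ^ 2), ← pow_mul,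
      mul_comm 2 l, pow_mul, pow_succ (2 : ℝ) l]
    field_simp
    ring
  rw [h3]
  have h4 : 1 + (l : ℝ) * (1 / 8) ≤ (9 / 8) ^ l := by
    have := one_add_mul_le_pow (a := (1 / 8 : ℝ)) (by norm_num) l
    norm_num at this ⊢
    exact this
  have hB0 : 0 ≤ B := by
    have : (0 : ℝ) ≤ d := Nat.cast_nonneg _
    linarith
  have h5 : B * (1 + l * (1 / 8)) ≤ C * (9 / 8) ^ l := by gcongr
  have h6 : Real.exp (-1) ≤ 1 / 2 := by
    have := Real.exp_one_gt_d9
    rw [Real.exp_neg, one_div]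
    gcongr
    linarith
  calc Real.exp (-(C * (9 / 8) ^ l)) ≤ Real.exp (-B + ((l * (d + 1) : ℕ) : ℝ) * (-1)) := by
        apply Real.exp_le_exp.2
        push_cast
        have hl : (0 : ℝ) ≤ l := Nat.cast_nonneg _
        nlinarith
    _ = Real.exp (-B) * Real.exp (-1) ^ (l * (d + 1)) := by
        rw [Real.exp_add, Real.exp_nat_mul]
    _ ≤ _ := by gcongr

/-- A quantitative modulus of continuity for random fields with Gaussian increments. -/
lemma exists_modulus_event {X : Pt d → Ω → ℝ} (hc : ∀ ω, Continuous fun x => X x ω)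
    {κ w lam B : ℝ} (hκ : 0 < κ) (hw : 0 < w) (hlam : 0 < lam)
    (htail : ∀ x y t v, 0 ≤ t → κ * ‖x - y‖ ≤ v →
      P {ω | t ≤ |X x ω - X y ω|} ≤ 2 * ENNReal.ofReal (Real.exp (-t ^ 2 / (2 * v))))
    (hd : 0 < d) (hB : B ≤ lam ^ 2 / (128 * κ * Real.sqrt d * w)) (hB' : 16 * ((d : ℝ) + 1) ≤ B)
    (b : Pt d) (K : ℕ) :
    ∃ bad : Set Ω, MeasurableSet[fieldSigma X] bad ∧
      P bad ≤ (2 * K + 1 : ℕ) ^ d * (2 ^ (d + 2) * ENNReal.ofReal (Real.exp (-B))) ∧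
      ∀ ω ∉ bad, ∀ x y : Pt d, (∀ i, |x i - b i| ≤ K * w) → (∀ i, |y i - b i| ≤ K * w) →
        (∀ i, |x i - y i| ≤ w) → |X x ω - X y ω| ≤ lam := by
  classical
  let corner (k : Fin d → ℤ) : Pt d := WithLp.toLp 2 fun i => b i + w * k i
  let ev (k : Fin d → ℤ) (l : ℕ) (u : Fin d → ℕ) : Set Ω :=
    {ω | lam / 8 * (3 / 4) ^ l ≤ |X (gridPt (corner k) (2 * w) (l + 1) u) ω -
      X (gridPt (corner k) (2 * w) l (fun i => u i / 2)) ω|}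
  let Ks : Finset (Fin d → ℤ) := Fintype.piFinset fun _ => Finset.Icc (-(K : ℤ)) K
  let Us (l : ℕ) : Finset (Fin d → ℕ) := Fintype.piFinset fun _ => Finset.range (2 ^ (l + 1))
  refine ⟨⋃ k ∈ Ks, ⋃ l, ⋃ u ∈ Us l, ev k l u, ?_, ?_, ?_⟩
  · refine Finset.measurableSet_biUnion _ fun k _ => MeasurableSet.iUnion fun l =>
      Finset.measurableSet_biUnion _ fun u _ => ?_
    have h1 := measurable_fieldSigma X (gridPt (corner k) (2 * w) (l + 1) u)
    have h2 := measurable_fieldSigma X (gridPt (corner k) (2 * w) l (fun i => u i / 2))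
    have h3 : Measurable[fieldSigma X] fun ω =>
        |X (gridPt (corner k) (2 * w) (l + 1) u) ω -
          X (gridPt (corner k) (2 * w) l (fun i => u i / 2)) ω| :=
      continuous_abs.measurable.comp (h1.sub h2)
    exact h3 measurableSet_Ici
  · have hcard : (Ks.card : ENNReal) = (2 * K + 1 : ℕ) ^ d := by
      simp only [Ks, Fintype.card_piFinset, Int.card_Icc, Finset.prod_const, Finset.card_univ,
        Fintype.card_fin]
      rw [show (K + 1 - -(K : ℤ)).toNat = 2 * K + 1 by omega]
      push_cast
      rfl
    have hk (k : Fin d → ℤ) : P (⋃ l, ⋃ u ∈ Us l, ev k l u) ≤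
        2 ^ (d + 2) * ENNReal.ofReal (Real.exp (-B)) := by
      calc P (⋃ l, ⋃ u ∈ Us l, ev k l u) ≤ ∑' l, P (⋃ u ∈ Us l, ev k l u) := measure_iUnion_le _
        _ ≤ ∑' l : ℕ, (2 ^ (d + 1) * ENNReal.ofReal (Real.exp (-B))) * (2⁻¹) ^ l := by
          refine ENNReal.tsum_le_tsum fun l => ?_
          calc P (⋃ u ∈ Us l, ev k l u) ≤ ∑ u ∈ Us l, P (ev k l u) :=
                measure_biUnion_finset_le _ _
            _ ≤ ∑ _u ∈ Us l, 2 * (ENNReal.ofReal (Real.exp (-B)) * (2⁻¹) ^ (l * (d + 1))) :=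
                Finset.sum_le_sum fun u _ =>
                  measure_chain_level_le hκ hw hlam htail hd hB hB' _ l u
            _ = (2 ^ (d + 1) * ENNReal.ofReal (Real.exp (-B))) *
                  ((2 : ENNReal) ^ (l * d) * 2⁻¹ ^ (l * (d + 1))) := by
                rw [Finset.sum_const, nsmul_eq_mul]
                simp only [Us, Fintype.card_piFinset, Finset.card_range, Finset.prod_const,
                  Finset.card_univ, Fintype.card_fin]
                push_cast
                ring
            _ = _ := by
                congr 1
                rw [mul_add, mul_one, pow_add, ← mul_assoc, ← mul_pow,
                  ENNReal.mul_inv_cancel (by norm_num) (by norm_num), one_pow, one_mul]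
        _ = _ := by
          rw [ENNReal.tsum_mul_left, ENNReal.tsum_geometric, ENNReal.one_sub_inv_two, inv_inv]
          ring
    calc P (⋃ k ∈ Ks, ⋃ l, ⋃ u ∈ Us l, ev k l u)
        ≤ ∑ k ∈ Ks, P (⋃ l, ⋃ u ∈ Us l, ev k l u) := measure_biUnion_finset_le _ _
      _ ≤ ∑ _k ∈ Ks, 2 ^ (d + 2) * ENNReal.ofReal (Real.exp (-B)) :=
          Finset.sum_le_sum fun k _ => hk k
      _ = _ := by rw [Finset.sum_const, nsmul_eq_mul, hcard]
  · intro ω hω x y hx hy hxy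
    let k : Fin d → ℤ := fun i => ⌊(min (x i) (y i) - b i) / w⌋
    have hkK : k ∈ Ks := by
      rw [Fintype.mem_piFinset]
      intro i
      have h1 := abs_le.1 (hx i)
      have h2 := abs_le.1 (hy i)
      rw [Finset.mem_Icc]
      constructor
      · rw [Int.le_floor, le_div_iff₀ hw]
        push_cast
        have : -(K * w) ≤ min (x i) (y i) - b i := by
          rw [le_sub_iff_add_le, le_min_iff]
          constructor <;> linarith
        linarith
      · rw [← Int.lt_add_one_iff, Int.floor_lt, div_lt_iff₀ hw]
        push_cast
        have := min_le_left (x i) (y i)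
        nlinarith
    have hlow (i : Fin d) : corner k i ≤ min (x i) (y i) ∧
        min (x i) (y i) < corner k i + w := by
      have h1 := Int.floor_le ((min (x i) (y i) - b i) / w)
      have h2 := Int.lt_floor_add_one ((min (x i) (y i) - b i) / w)
      rw [le_div_iff₀ hw] at h1
      rw [div_lt_iff₀ hw] at h2
      simp only [corner, k]
      constructor <;> linarith
    have hgood (l : ℕ) (u : Fin d → ℕ) (hu : ∀ i, u i < 2 ^ (l + 1)) :
        |X (gridPt (corner k) (2 * w) (l + 1) u) ω -
          X (gridPt (corner k) (2 * w) l (fun i => u i / 2)) ω| ≤ lam / 8 * (3 / 4) ^ l := by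
      by_contra hcon
      apply hω
      simp only [Set.mem_iUnion]
      refine ⟨k, hkK, l, u, ?_, (not_le.1 hcon).le⟩
      rw [Fintype.mem_piFinset]
      exact fun i => Finset.mem_range.2 (hu i)
    have key (q : Pt d) (hq : ∀ i, min (x i) (y i) ≤ q i ∧ q i ≤ min (x i) (y i) + w) :
        |X q ω - X (corner k) ω| ≤ 4 * (lam / 8) :=
      abs_sub_le_of_chain (hc ω) (v := 2 * w) (by positivity) (by positivity)
        (fun i => (hlow i).1.trans (hq i).1) (fun i => by
          have := (hlow i).2; have := (hq i).2; linarith) hgood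
    have kx := key x fun i => ⟨min_le_left _ _, by
      have := abs_le.1 (hxy i)
      rw [← sub_le_iff_le_add, le_min_iff]
      constructor <;> linarith⟩
    have ky := key y fun i => ⟨min_le_right _ _, by
      have := abs_le.1 (hxy i)
      rw [← sub_le_iff_le_add, le_min_iff]
      constructor <;> linarith⟩
    rw [abs_le] at kx ky ⊢
    constructor <;> linarith [kx.1, kx.2, ky.1, ky.2]

end chaining

section generic

variable {Ω : Type} {α β : Type*}

/-- If the simultaneous occurrence of the events indexed by `S` has probability at most `ε ^ |S|`,
then at least `k` events occur with probability at most `2 ^ |T| * ε ^ k`. -/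
lemma measure_card_le {mΩ : MeasurableSpace Ω} {P : Measure Ω} {ι : Type*} [DecidableEq ι]
    (T : Finset ι) (Ev : ι → Set Ω) (ε : ENNReal)
    (h : ∀ S ⊆ T, P (⋂ i ∈ S, Ev i) ≤ ε ^ S.card) (k : ℕ) :
    P (⋃ S ∈ T.powersetCard k, ⋂ i ∈ S, Ev i) ≤ 2 ^ T.card * ε ^ k := by
  refine (measure_biUnion_finset_le _ _).trans ?_
  calc ∑ S ∈ T.powersetCard k, P (⋂ i ∈ S, Ev i) ≤ ∑ S ∈ T.powersetCard k, ε ^ k :=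
        Finset.sum_le_sum fun S hS => by
          rw [Finset.mem_powersetCard] at hS
          exact hS.2 ▸ h S hS.1
    _ ≤ 2 ^ T.card * ε ^ k := by
        rw [Finset.sum_const, Finset.card_powersetCard, nsmul_eq_mul]
        gcongr
        exact_mod_cast (Nat.choose_le_two_pow _ _)

lemma card_filter_lt_of_notMem [DecidableEq α] (T : Finset α) (Ev : α → Set Ω) {k : ℕ} {ω : Ω}
    [DecidablePred fun i => ω ∈ Ev i]
    (h : ω ∉ ⋃ S ∈ T.powersetCard k, ⋂ i ∈ S, Ev i) :
    (T.filter fun i => ω ∈ Ev i).card < k := by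
  by_contra! hk
  obtain ⟨S, hS, hSk⟩ := Finset.exists_subset_card_eq hk
  refine h (Set.mem_iUnion₂.2 ⟨S, ?_, Set.mem_iInter₂.2 fun i hi => ?_⟩)
  · exact Finset.mem_powersetCard.2 ⟨hS.trans (Finset.filter_subset _ _), hSk⟩
  · exact (Finset.mem_filter.1 (hS hi)).2

/-- `f` is measurable for the discrete `σ`-algebra and takes countably many values. -/
structure IsCountablyValued (m : MeasurableSpace Ω) (f : Ω → α) : Prop where
  countable : (Set.range f).Countable
  measurableSet_fiber : ∀ y, MeasurableSet[m] (f ⁻¹' {y})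

namespace IsCountablyValued

variable {m m' : MeasurableSpace Ω} {f : Ω → α}

lemma mono (hf : IsCountablyValued m f) (h : m ≤ m') : IsCountablyValued m' f :=
  ⟨hf.countable, fun y => h _ (hf.measurableSet_fiber y)⟩

lemma const (c : α) : IsCountablyValued m fun _ : Ω => c :=
  ⟨(Set.countable_singleton c).mono (by rintro _ ⟨ω, rfl⟩; rfl), fun _ => .const _⟩

lemma measurableSet_mem (hf : IsCountablyValued m f) {Bad : α → Set Ω}
    (hB : ∀ y, MeasurableSet[m] (Bad y)) : MeasurableSet[m] {ω | ω ∈ Bad (f ω)} := by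
  have : {ω | ω ∈ Bad (f ω)} = ⋃ y ∈ Set.range f, f ⁻¹' {y} ∩ Bad y := by
    ext ω
    simp only [Set.mem_ofPred_eq, Set.mem_iUnion, Set.mem_inter_iff, Set.mem_preimage,
      Set.mem_singleton_iff, exists_prop]
    exact ⟨fun h => ⟨_, ⟨ω, rfl⟩, rfl, h⟩, fun ⟨y, _, h1, h2⟩ => h1 ▸ h2⟩
  rw [this]
  exact .biUnion hf.countable fun y _ => (hf.measurableSet_fiber y).inter (hB y)

lemma bind (hf : IsCountablyValued m f) {V : α → Ω → β} (hV : ∀ y, IsCountablyValued m (V y)) :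
    IsCountablyValued m fun ω => V (f ω) ω := by
  constructor
  · refine (hf.countable.biUnion fun y _ => (hV y).countable).mono ?_
    rintro _ ⟨ω, rfl⟩
    exact Set.mem_biUnion ⟨ω, rfl⟩ ⟨ω, rfl⟩
  · exact fun z => hf.measurableSet_mem (Bad := fun y => V y ⁻¹' {z})
      fun y => (hV y).measurableSet_fiber z

lemma map (hf : IsCountablyValued m f) (g : α → β) : IsCountablyValued m fun ω => g (f ω) :=
  hf.bind fun y => const (g y)

lemma map₂ {γ : Type*} {f' : Ω → β} (hf : IsCountablyValued m f) (hf' : IsCountablyValued m f')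
    (g : α → β → γ) : IsCountablyValued m fun ω => g (f ω) (f' ω) :=
  hf.bind fun y => hf'.map (g y)

lemma of_measurable [MeasurableSpace α] [MeasurableSingletonClass α] {s : Set α}
    (hs : s.Countable) (hf : Measurable[m] f) (h : ∀ ω, f ω ∈ s) : IsCountablyValued m f :=
  ⟨hs.mono (by rintro _ ⟨ω, rfl⟩; exact h ω), fun y => hf (measurableSet_singleton y)⟩

/-- Freezing a countably valued argument. -/
lemma measure_inter_le {mΩ : MeasurableSpace Ω} {P : Measure Ω} (hm : m ≤ mΩ)
    (hf : IsCountablyValued m f) {Bad : α → Set Ω} {ε : ENNReal} {E : Set Ω}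
    (hE : MeasurableSet[m] E)
    (h : ∀ y E', MeasurableSet[m] E' → P (E' ∩ Bad y) ≤ ε * P E') :
    P (E ∩ {ω | ω ∈ Bad (f ω)}) ≤ ε * P E := by
  have hsub : E ∩ {ω | ω ∈ Bad (f ω)} ⊆ ⋃ y ∈ Set.range f, (E ∩ f ⁻¹' {y}) ∩ Bad y := by
    rintro ω ⟨h1, h2⟩
    exact Set.mem_biUnion ⟨ω, rfl⟩ ⟨⟨h1, rfl⟩, h2⟩
  have hEq : E = ⋃ y ∈ Set.range f, E ∩ f ⁻¹' {y} := by
    ext ω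
    simp
  have hc := hf.countable.to_subtype
  calc P (E ∩ {ω | ω ∈ Bad (f ω)}) ≤ ∑' y : Set.range f, P ((E ∩ f ⁻¹' {y.1}) ∩ Bad y.1) :=
        (measure_mono hsub).trans (measure_biUnion_le _ hf.countable _)
    _ ≤ ∑' y : Set.range f, ε * P (E ∩ f ⁻¹' {y.1}) :=
        ENNReal.tsum_le_tsum fun y => h _ _ (hE.inter (hf.measurableSet_fiber _))
    _ = ε * P E := by
        rw [ENNReal.tsum_mul_left]
        conv_rhs => rw [hEq, measure_biUnion hf.countable (fun x _ y _ hxy =>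
          (Disjoint.preimage f (Set.disjoint_singleton.2 hxy)).mono
            Set.inter_subset_right Set.inter_subset_right)
          (fun y _ => (hm _ hE).inter (hm _ (hf.measurableSet_fiber y)))]

end IsCountablyValued

end generic

/-- The integer nearest to `Q * x'`, where `x'` is `8 * x` truncated to `[-1, 1]`. -/
noncomputable def roundClamp (Q : ℕ) (x : ℝ) : ℤ := round (Q * max (-1) (min 1 (8 * x)))

lemma measurable_roundClamp (Q : ℕ) : Measurable (roundClamp Q) := by
  unfold roundClamp
  simp only [round_eq]
  exact Int.measurable_floor.comp (by fun_prop)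

lemma abs_roundClamp_sub_le (Q : ℕ) (x : ℝ) :
    |Q * max (-1) (min 1 (8 * x)) - roundClamp Q x| ≤ 1 / 2 := abs_sub_round _

lemma abs_roundClamp_le (Q : ℕ) (x : ℝ) : |(roundClamp Q x : ℝ)| ≤ Q := by
  have h := abs_le.1 (abs_roundClamp_sub_le Q x)
  have h1 : (Q : ℝ) * max (-1) (min 1 (8 * x)) ≤ Q * 1 := by gcongr; simp
  have h2 : (Q : ℝ) * (-1) ≤ Q * max (-1) (min 1 (8 * x)) := by gcongr; simp
  rw [abs_le]
  constructor
  · have : (-Q - 1 : ℝ) < roundClamp Q x := by linarith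
    have : (-Q - 1 : ℤ) < roundClamp Q x := by exact_mod_cast this
    have : (-Q : ℤ) ≤ roundClamp Q x := by omega
    exact_mod_cast this
  · have : (roundClamp Q x : ℝ) < Q + 1 := by linarith
    have : roundClamp Q x < Q + 1 := by exact_mod_cast this
    have : roundClamp Q x ≤ Q := by omega
    exact_mod_cast this

lemma mul_roundClamp_nonneg (Q : ℕ) (x : ℝ) : 0 ≤ x * roundClamp Q x := by
  have h := abs_le.1 (abs_roundClamp_sub_le Q x)
  rcases le_total 0 x with hx | hx
  · have h2 : 0 ≤ (Q : ℝ) * max (-1) (min 1 (8 * x)) :=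
      mul_nonneg (by positivity) (le_max_of_le_right (le_min (by norm_num) (by linarith)))
    have : (-1 : ℝ) < roundClamp Q x := by linarith
    have : (-1 : ℤ) < roundClamp Q x := by exact_mod_cast this
    have : (0 : ℤ) ≤ roundClamp Q x := by omega
    exact mul_nonneg hx (by exact_mod_cast this)
  · have h2 : (Q : ℝ) * max (-1) (min 1 (8 * x)) ≤ 0 :=
      mul_nonpos_of_nonneg_of_nonpos (by positivity)
        (max_le (by norm_num) (min_le_of_right_le (by linarith)))
    have : (roundClamp Q x : ℝ) < 1 := by linarith
    have : roundClamp Q x < 1 := by exact_mod_cast this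
    have : roundClamp Q x ≤ 0 := by omega
    exact mul_nonneg_of_nonpos_of_nonpos hx (by exact_mod_cast this)

lemma abs_roundClamp_eq {Q : ℕ} {x : ℝ} (hx : 1 / 8 ≤ |x|) : |(roundClamp Q x : ℝ)| = Q := by
  rcases le_abs.1 hx with h | h
  · have : max (-1) (min 1 (8 * x)) = 1 := by
      rw [min_eq_left (by linarith), max_eq_right (by norm_num)]
    rw [roundClamp, this, mul_one, round_natCast]
    simp
  · have : max (-1) (min 1 (8 * x)) = -1 :=
      max_eq_left ((min_le_right _ _).trans (by linarith))
    rw [roundClamp, this, mul_neg_one, show (-(Q : ℝ)) = ((-Q : ℤ) : ℝ) by push_cast; rfl,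
      round_intCast]
    simp

lemma abs_roundClamp_sub_roundClamp_le (Q : ℕ) (x y : ℝ) :
    |(roundClamp Q x : ℝ) - roundClamp Q y| ≤ Q * (8 * |x - y|) + 1 := by
  have hx := abs_le.1 (abs_roundClamp_sub_le Q x)
  have hy := abs_le.1 (abs_roundClamp_sub_le Q y)
  have h : |max (-1) (min 1 (8 * x)) - max (-1) (min 1 (8 * y))| ≤ 8 * |x - y| := by
    calc _ ≤ |min 1 (8 * x) - min 1 (8 * y)| := by
          simpa using abs_max_sub_max_le_max (-1) (min 1 (8 * x)) (-1) (min 1 (8 * y))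
      _ ≤ |8 * x - 8 * y| := by
          simpa using abs_min_sub_min_le_max 1 (8 * x) 1 (8 * y)
      _ = 8 * |x - y| := by rw [← mul_sub, abs_mul, abs_of_pos (by norm_num : (0 : ℝ) < 8)]
  have h' : |(Q : ℝ) * max (-1) (min 1 (8 * x)) - Q * max (-1) (min 1 (8 * y))|
      ≤ Q * (8 * |x - y|) := by
    rw [← mul_sub, abs_mul, Nat.abs_cast]
    gcongr
  have := abs_le.1 h'
  rw [abs_le]
  constructor <;> linarith

section dirCoef

variable {d : ℕ} {r R : ℝ}

/-- The coefficient of `X (b + e) - X (b - e)` in the covariance with `X (b + v)`. -/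
noncomputable def dirCoef (d : ℕ) (r R : ℝ) (v : Pt d) (i : Fin d) : ℝ :=
  bandKernel d r R (v - EuclideanSpace.single i (3 * r)) -
    bandKernel d r R (v + EuclideanSpace.single i (3 * r))

lemma norm_sub_single_sq (v : Pt d) (i : Fin d) (a : ℝ) :
    ‖v - EuclideanSpace.single i a‖ ^ 2 = ‖v‖ ^ 2 + a ^ 2 - 2 * (a * v i) := by
  rw [norm_sub_sq_real, EuclideanSpace.inner_single_right, PiLp.norm_single]
  simp
  ring

lemma norm_add_single_sq (v : Pt d) (i : Fin d) (a : ℝ) :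
    ‖v + EuclideanSpace.single i a‖ ^ 2 = ‖v‖ ^ 2 + a ^ 2 + 2 * (a * v i) := by
  rw [norm_add_sq_real, EuclideanSpace.inner_single_right, PiLp.norm_single]
  simp
  ring

lemma dirCoef_nonneg (hr : 0 < r) (hrR : r ≤ R) {v : Pt d} {i : Fin d} (h : 0 ≤ v i) :
    0 ≤ dirCoef d r R v i := by
  refine sub_nonneg.2 (bandKernel_antitone hr hrR ?_)
  rw [← sq_le_sq₀ (norm_nonneg _) (norm_nonneg _), norm_sub_single_sq, norm_add_single_sq]
  have : 0 ≤ 3 * r * v i := by positivity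
  linarith

lemma dirCoef_neg (v : Pt d) (i : Fin d) : dirCoef d r R (-v) i = -dirCoef d r R v i := by
  have h1 : ‖-v - EuclideanSpace.single i (3 * r)‖ = ‖v + EuclideanSpace.single i (3 * r)‖ := by
    rw [← norm_neg]; congr 1; abel
  have h2 : ‖-v + EuclideanSpace.single i (3 * r)‖ = ‖v - EuclideanSpace.single i (3 * r)‖ := by
    rw [← norm_neg]; congr 1; abel
  rw [dirCoef, dirCoef, bandKernel_eq_of_norm_eq h1, bandKernel_eq_of_norm_eq h2, neg_sub]

lemma dirCoef_eq_zero {v : Pt d} {i : Fin d} (h : v i = 0) : dirCoef d r R v i = 0 := by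
  refine sub_eq_zero.2 (bandKernel_eq_of_norm_eq ?_)
  rw [← sq_eq_sq₀ (norm_nonneg _) (norm_nonneg _), norm_sub_single_sq, norm_add_single_sq]
  simp [h]

lemma le_dirCoef (hr : 0 < r) (hd : 16 ≤ d) (hR : 6 * d * r ≤ R) {v : Pt d} {i : Fin d}
    (hv : ‖v‖ ≤ 3 * r) (hvi : v i = 3 * r / √d) : 1 / (4 * √d) ≤ dirCoef d r R v i := by
  have hd' : (16 : ℝ) ≤ d := by exact_mod_cast hd
  have hs : (4 : ℝ) ≤ √d := by
    rw [show (4 : ℝ) = √16 by rw [show (16 : ℝ) = 4 ^ 2 by norm_num]; simp]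
    exact Real.sqrt_le_sqrt hd'
  set s := √(d : ℝ) with hsdef
  have hs0 : 0 < s := by linarith
  set x := v - EuclideanSpace.single i (3 * r) with hx
  set y := v + EuclideanSpace.single i (3 * r) with hy
  have hxs : ‖x‖ ^ 2 = ‖v‖ ^ 2 + 9 * r ^ 2 - 18 * r ^ 2 / s := by
    rw [hx, norm_sub_single_sq, hvi]; ring
  have hys : ‖y‖ ^ 2 = ‖v‖ ^ 2 + 9 * r ^ 2 + 18 * r ^ 2 / s := by
    rw [hy, norm_add_single_sq, hvi]; ring
  have hq : 18 * r ^ 2 / s ≤ 9 / 2 * r ^ 2 := by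
    rw [div_le_iff₀ hs0]; nlinarith [sq_nonneg r]
  have hq0 : 0 < 18 * r ^ 2 / s := by positivity
  have hx2 : 2 * r ≤ ‖x‖ := by
    rw [← sq_le_sq₀ (by positivity) (norm_nonneg _)]
    nlinarith [sq_nonneg ‖v‖, sq_nonneg r]
  have hy6 : ‖y‖ ≤ 6 * r := by
    refine (norm_add_le _ _).trans ?_
    rw [PiLp.norm_single, Real.norm_of_nonneg (by positivity)]
    linarith
  have hx0 : 0 < ‖x‖ := by linarith
  have hxy : ‖x‖ ≤ ‖y‖ := by
    rw [← sq_le_sq₀ (norm_nonneg _) (norm_nonneg _)]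
    linarith
  set c := ‖y‖ / ‖x‖ with hc
  have hcx : ‖y‖ = c * ‖x‖ := by rw [hc]; field_simp
  have hc1 : 1 ≤ c := by rwa [hc, one_le_div hx0]
  have hdr : 0 ≤ d * r := by positivity
  have key := half_log_le_bandKernel_sub (d := d) (r := r) (R := R) (x := x) (y := y) hr hc1 ?_ hx2
    ?_ hcx
  · refine le_trans ?_ key
    have hlog : 1 - 1 / c ^ 2 ≤ 2 * Real.log c := by
      have := Real.one_sub_inv_le_log_of_pos (x := c ^ 2) (by positivity)
      rw [Real.log_pow] at this
      simpa using this
    have hc2 : 1 - 1 / c ^ 2 = (‖y‖ ^ 2 - ‖x‖ ^ 2) / ‖y‖ ^ 2 := by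
      have : 0 < ‖y‖ := by linarith
      rw [hc]; field_simp
    have hyx : ‖y‖ ^ 2 - ‖x‖ ^ 2 = 36 * r ^ 2 / s := by rw [hys, hxs]; ring
    have hlow : 1 / s ≤ 1 - 1 / c ^ 2 := by
      rw [hc2, hyx, div_div, div_le_div_iff₀ hs0 (by have : 0 < ‖y‖ := by linarith
                                                     positivity)]
      have : ‖y‖ ^ 2 ≤ (6 * r) ^ 2 := by gcongr
      nlinarith
    have : 1 / (4 * s) = 1 / s / 4 := by rw [div_div, mul_comm]
    linarith
  · calc r * c ≤ ‖x‖ * c := by gcongr; linarith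
      _ = ‖y‖ := by rw [hcx, mul_comm]
      _ ≤ 6 * r := hy6
      _ ≤ 6 * d * r := by nlinarith
      _ ≤ R := hR
  · calc d * ‖x‖ * c = d * ‖y‖ := by rw [hcx]; ring
      _ ≤ d * (6 * r) := by gcongr
      _ ≤ R := by linarith

lemma mul_dirCoef_nonneg (hr : 0 < r) (hrR : r ≤ R) {v : Pt d} {i : Fin d} {u : ℝ}
    (h : 0 ≤ u * v i) : 0 ≤ u * dirCoef d r R v i := by
  rcases lt_trichotomy (v i) 0 with hv | hv | hv
  · have hu : u ≤ 0 := by nlinarith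
    have := dirCoef_nonneg (R := R) hr hrR (v := -v) (i := i) (by simpa using hv.le)
    rw [dirCoef_neg] at this
    nlinarith
  · simp [dirCoef_eq_zero hv]
  · exact mul_nonneg (by nlinarith) (dirCoef_nonneg hr hrR hv.le)

lemma le_mul_dirCoef (hr : 0 < r) (hd : 16 ≤ d) (hR : 6 * d * r ≤ R) {v : Pt d} {i : Fin d}
    {u : ℝ} (h : 0 ≤ u * v i) (hv : ‖v‖ ≤ 3 * r) (hvi : |v i| = 3 * r / √d) :
    |u| * (1 / (4 * √d)) ≤ u * dirCoef d r R v i := by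
  have hpos : 0 < 3 * r / √d := by
    have : (0 : ℝ) < d := by exact_mod_cast (by omega)
    positivity
  rcases eq_or_eq_neg_of_abs_eq hvi with hv' | hv'
  · have hu : 0 ≤ u := by rw [hv'] at h; exact nonneg_of_mul_nonneg_left h hpos
    rw [abs_of_nonneg hu]
    gcongr
    exact le_dirCoef hr hd hR hv hv'
  · have hu : u ≤ 0 := by rw [hv'] at h; nlinarith
    have := le_dirCoef hr hd hR (v := -v) (i := i) (by simpa using hv) (by simp [hv'])
    rw [dirCoef_neg] at this
    rw [abs_of_nonpos hu]
    nlinarith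

end dirCoef

/-- A continuous stationary Gaussian field with covariance `bandKernel d r R`. -/
structure IsBandField {d : ℕ} {Ω : Type} [MeasurableSpace Ω] (P : Measure Ω)
    (S : Submodule ℝ (Ω → ℝ)) (X : Pt d → Ω → ℝ) (r R : ℝ) : Prop where
  space : IsGaussianSpace P S
  mem : ∀ x, X x ∈ S
  cont : ∀ ω, Continuous fun x => X x ω
  cov : ∀ x y, cov[X x, X y; P] = bandKernel d r R (x - y)

/-- The increment of `X` between the two opposite points at distance `3 * r` of `b` in
direction `i`. -/
noncomputable def dirDiff {d : ℕ} {Ω : Type} (X : Pt d → Ω → ℝ) (r : ℝ) (b : Pt d) (i : Fin d) :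
    Ω → ℝ :=
  X (b + EuclideanSpace.single i (3 * r)) - X (b - EuclideanSpace.single i (3 * r))

lemma measurable_dirDiff {d : ℕ} {Ω : Type} (X : Pt d → Ω → ℝ) (r : ℝ) (b : Pt d) (i : Fin d) :
    Measurable[fieldSigma X] (dirDiff X r b i) :=
  (measurable_fieldSigma X _).sub (measurable_fieldSigma X _)

namespace IsBandField

variable {d : ℕ} {Ω : Type} [MeasurableSpace Ω] {P : Measure Ω} {S : Submodule ℝ (Ω → ℝ)}
  {X : Pt d → Ω → ℝ} {r R : ℝ}

lemma dirDiff_mem (hX : IsBandField P S X r R) (b : Pt d) (i : Fin d) : dirDiff X r b i ∈ S :=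
  S.sub_mem (hX.mem _) (hX.mem _)

lemma fieldSigma_le (hX : IsBandField P S X r R) : fieldSigma X ≤ ‹MeasurableSpace Ω› :=
  (measurable_pi_lambda _ fun x => hX.space.measurable _ (hX.mem x)).comap_le

lemma sum_mem (hX : IsBandField P S X r R) (b v : Pt d) :
    ∑ i, (dirCoef d r R v i / Var[dirDiff X r b i; P]) • dirDiff X r b i ∈ S :=
  S.sum_mem fun i _ => S.smul_mem _ (hX.dirDiff_mem b i)

/-- The part of `X (b + v)` independent of the increments `dirDiff X r b i`. -/
noncomputable def resid (P : Measure Ω) (X : Pt d → Ω → ℝ) (r R : ℝ) (b v : Pt d) : Ω → ℝ :=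
  X (b + v) - ∑ i, (dirCoef d r R v i / Var[dirDiff X r b i; P]) • dirDiff X r b i

lemma resid_mem (hX : IsBandField P S X r R) (b v : Pt d) : resid P X r R b v ∈ S :=
  S.sub_mem (hX.mem _) (hX.sum_mem b v)

variable [IsProbabilityMeasure P]

lemma cov_dirDiff (hX : IsBandField P S X r R) (b v : Pt d) (i : Fin d) :
    cov[X (b + v), dirDiff X r b i; P] = dirCoef d r R v i := by
  rw [dirDiff, hX.space.cov_sub_right (hX.mem _) (hX.mem _) (hX.mem _), hX.cov, hX.cov, dirCoef]
  congr 2 <;> abel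

lemma cov_dirDiff_dirDiff (hX : IsBandField P S X r R) (b : Pt d) {i j : Fin d} (hij : i ≠ j) :
    cov[dirDiff X r b i, dirDiff X r b j; P] = 0 := by
  have h1 := hX.cov_dirDiff b (EuclideanSpace.single i (3 * r)) j
  have h2 := hX.cov_dirDiff b (-EuclideanSpace.single i (3 * r)) j
  rw [dirCoef_eq_zero (by simp [hij.symm])] at h1 h2
  rw [dirDiff, hX.space.cov_sub_left (hX.mem _) (hX.mem _) (hX.dirDiff_mem _ _), h1,
    sub_eq_add_neg b, h2, sub_zero]

lemma variance_sub (hX : IsBandField P S X r R) (x y : Pt d) :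
    Var[X x - X y; P] = 2 * (bandKernel d r R 0 - bandKernel d r R (x - y)) := by
  rw [← covariance_self (hX.space.measurable _ (S.sub_mem (hX.mem _) (hX.mem _))).aemeasurable,
    hX.space.cov_sub_left (hX.mem _) (hX.mem _) (S.sub_mem (hX.mem _) (hX.mem _)),
    hX.space.cov_sub_right (hX.mem _) (hX.mem _) (hX.mem _),
    hX.space.cov_sub_right (hX.mem _) (hX.mem _) (hX.mem _), hX.cov, hX.cov, hX.cov, hX.cov,
    sub_self, sub_self, bandKernel_eq_of_norm_eq (norm_sub_rev y x)]
  ring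

lemma variance_dirDiff (hX : IsBandField P S X r R) (b : Pt d) (i : Fin d) :
    Var[dirDiff X r b i; P] =
      2 * (bandKernel d r R 0 - bandKernel d r R (EuclideanSpace.single i (6 * r))) := by
  rw [dirDiff, hX.variance_sub]
  congr 3
  rw [add_sub_sub_cancel]
  ext j
  by_cases h : j = i <;> simp [h]
  ring

lemma two_le_variance_dirDiff (hX : IsBandField P S X r R) (hr : 0 < r) (hR : 3 * r ≤ R)
    (b : Pt d) (i : Fin d) : 2 ≤ Var[dirDiff X r b i; P] := by
  rw [hX.variance_dirDiff]
  have := log_le_bandKernel_zero_sub (d := d) (c := 3) (R := R)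
    (x := EuclideanSpace.single i (6 * r)) hr (by norm_num) hR
    (by rw [PiLp.norm_single, Real.norm_of_nonneg (by positivity)]; linarith)
  have h3 : (1 : ℝ) ≤ Real.log 3 := by
    rw [Real.le_log_iff_exp_le (by norm_num)]
    exact (Real.exp_one_lt_d9.le).trans (by norm_num)
  linarith

lemma variance_dirDiff_le (hX : IsBandField P S X r R) (hr : 0 < r) (hR : r ≤ R)
    (b : Pt d) (i : Fin d) : Var[dirDiff X r b i; P] ≤ 2 * Real.log (R / r) := by
  rw [hX.variance_dirDiff, ← bandKernel_zero (d := d) hr hR]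
  have := bandKernel_nonneg (d := d) (x := EuclideanSpace.single i (6 * r)) hr hR
  linarith

lemma cov_resid (hX : IsBandField P S X r R) (hr : 0 < r) (hR : 3 * r ≤ R) (b v : Pt d)
    (j : Fin d) : cov[resid P X r R b v, dirDiff X r b j; P] = 0 := by
  rw [resid, hX.space.cov_sub_left (hX.mem _) (hX.sum_mem b v) (hX.dirDiff_mem b j),
    hX.cov_dirDiff, covariance_sum_left (fun i =>
      hX.space.memLp (S.smul_mem _ (hX.dirDiff_mem b i))) (hX.space.memLp (hX.dirDiff_mem b j)),
    Finset.sum_eq_single j]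
  · rw [covariance_smul_left,
      covariance_self (hX.space.measurable _ (hX.dirDiff_mem b j)).aemeasurable]
    have := hX.two_le_variance_dirDiff hr hR b j
    field_simp
    ring
  · intro i _ hij
    rw [covariance_smul_left, hX.cov_dirDiff_dirDiff b hij, mul_zero]
  · simp

lemma variance_resid_le (hX : IsBandField P S X r R) (hr : 0 < r) (hR : 3 * r ≤ R) (b v : Pt d) :
    Var[resid P X r R b v; P] ≤ Real.log (R / r) := by
  set T := ∑ i, (dirCoef d r R v i / Var[dirDiff X r b i; P]) • dirDiff X r b i with hT
  have hTS : T ∈ S := hX.sum_mem b v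
  have hRS := hX.resid_mem b v
  have hXe : X (b + v) = resid P X r R b v + T := by rw [resid]; abel
  have hc : cov[resid P X r R b v, T; P] = 0 := by
    rw [covariance_comm, hT, covariance_sum_left (fun i =>
      hX.space.memLp (S.smul_mem _ (hX.dirDiff_mem b i))) (hX.space.memLp hRS)]
    refine Finset.sum_eq_zero fun i _ => ?_
    rw [covariance_smul_left, covariance_comm, hX.cov_resid hr hR, mul_zero]
  have hv : Var[X (b + v); P] = Real.log (R / r) := by
    rw [← covariance_self (hX.space.measurable _ (hX.mem _)).aemeasurable, hX.cov, sub_self,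
      bandKernel_zero hr (by linarith)]
  rw [← hv, hXe, variance_add (hX.space.memLp hRS) (hX.space.memLp hTS), hc]
  have := variance_nonneg T P
  linarith

lemma measure_abs_dirDiff_lt_le (hX : IsBandField P S X r R) (hr : 0 < r) (hR : 3 * r ≤ R)
    (b : Pt d) (i : Fin d) : P {ω | |dirDiff X r b i ω| < 1 / 8} ≤ ENNReal.ofReal (1 / 12) := by
  have hm := hX.space.measurable _ (hX.dirDiff_mem b i)
  have hv := hX.two_le_variance_dirDiff hr hR b i
  set v := Var[dirDiff X r b i; P] with hvdef
  have hset : {ω | |dirDiff X r b i ω| < 1 / 8} = dirDiff X r b i ⁻¹' Set.Ioo (-(1 / 8))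
    (1 / 8) := by
    ext ω; simp [abs_lt]
  have hv0 : v.toNNReal ≠ 0 := by simp; linarith
  rw [hset, ← Measure.map_apply hm measurableSet_Ioo, hX.space.map_eq (hX.dirDiff_mem b i),
    gaussianReal_apply _ hv0]
  have hpdf (x : ℝ) : gaussianPDF 0 v.toNNReal x ≤ ENNReal.ofReal (1 / 3) := by
    refine ENNReal.ofReal_le_ofReal ?_
    rw [gaussianPDFReal, Real.coe_toNNReal _ (by linarith)]
    have h3 : (3 : ℝ) ≤ √(2 * Real.pi * v) := by
      refine Real.le_sqrt_of_sq_le ?_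
      nlinarith [Real.pi_gt_three]
    calc _ ≤ (3 : ℝ)⁻¹ * 1 := by
          gcongr
          rw [Real.exp_le_one_iff]
          exact div_nonpos_of_nonpos_of_nonneg (by nlinarith [sq_nonneg (x - 0)]) (by linarith)
      _ = 1 / 3 := by norm_num
  calc ∫⁻ x in Set.Ioo (-(1 / 8) : ℝ) (1 / 8), gaussianPDF 0 v.toNNReal x
      ≤ ∫⁻ x in Set.Ioo (-(1 / 8) : ℝ) (1 / 8), ENNReal.ofReal (1 / 3) := lintegral_mono hpdf
    _ = ENNReal.ofReal (1 / 12) := by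
        rw [setLIntegral_const, Real.volume_Ioo, ← ENNReal.ofReal_mul (by norm_num)]
        norm_num

lemma iIndepFun_dirDiff (hX : IsBandField P S X r R) (b : Pt d) :
    iIndepFun (fun i => dirDiff X r b i) P := by
  have := hX.space.iIndepFun (fun (i : Fin d) (_ : Unit) => dirDiff X r b i)
    (fun i _ => hX.dirDiff_mem b i) (fun i j hij _ _ => hX.cov_dirDiff_dirDiff b hij)
  exact this.comp (fun _ f => f ()) (fun _ => measurable_pi_apply _)

lemma measure_card_small_le (hX : IsBandField P S X r R) (hr : 0 < r) (hR : 3 * r ≤ R)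
    (b : Pt d) (k : ℕ) :
    P (⋃ T ∈ (Finset.univ : Finset (Fin d)).powersetCard k,
      ⋂ i ∈ T, {ω | |dirDiff X r b i ω| < 1 / 8}) ≤ 2 ^ d * ENNReal.ofReal (1 / 12) ^ k := by
  have := measure_card_le (P := P) (Finset.univ : Finset (Fin d))
    (fun i => {ω | |dirDiff X r b i ω| < 1 / 8}) (ENNReal.ofReal (1 / 12)) ?_ k
  · simpa using this
  intro T _
  have hset (i : Fin d) : {ω | |dirDiff X r b i ω| < 1 / 8} =
      dirDiff X r b i ⁻¹' Set.Ioo (-(1 / 8)) (1 / 8) := by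
    ext ω; simp [abs_lt]
  calc P (⋂ i ∈ T, {ω | |dirDiff X r b i ω| < 1 / 8})
      = ∏ i ∈ T, P {ω | |dirDiff X r b i ω| < 1 / 8} := by
        simp only [hset]
        exact (hX.iIndepFun_dirDiff b).measure_inter_preimage_eq_mul T
          fun i _ => measurableSet_Ioo
    _ ≤ ∏ i ∈ T, ENNReal.ofReal (1 / 12) :=
        Finset.prod_le_prod' fun i _ => hX.measure_abs_dirDiff_lt_le hr hR b i
    _ = ENNReal.ofReal (1 / 12) ^ T.card := by simp

end IsBandField

section stepMap

variable {d : ℕ} {r R : ℝ}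

/-- The displacement with coordinates `3 * r / √d * (k i / Q)`, vanishing in direction `i₀`. -/
noncomputable def shiftOf (r : ℝ) (Q : ℕ) (i₀ : Fin d) (k : Fin d → ℤ) : Pt d :=
  WithLp.toLp 2 fun i => if i = i₀ then 0 else 3 * r / √d * (k i / Q)

lemma shiftOf_apply (Q : ℕ) (i₀ : Fin d) (k : Fin d → ℤ) (i : Fin d) :
    shiftOf r Q i₀ k i = if i = i₀ then 0 else 3 * r / √d * (k i / Q) := rfl

lemma norm_shiftOf_sub_le (hr : 0 ≤ r) {Q : ℕ} (hQ : 0 < Q) (i₀ : Fin d) {k k' : Fin d → ℤ} {c : ℝ}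
    (hc : 0 ≤ c) (h : ∀ i, |(k i : ℝ) - k' i| ≤ Q * c) :
    ‖shiftOf r Q i₀ k - shiftOf r Q i₀ k'‖ ≤ 3 * r * c := by
  have hd : 0 < d := i₀.pos
  have hs : (0 : ℝ) < √d := Real.sqrt_pos.2 (by exact_mod_cast hd)
  have hQ' : (0 : ℝ) < Q := by exact_mod_cast hQ
  have := norm_le_sqrt_mul (x := shiftOf r Q i₀ k - shiftOf r Q i₀ k') (c := 3 * r / √d * c)
    (by positivity) fun i => by
      rw [PiLp.sub_apply, shiftOf_apply, shiftOf_apply]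
      split_ifs
      · simp; positivity
      · rw [← mul_sub, ← sub_div, abs_mul, abs_of_nonneg (by positivity), abs_div, Nat.abs_cast]
        gcongr
        rw [div_le_iff₀ hQ', mul_comm]
        exact h i
  refine this.trans (le_of_eq ?_)
  field_simp

lemma norm_shiftOf_le (hr : 0 ≤ r) {Q : ℕ} (hQ : 0 < Q) (i₀ : Fin d) {k : Fin d → ℤ}
    (h : ∀ i, |(k i : ℝ)| ≤ Q) : ‖shiftOf r Q i₀ k‖ ≤ 3 * r := by
  have h0 : shiftOf r Q i₀ (fun _ : Fin d => 0) = 0 := by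
    ext i
    simp [shiftOf_apply]
  have := norm_shiftOf_sub_le hr hQ i₀ (k := k) (k' := fun _ => 0) zero_le_one (by simpa using h)
  simpa [h0] using this

/-- Moving in the directions of the increments `D` yields a gain of order `√d`. -/
lemma le_sum_dirCoef (hr : 0 < r) (hd : 16 ≤ d) (hR : 6 * d * r ≤ R) {Q : ℕ} (hQ : 0 < Q)
    (i₀ : Fin d) {D σ : Fin d → ℝ} {Lg : ℝ} (hσ : ∀ i, 2 ≤ σ i) (hσ' : ∀ i, σ i ≤ 2 * Lg)
    (hcard : (Finset.univ.filter fun i => |D i| < 1 / 8).card < (d + 1) / 2) :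
    √d / (256 * Lg) ≤
      ∑ i, dirCoef d r R (shiftOf r Q i₀ fun i => roundClamp Q (D i)) i / σ i * D i := by
  classical
  set v := shiftOf r Q i₀ fun i => roundClamp Q (D i) with hv
  have hd' : (16 : ℝ) ≤ d := by exact_mod_cast hd
  have hs : (0 : ℝ) < √d := Real.sqrt_pos.2 (by linarith)
  have hLg : 1 ≤ Lg := by have := (hσ i₀).trans (hσ' i₀); linarith
  have hQ' : (0 : ℝ) < Q := by exact_mod_cast hQ
  have hrR : r ≤ R := le_trans (by nlinarith) hR
  have hvn : ‖v‖ ≤ 3 * r := norm_shiftOf_le hr.le hQ i₀ fun i => abs_roundClamp_le _ _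
  have hsign (i : Fin d) : 0 ≤ D i * v i := by
    rw [hv, shiftOf_apply]
    split_ifs
    · simp
    · have := mul_roundClamp_nonneg Q (D i)
      have : D i * (3 * r / √d * (roundClamp Q (D i) / Q)) =
        3 * r / √d * ((D i * roundClamp Q (D i)) / Q) := by ring
      rw [this]
      positivity
  have hnn (i : Fin d) : 0 ≤ dirCoef d r R v i / σ i * D i := by
    have h1 := mul_dirCoef_nonneg hr hrR (hsign i)
    have h2 : 0 < σ i := by linarith [hσ i]
    rw [div_mul_eq_mul_div, mul_comm]
    positivity
  set G := Finset.univ.filter fun i => i ≠ i₀ ∧ 1 / 8 ≤ |D i| with hG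
  have hterm (i : Fin d) (hi : i ∈ G) :
      1 / (64 * √d * Lg) ≤ dirCoef d r R v i / σ i * D i := by
    obtain ⟨hi0, hiD⟩ := (Finset.mem_filter.1 hi).2
    have hvi : |v i| = 3 * r / √d := by
      rw [hv, shiftOf_apply, if_neg hi0, abs_mul, abs_of_nonneg (by positivity), abs_div,
        abs_roundClamp_eq hiD, Nat.abs_cast, div_self hQ'.ne', mul_one]
    have h1 := le_mul_dirCoef hr hd hR (hsign i) hvn hvi
    have h2 : 0 < σ i := by linarith [hσ i]
    rw [div_mul_eq_mul_div, le_div_iff₀ h2, mul_comm (dirCoef d r R v i)]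
    refine le_trans ?_ h1
    calc 1 / (64 * √d * Lg) * σ i ≤ 1 / (64 * √d * Lg) * (2 * Lg) := by gcongr; exact hσ' i
      _ = 1 / 8 * (1 / (4 * √d)) := by field_simp; norm_num
      _ ≤ |D i| * (1 / (4 * √d)) := by gcongr
  have hGcard : (d : ℝ) / 4 ≤ G.card := by
    have hle : d ≤ G.card + (Finset.univ.filter fun i => |D i| < 1 / 8).card + 1 := by
      have hun : (Finset.univ : Finset (Fin d)) ⊆
          G ∪ (Finset.univ.filter fun i => |D i| < 1 / 8) ∪ {i₀} := by
        intro i _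
        simp only [hG, Finset.mem_union, Finset.mem_filter, Finset.mem_univ, true_and,
          Finset.mem_singleton]
        by_cases h : i = i₀
        · exact .inr h
        · rcases le_or_gt (1 / 8) |D i| with h' | h'
          · exact .inl (.inl ⟨h, h'⟩)
          · exact .inl (.inr h')
      have := Finset.card_le_card hun
      rw [Finset.card_univ, Fintype.card_fin] at this
      refine this.trans ((Finset.card_union_le _ _).trans ?_)
      gcongr
      · exact Finset.card_union_le _ _
      · simp
    have : d ≤ 4 * G.card := by omega
    have : (d : ℝ) ≤ 4 * G.card := by exact_mod_cast this
    linarith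
  calc √d / (256 * Lg) = d / 4 * (1 / (64 * √d * Lg)) := by
        field_simp
        rw [Real.sq_sqrt (by linarith)]
        ring
    _ ≤ G.card * (1 / (64 * √d * Lg)) := by gcongr
    _ = ∑ i ∈ G, 1 / (64 * √d * Lg) := by rw [Finset.sum_const, nsmul_eq_mul]
    _ ≤ ∑ i ∈ G, dirCoef d r R v i / σ i * D i := Finset.sum_le_sum hterm
    _ ≤ ∑ i, dirCoef d r R v i / σ i * D i :=
        Finset.sum_le_sum_of_subset_of_nonneg (Finset.subset_univ _) fun i _ _ => hnn i

/-- A random displacement `V b` of each point `b`, at scale `r`, such that outside of the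
exceptional event `bad b` the field `X` is at least `A` near `b + V b`, and `b' + V b'` is close to
`b + V b` for `b'` close to `b`. -/
structure IsStepMap {Ω : Type} [MeasurableSpace Ω] (P : Measure Ω) (X : Pt d → Ω → ℝ)
    (r σ τ A : ℝ) (ε : ENNReal) (i₀ : Fin d) (V : Pt d → Ω → Pt d) (bad : Pt d → Set Ω) :
    Prop where
  countablyValued : ∀ b, IsCountablyValued (fieldSigma X) (V b)
  norm_le : ∀ b ω, ‖V b ω‖ ≤ 3 * r
  apply_eq : ∀ b ω, V b ω i₀ = 0
  measurableSet_bad : ∀ b, MeasurableSet[fieldSigma X] (bad b)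
  measure_bad_le : ∀ b, P (bad b) ≤ ε
  high : ∀ b, ∀ ω ∉ bad b, ∀ x, ‖x - (b + V b ω)‖ ≤ 2 * σ * r → A ≤ X x ω
  close : ∀ b, ∀ ω ∉ bad b, ∀ b', ‖b' - b‖ ≤ τ * r → ‖(b' + V b' ω) - (b + V b ω)‖ ≤ σ * r

/-- The displacement following the signs of the increments of `X`. -/
noncomputable def dirShift {d : ℕ} {Ω : Type} (X : Pt d → Ω → ℝ) (r : ℝ) (Q : ℕ) (i₀ : Fin d)
    (b : Pt d) (ω : Ω) :
    Pt d :=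
  shiftOf r Q i₀ fun i => roundClamp Q (dirDiff X r b i ω)

/-- The `σ`-algebra generated by the increments of `X` around `b`. -/
noncomputable abbrev dirSigma {d : ℕ} {Ω : Type} (X : Pt d → Ω → ℝ) (r : ℝ) (b : Pt d) :
    MeasurableSpace Ω :=
  MeasurableSpace.comap (fun ω (i : Fin d) => dirDiff X r b i ω) MeasurableSpace.pi

lemma isCountablyValued_dirShift {d : ℕ} {Ω : Type} {m : MeasurableSpace Ω} (X : Pt d → Ω → ℝ)
    (r : ℝ) (Q : ℕ)
    (i₀ : Fin d) (b : Pt d) (hm : ∀ i, Measurable[m] (dirDiff X r b i)) :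
    IsCountablyValued m (dirShift X r Q i₀ b) :=
  (IsCountablyValued.of_measurable (Set.countable_univ (α := Fin d → ℤ))
    (measurable_pi_lambda _ fun i => (measurable_roundClamp Q).comp (hm i))
    fun _ => Set.mem_univ _).map (shiftOf r Q i₀)

variable {Ω : Type} [MeasurableSpace Ω] {P : Measure Ω} [IsProbabilityMeasure P]
  {S : Submodule ℝ (Ω → ℝ)} {X : Pt d → Ω → ℝ}

lemma IsBandField.measure_le_abs_sub (hX : IsBandField P S X r R) (hr : 0 < r) (hR : r ≤ R)
    (x y : Pt d) (t v : ℝ) (ht : 0 ≤ t) (hv : d / r * ‖x - y‖ ≤ v) :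
    P {ω | t ≤ |X x ω - X y ω|} ≤ 2 * ENNReal.ofReal (Real.exp (-t ^ 2 / (2 * v))) := by
  refine hX.space.measure_abs_ge_le (Y := X x - X y) (S.sub_mem (hX.mem _) (hX.mem _)) ?_ ht
  rw [hX.variance_sub]
  refine le_trans ?_ hv
  have := bandKernel_zero_sub_le (d := d) (x := x - y) hr hR
  calc _ ≤ 2 * (d * ‖x - y‖ / (2 * r)) := by gcongr
    _ = d / r * ‖x - y‖ := by field_simp

lemma IsBandField.measurable_resid (P : Measure Ω) (X : Pt d → Ω → ℝ) (r R : ℝ) (b v : Pt d) :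
    Measurable[fieldSigma X] (IsBandField.resid P X r R b v) := by
  refine (measurable_fieldSigma X _).sub ?_
  have h : ∀ i ∈ (Finset.univ : Finset (Fin d)), Measurable[fieldSigma X]
      ((dirCoef d r R v i / Var[dirDiff X r b i; P]) • dirDiff X r b i) := fun i _ =>
    (measurable_dirDiff X r b i).const_mul _
  convert Finset.measurable_sum _ h using 1
  ext ω
  rw [Finset.sum_apply]

lemma IsBandField.measure_resid_dirShift_le (hX : IsBandField P S X r R) (hr : 0 < r)
    (hR : 3 * r ≤ R) {Lg t : ℝ} (hLg : Real.log (R / r) ≤ Lg) (ht : 0 ≤ t) (Q : ℕ) (i₀ : Fin d)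
    (b : Pt d) :
    P {ω | IsBandField.resid P X r R b (dirShift X r Q i₀ b ω) ω ≤ -t} ≤
      ENNReal.ofReal (Real.exp (-t ^ 2 / (2 * Lg))) := by
  have hm : ∀ i, Measurable[dirSigma X r b] (dirDiff X r b i) := fun i =>
    (measurable_pi_apply i).comp (comap_measurable fun ω (i : Fin d) => dirDiff X r b i ω)
  have hmle : dirSigma X r b ≤ ‹MeasurableSpace Ω› :=
    (measurable_pi_lambda _ fun i => hX.space.measurable _ (hX.dirDiff_mem b i)).comap_le
  have key := (isCountablyValued_dirShift X r Q i₀ b hm).measure_inter_le (P := P) hmle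
    (Bad := fun v => {ω | IsBandField.resid P X r R b v ω ≤ -t})
    (ε := ENNReal.ofReal (Real.exp (-t ^ 2 / (2 * Lg)))) (E := Set.univ) .univ ?_
  · simpa using key
  rintro v E' ⟨s, hs, rfl⟩
  have hind := hX.space.indepFun (fun i => dirDiff X r b i)
    (fun _ : Unit => IsBandField.resid P X r R b v) (fun i => hX.dirDiff_mem b i)
    (fun _ => hX.resid_mem b v) (fun i _ => by rw [covariance_comm, hX.cov_resid hr hR])
  have hset : {ω | IsBandField.resid P X r R b v ω ≤ -t} =
      (fun ω (_ : Unit) => IsBandField.resid P X r R b v ω) ⁻¹' {f | f () ≤ -t} := rfl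
  rw [hset, hind.measure_inter_preimage_eq_mul _ _ hs
    (measurableSet_le (measurable_pi_apply _) measurable_const), ← hset, mul_comm]
  gcongr
  exact hX.space.measure_le_neg_le (hX.resid_mem b v)
    ((hX.variance_resid_le hr hR b v).trans hLg) ht

/-- The exceptional probability of the one-step construction. -/
noncomputable def stepError (d K₁ K₂ : ℕ) (B₁ B₂ A Lg : ℝ) : ENNReal :=
  (2 * K₁ + 1 : ℕ) ^ d * (2 ^ (d + 2) * ENNReal.ofReal (Real.exp (-B₁))) +
  (2 * K₂ + 1 : ℕ) ^ d * (2 ^ (d + 2) * ENNReal.ofReal (Real.exp (-B₂))) +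
  2 ^ d * ENNReal.ofReal (1 / 12) ^ ((d + 1) / 2) +
  ENNReal.ofReal (Real.exp (-(2 * A) ^ 2 / (2 * Lg)))

lemma abs_coord_le_of_norm_le {d : ℕ} {x : Pt d} {c : ℝ} (h : ‖x‖ ≤ c) (i : Fin d) : |x i| ≤ c :=
  (PiLp.norm_apply_le x i).trans h

theorem IsBandField.exists_isStepMap {d : ℕ} {Ω : Type} [MeasurableSpace Ω] {P : Measure Ω}
    [IsProbabilityMeasure P] {S : Submodule ℝ (Ω → ℝ)} {X : Pt d → Ω → ℝ} {r R : ℝ}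
    (hX : IsBandField P S X r R) (hr : 0 < r) (hd : 16 ≤ d) (hR : 6 * d * r ≤ R) {Lg : ℝ}
    (hLg : Real.log (R / r) ≤ Lg) {σ τ A B₁ B₂ : ℝ} {K₁ K₂ : ℕ} (hσ : 0 < σ) (hσ1 : σ ≤ 1 / 2)
    (hτ : 0 < τ) (hτσ : τ ≤ σ / 2) (hA : A = √d / (1024 * Lg))
    (hB₁ : 16 * (d + 1) ≤ B₁) (hB₁' : B₁ ≤ A ^ 2 / (256 * (d * √d) * σ))
    (hB₂ : 16 * (d + 1) ≤ B₂) (hB₂' : B₂ ≤ (σ / 192) ^ 2 / (128 * (d * √d) * τ))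
    (hK₁ : 5 ≤ K₁ * (2 * σ)) (hK₂ : 5 ≤ K₂ * τ) (i₀ : Fin d) :
    ∃ V bad, IsStepMap P X r σ τ A (stepError d K₁ K₂ B₁ B₂ A Lg) i₀ V bad := by
  classical
  have hd' : (16 : ℝ) ≤ d := by exact_mod_cast hd
  have hs : (0 : ℝ) < √d := Real.sqrt_pos.2 (by linarith)
  have h3R : 3 * r ≤ R := le_trans (by nlinarith) hR
  have hrR : r ≤ R := by linarith
  have hvar (b : Pt d) (i : Fin d) : Var[dirDiff X r b i; P] ≤ 2 * Lg :=
    (hX.variance_dirDiff_le hr hrR b i).trans (by linarith)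
  have hLg1 : 1 ≤ Lg := by
    have := (hX.two_le_variance_dirDiff hr h3R 0 i₀).trans (hvar 0 i₀)
    linarith
  have hA0 : 0 < A := by rw [hA]; positivity
  obtain ⟨Q, hQ⟩ := exists_nat_ge (12 / σ)
  have hQσ : 12 ≤ Q * σ := by rwa [div_le_iff₀ hσ] at hQ
  have hQ0 : 0 < Q := by
    have : (0 : ℝ) < Q := (by positivity : 0 < 12 / σ).trans_le hQ
    exact_mod_cast this
  have hQ0' : (0 : ℝ) < Q := by exact_mod_cast hQ0
  have h1 (b : Pt d) := exists_modulus_event (P := P) hX.cont (κ := d / r) (w := 2 * σ * r)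
    (lam := A) (B := B₁) (by positivity) (by positivity) hA0
    (fun x y t v ht hv => hX.measure_le_abs_sub hr hrR x y t v ht hv) (by omega)
    (hB₁'.trans_eq (by field_simp; norm_num)) hB₁ b K₁
  have h2 (b : Pt d) := exists_modulus_event (P := P) hX.cont (κ := d / r) (w := τ * r)
    (lam := σ / 192) (B := B₂) (by positivity) (by positivity) (by positivity)
    (fun x y t v ht hv => hX.measure_le_abs_sub hr hrR x y t v ht hv) (by omega)
    (hB₂'.trans_eq (by field_simp)) hB₂ b K₂
  choose bad₁ hm₁ hP₁ hb₁ using h1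
  choose bad₂ hm₂ hP₂ hb₂ using h2
  have hnorm (b : Pt d) (ω : Ω) : ‖dirShift X r Q i₀ b ω‖ ≤ 3 * r :=
    norm_shiftOf_le hr.le hQ0 i₀ fun i => abs_roundClamp_le _ _
  have hcv (b : Pt d) : IsCountablyValued (fieldSigma X) (dirShift X r Q i₀ b) :=
    isCountablyValued_dirShift X r Q i₀ b fun i => measurable_dirDiff X r b i
  let bad₃ (b : Pt d) : Set Ω := ⋃ T ∈ (Finset.univ : Finset (Fin d)).powersetCard ((d + 1) / 2),
      ⋂ i ∈ T, {ω | |dirDiff X r b i ω| < 1 / 8}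
  let bad₄ (b : Pt d) : Set Ω :=
    {ω | IsBandField.resid P X r R b (dirShift X r Q i₀ b ω) ω ≤ -(2 * A)}
  have hm₃ (b : Pt d) : MeasurableSet[fieldSigma X] (bad₃ b) := by
    refine @Finset.measurableSet_biUnion _ _ (fieldSigma X) _ _ fun T _ =>
      @Finset.measurableSet_biInter _ _ (fieldSigma X) _ _ fun i _ => ?_
    exact (continuous_abs.measurable.comp (measurable_dirDiff X r b i)) measurableSet_Iio
  have hm₄ (b : Pt d) : MeasurableSet[fieldSigma X] (bad₄ b) :=
    (hcv b).measurableSet_mem (Bad := fun v => {ω | IsBandField.resid P X r R b v ω ≤ -(2 * A)})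
      fun v => (IsBandField.measurable_resid P X r R b v) measurableSet_Iic
  refine ⟨dirShift X r Q i₀, fun b => bad₁ b ∪ bad₂ b ∪ bad₃ b ∪ bad₄ b, hcv, hnorm, ?_, ?_, ?_,
    ?_, ?_⟩
  · intro b ω
    rw [dirShift, shiftOf_apply, if_pos rfl]
  · exact fun b => (((hm₁ b).union (hm₂ b)).union (hm₃ b)).union (hm₄ b)
  · intro b
    refine (measure_union_le _ _).trans (add_le_add ((measure_union_le _ _).trans
      (add_le_add ((measure_union_le _ _).trans (add_le_add (hP₁ b) (hP₂ b))) ?_)) ?_)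
    · exact hX.measure_card_small_le hr h3R b _
    · exact hX.measure_resid_dirShift_le hr h3R hLg (by positivity) Q i₀ b
  · intro b ω hω x hx
    simp only [Set.mem_union, not_or] at hω
    obtain ⟨⟨⟨hω1, -⟩, hω3⟩, hω4⟩ := hω
    set v := dirShift X r Q i₀ b ω with hv
    have hres : -(2 * A) < IsBandField.resid P X r R b v ω := not_le.1 hω4
    have hgain := le_sum_dirCoef (D := fun i => dirDiff X r b i ω)
      (σ := fun i => Var[dirDiff X r b i; P]) (Lg := Lg) hr hd hR hQ0 i₀
      (fun i => hX.two_le_variance_dirDiff hr h3R b i) (hvar b)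
      (card_filter_lt_of_notMem Finset.univ (fun i => {ω | |dirDiff X r b i ω| < 1 / 8}) hω3)
    have hXv : X (b + v) ω = IsBandField.resid P X r R b v ω +
        ∑ i, dirCoef d r R v i / Var[dirDiff X r b i; P] * dirDiff X r b i ω := by
      simp [IsBandField.resid]
    have h4A : √d / (256 * Lg) = 4 * A := by rw [hA]; field_simp; norm_num
    have hgain' : 4 * A ≤
        ∑ i, dirCoef d r R v i / Var[dirDiff X r b i; P] * dirDiff X r b i ω := h4A ▸ hgain
    have hK : 5 * r ≤ K₁ * (2 * σ * r) := by nlinarith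
    have hσr : σ * r ≤ 1 / 2 * r := by gcongr
    have hosc := hb₁ b ω hω1 x (b + v) (fun i => ?_) (fun i => ?_) (fun i => ?_)
    · have := (abs_le.1 hosc).1
      linarith
    · refine (abs_coord_le_of_norm_le (x := x - b) (c := 5 * r) ?_ i).trans hK
      have := norm_add_le (x - (b + v)) v
      rw [show x - (b + v) + v = x - b by abel] at this
      linarith [hnorm b ω]
    · refine (abs_coord_le_of_norm_le (x := b + v - b) (c := 5 * r) ?_ i).trans hK
      rw [add_sub_cancel_left]
      linarith [hnorm b ω]
    · exact abs_coord_le_of_norm_le (x := x - (b + v)) hx i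
  · intro b ω hω b' hb'
    simp only [Set.mem_union, not_or] at hω
    obtain ⟨⟨⟨-, hω2⟩, -⟩, -⟩ := hω
    have hK : 5 * r ≤ K₂ * (τ * r) := by nlinarith
    have hτr : τ * r ≤ 1 * r := by gcongr; linarith
    have hnear (y : Pt d) (hy : ‖y‖ ≤ 3 * r) (c : Pt d) (hc : ‖c - b‖ ≤ τ * r) (i : Fin d) :
        |(c + y) i - b i| ≤ K₂ * (τ * r) := by
      refine (abs_coord_le_of_norm_le (x := c + y - b) (c := 5 * r) ?_ i).trans hK
      rw [show c + y - b = (c - b) + y by abel]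
      linarith [norm_add_le (c - b) y]
    have hcmp (y : Pt d) (hy : ‖y‖ ≤ 3 * r) : |X (b' + y) ω - X (b + y) ω| ≤ σ / 192 := by
      refine hb₂ b ω hω2 (b' + y) (b + y) (hnear y hy b' hb') (hnear y hy b ?_) fun i => ?_
      · simp; positivity
      · have := abs_coord_le_of_norm_le (x := b' - b) hb' i
        simpa using this
    have hD (i : Fin d) : |dirDiff X r b' i ω - dirDiff X r b i ω| ≤ σ / 96 := by
      have hn : ‖(EuclideanSpace.single i (3 * r) : Pt d)‖ ≤ 3 * r := by
        rw [PiLp.norm_single, Real.norm_of_nonneg (by positivity)]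
      have e1 := abs_le.1 (hcmp _ hn)
      have e2 := abs_le.1 (hcmp (-EuclideanSpace.single i (3 * r)) (by rwa [norm_neg]))
      simp only [dirDiff, Pi.sub_apply, sub_eq_add_neg b, sub_eq_add_neg b']
      rw [abs_le]
      constructor <;> linarith [e1.1, e1.2, e2.1, e2.2]
    have hV := norm_shiftOf_sub_le (r := r) hr.le hQ0 i₀
      (k := fun i => roundClamp Q (dirDiff X r b' i ω))
      (k' := fun i => roundClamp Q (dirDiff X r b i ω)) (c := σ / 6) (by positivity) fun i => by
        refine (abs_roundClamp_sub_roundClamp_le _ _ _).trans ?_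
        have := hD i
        have : (Q : ℝ) * (8 * |dirDiff X r b' i ω - dirDiff X r b i ω|) ≤ Q * (8 * (σ / 96)) := by
          gcongr
        nlinarith
    calc ‖(b' + dirShift X r Q i₀ b' ω) - (b + dirShift X r Q i₀ b ω)‖
        = ‖(b' - b) + (dirShift X r Q i₀ b' ω - dirShift X r Q i₀ b ω)‖ := by congr 1; abel
      _ ≤ τ * r + 3 * r * (σ / 6) := (norm_add_le _ _).trans (add_le_add hb' hV)
      _ ≤ σ * r := by nlinarith

end stepMap

section subdivision

variable {d : ℕ}

/-- Subdivision of each step of the sequence `s` into `M` equal steps. -/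
noncomputable def subdiv (M : ℕ) (s : ℕ → Pt d) (i : ℕ) : Pt d :=
  s (i / M) + ((i % M : ℕ) / M : ℝ) • (s (i / M + 1) - s (i / M))

lemma subdiv_succ_sub {M : ℕ} (hM : 0 < M) (s : ℕ → Pt d) (i : ℕ) :
    subdiv M s (i + 1) - subdiv M s i = (1 / M : ℝ) • (s (i / M + 1) - s (i / M)) := by
  have hM' : (M : ℝ) ≠ 0 := by exact_mod_cast hM.ne'
  rw [subdiv, subdiv, Nat.succ_div, Nat.add_mod]
  by_cases h : M ∣ i + 1
  · have h1 : i % M + 1 = M := by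
      have h2 := Nat.mod_lt i hM
      have h3 : M ∣ i % M + 1 := by
        rw [← Nat.mod_add_div i M, add_right_comm] at h
        exact (Nat.dvd_add_left (Dvd.intro _ rfl)).1 h
      exact le_antisymm h2 (Nat.le_of_dvd (by omega) h3)
    have h4 : (i % M + 1 % M) % M = 0 := by
      rw [← Nat.add_mod]; exact Nat.mod_eq_zero_of_dvd h
    have h5 : ((i % M : ℕ) : ℝ) = M - 1 := by
      rw [eq_sub_iff_add_eq]; exact_mod_cast h1
    rw [if_pos h, h4, h5, sub_div, div_self hM', sub_smul]
    simp
    abel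
  · have h1 : (i % M + 1 % M) % M = i % M + 1 := by
      rw [← Nat.add_mod]
      have h2 := Nat.mod_lt i hM
      have h3 : i % M + 1 ≠ M := fun h3 => h (by
        rw [← Nat.mod_add_div i M, add_right_comm, h3]
        exact (dvd_refl M).add (Dvd.intro _ rfl))
      have h4 : (i + 1) % M = (i % M + 1) % M := by simp
      rw [h4, Nat.mod_eq_of_lt (by omega)]
    rw [if_neg h, h1, add_zero]
    push_cast
    rw [add_div, add_smul]
    abel

lemma norm_subdiv_sub_le {M : ℕ} (hM : 0 < M) (s : ℕ → Pt d) (i : ℕ) :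
    ‖subdiv M s i - s (i / M)‖ ≤ ‖s (i / M + 1) - s (i / M)‖ := by
  rw [subdiv, add_sub_cancel_left, norm_smul]
  refine mul_le_of_le_one_left (norm_nonneg _) ?_
  rw [Real.norm_of_nonneg (by positivity)]
  refine div_le_one_of_le₀ ?_ (by positivity)
  exact_mod_cast (Nat.mod_lt i hM).le

/-- The successive refinements of the sequence of points `p + i * ρ` of a line in direction `i₀`,
displaced at each step by the maps `V n`. -/
noncomputable def sites {Ω : Type} (p : Pt d) (ρ : ℝ) (i₀ : Fin d) (M : ℕ)
    (V : ℕ → Pt d → Ω → Pt d) : ℕ → ℕ → Ω → Pt d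
  | 0, i, _ => p + EuclideanSpace.single i₀ (i * ρ)
  | n + 1, i, ω => subdiv M (fun j => sites p ρ i₀ M V n j ω) i +
      V n (subdiv M (fun j => sites p ρ i₀ M V n j ω) i) ω

/-- The points before the `n`-th displacement. -/
noncomputable def base {Ω : Type} (p : Pt d) (ρ : ℝ) (i₀ : Fin d) (M : ℕ) (V : ℕ → Pt d → Ω → Pt d)
    (n i : ℕ)
    (ω : Ω) : Pt d :=
  subdiv M (fun j => sites p ρ i₀ M V n j ω) i

lemma sites_succ {Ω : Type} {ρ : ℝ} {i₀ : Fin d} {M : ℕ} {V : ℕ → Pt d → Ω → Pt d} (p : Pt d)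
    (n i : ℕ) (ω : Ω) :
    sites p ρ i₀ M V (n + 1) i ω = base p ρ i₀ M V n i ω + V n (base p ρ i₀ M V n i ω) ω := rfl

end subdivision

/-- A sequence of independent fields with step maps at the scales `ρ / N ^ (n + 1)`. -/
structure IsCascade {d : ℕ} {Ω : Type} [MeasurableSpace Ω] (P : Measure Ω)
    (X : ℕ → Pt d → Ω → ℝ) (ρ N σ τ A : ℝ) (ε : ENNReal) (i₀ : Fin d)
    (V : ℕ → Pt d → Ω → Pt d) (bad : ℕ → Pt d → Set Ω) (M : ℕ) : Prop where
  step : ∀ n, IsStepMap P (X n) (ρ / N ^ (n + 1)) σ τ A ε i₀ (V n) (bad n)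
  indep : iIndep (fun n => fieldSigma (X n)) P
  le : ∀ n, fieldSigma (X n) ≤ ‹MeasurableSpace Ω›
  ρ_pos : 0 < ρ
  two_le : 2 ≤ N
  M_pos : 0 < M
  σ_pos : 0 < σ
  le_σ_mul : 46 ≤ σ * N
  le_τ_mul : 7 * N ≤ τ * M
  τ_le : τ ≤ 1

namespace IsCascade

variable {d : ℕ} {Ω : Type} [MeasurableSpace Ω] {P : Measure Ω} {X : ℕ → Pt d → Ω → ℝ}
  {ρ N σ τ A : ℝ} {ε : ENNReal} {i₀ : Fin d} {V : ℕ → Pt d → Ω → Pt d}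
  {bad : ℕ → Pt d → Set Ω} {M : ℕ}

lemma scale_pos (hC : IsCascade P X ρ N σ τ A ε i₀ V bad M) (n : ℕ) : 0 < ρ / N ^ n :=
  div_pos hC.ρ_pos (pow_pos (by linarith [hC.two_le]) _)

lemma scale_succ (hC : IsCascade P X ρ N σ τ A ε i₀ V bad M) (n : ℕ) :
    ρ / N ^ n = N * (ρ / N ^ (n + 1)) := by
  have : N ≠ 0 := by linarith [hC.two_le]
  field_simp
  ring

lemma norm_base_sub_le_of (hC : IsCascade P X ρ N σ τ A ε i₀ V bad M) (p : Pt d) (n : ℕ) (ω : Ω)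
    (h : ∀ i, ‖sites p ρ i₀ M V n (i + 1) ω - sites p ρ i₀ M V n i ω‖ ≤ 7 * (ρ / N ^ n)) (i : ℕ) :
    ‖base p ρ i₀ M V n (i + 1) ω - base p ρ i₀ M V n i ω‖ ≤ τ * (ρ / N ^ (n + 1)) := by
  have hM : (0 : ℝ) < M := by exact_mod_cast hC.M_pos
  rw [base, base, subdiv_succ_sub hC.M_pos, norm_smul, Real.norm_of_nonneg (by positivity)]
  calc 1 / (M : ℝ) * _ ≤ 1 / M * (7 * (ρ / N ^ n)) := by gcongr; exact h _
    _ = 7 * N / M * (ρ / N ^ (n + 1)) := by rw [hC.scale_succ n]; ring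
    _ ≤ τ * (ρ / N ^ (n + 1)) := by
      gcongr
      · exact (hC.scale_pos _).le
      · rw [div_le_iff₀ hM]; exact hC.le_τ_mul

lemma norm_sites_sub_le (hC : IsCascade P X ρ N σ τ A ε i₀ V bad M) (p : Pt d) (n i : ℕ) (ω : Ω) :
    ‖sites p ρ i₀ M V n (i + 1) ω - sites p ρ i₀ M V n i ω‖ ≤ 7 * (ρ / N ^ n) ∧
    ‖base p ρ i₀ M V n (i + 1) ω - base p ρ i₀ M V n i ω‖ ≤ τ * (ρ / N ^ (n + 1)) := by
  induction n generalizing i with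
  | zero =>
    have key (i : ℕ) : ‖sites p ρ i₀ M V 0 (i + 1) ω - sites p ρ i₀ M V 0 i ω‖ ≤
        7 * (ρ / N ^ 0) := by
      have : sites p ρ i₀ M V 0 (i + 1) ω - sites p ρ i₀ M V 0 i ω = EuclideanSpace.single i₀
        ρ := by
        ext j
        by_cases h : j = i₀ <;> simp [sites, h]
        ring
      rw [this, PiLp.norm_single, Real.norm_of_nonneg hC.ρ_pos.le]
      have := hC.ρ_pos
      simp
      linarith
    exact ⟨key i, hC.norm_base_sub_le_of p 0 ω (fun i => key i) i⟩
  | succ n ih =>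
    have key (i : ℕ) : ‖sites p ρ i₀ M V (n + 1) (i + 1) ω - sites p ρ i₀ M V (n + 1) i ω‖ ≤
        7 * (ρ / N ^ (n + 1)) := by
      rw [sites_succ, sites_succ, add_sub_add_comm]
      have h1 := (hC.step n).norm_le (base p ρ i₀ M V n (i + 1) ω) ω
      have h2 := (hC.step n).norm_le (base p ρ i₀ M V n i ω) ω
      have h3 := (ih i).2
      have h4 := hC.scale_pos (n + 1)
      have h5 := hC.τ_le
      have h6 := norm_add_le (base p ρ i₀ M V n (i + 1) ω - base p ρ i₀ M V n i ω)
        (V n (base p ρ i₀ M V n (i + 1) ω) ω - V n (base p ρ i₀ M V n i ω) ω)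
      have h7 := norm_sub_le (V n (base p ρ i₀ M V n (i + 1) ω) ω) (V n (base p ρ i₀ M V n i ω) ω)
      nlinarith
    exact ⟨key i, hC.norm_base_sub_le_of p (n + 1) ω (fun i => key i) i⟩

lemma sites_apply (hC : IsCascade P X ρ N σ τ A ε i₀ V bad M) (p : Pt d) (n i : ℕ) (ω : Ω) :
    sites p ρ i₀ M V n i ω i₀ = p i₀ + i * (ρ / M ^ n) := by
  have hM : (M : ℝ) ≠ 0 := by exact_mod_cast hC.M_pos.ne'
  induction n generalizing i with
  | zero => simp [sites]
  | succ n ih =>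
    rw [sites_succ, PiLp.add_apply, (hC.step n).apply_eq, add_zero, base, subdiv, PiLp.add_apply,
      PiLp.smul_apply, PiLp.sub_apply, ih, ih, smul_eq_mul]
    have : (i : ℝ) = (i % M : ℕ) + M * (i / M : ℕ) := by
      exact_mod_cast (Nat.mod_add_div i M).symm
    rw [this]
    push_cast
    field_simp
    ring

lemma norm_sites_succ_sub_le (hC : IsCascade P X ρ N σ τ A ε i₀ V bad M) (p : Pt d) (n i : ℕ)
    (ω : Ω) {c : ℝ}
    (h : ‖sites p ρ i₀ M V n (i / M + 1) ω - sites p ρ i₀ M V n (i / M) ω‖ ≤ c) :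
    ‖sites p ρ i₀ M V (n + 1) i ω - sites p ρ i₀ M V n (i / M) ω‖ ≤
      c + 3 * (ρ / N ^ (n + 1)) := by
  rw [sites_succ, add_sub_right_comm]
  refine (norm_add_le _ _).trans (add_le_add ?_ ((hC.step n).norm_le _ ω))
  exact (norm_subdiv_sub_le hC.M_pos (fun j => sites p ρ i₀ M V n j ω) i).trans h

lemma norm_sites_succ_sub_le' (hC : IsCascade P X ρ N σ τ A ε i₀ V bad M) (p : Pt d) (n i : ℕ)
    (ω : Ω) : ‖sites p ρ i₀ M V (n + 1) i ω - sites p ρ i₀ M V n (i / M) ω‖ ≤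
      10 * (ρ / N ^ n) := by
  refine (hC.norm_sites_succ_sub_le p n i ω (hC.norm_sites_sub_le p n _ ω).1).trans ?_
  have h1 := hC.scale_succ n
  have h2 := hC.scale_pos (n + 1)
  have h3 := hC.two_le
  nlinarith

/-- The step function through the points of the `n`-th refinement. -/
noncomputable def stepPath (p : Pt d) (ρ : ℝ) (i₀ : Fin d) (M : ℕ) (V : ℕ → Pt d → Ω → Pt d)
    (n : ℕ) (ω : Ω) (t : ℝ) : Pt d :=
  sites p ρ i₀ M V n ⌊t * M ^ n⌋₊ ω

lemma floor_mul_pow_succ_div {M : ℕ} (hM : 0 < M) (t : ℝ) (n : ℕ) :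
    ⌊t * (M : ℝ) ^ (n + 1)⌋₊ / M = ⌊t * (M : ℝ) ^ n⌋₊ := by
  rw [← Nat.floor_div_natCast]
  congr 1
  have : (M : ℝ) ≠ 0 := by exact_mod_cast hM.ne'
  field_simp
  ring

lemma dist_stepPath_succ_le (hC : IsCascade P X ρ N σ τ A ε i₀ V bad M) (p : Pt d) (n : ℕ)
    (ω : Ω) (t : ℝ) :
    dist (stepPath p ρ i₀ M V n ω t) (stepPath p ρ i₀ M V (n + 1) ω t) ≤
      10 * ρ * (1 / N) ^ n := by
  have := hC.norm_sites_succ_sub_le' p n ⌊t * (M : ℝ) ^ (n + 1)⌋₊ ω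
  rw [floor_mul_pow_succ_div hC.M_pos] at this
  rw [dist_comm, dist_eq_norm]
  refine this.trans (le_of_eq ?_)
  rw [one_div, inv_pow]
  ring

/-- The limiting path. -/
noncomputable def limitPath (p : Pt d) (ρ : ℝ) (i₀ : Fin d) (M : ℕ) (V : ℕ → Pt d → Ω → Pt d)
    (ω : Ω) (t : ℝ) : Pt d :=
  Filter.limUnder Filter.atTop fun n => stepPath p ρ i₀ M V n ω t

lemma tendsto_stepPath (hC : IsCascade P X ρ N σ τ A ε i₀ V bad M) (p : Pt d) (ω : Ω) (t : ℝ) :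
    Filter.Tendsto (fun n => stepPath p ρ i₀ M V n ω t) Filter.atTop
      (nhds (limitPath p ρ i₀ M V ω t)) := by
  have hN := hC.two_le
  have h1 : 1 / N < 1 := by rw [div_lt_one (by linarith)]; linarith
  exact (cauchySeq_of_le_geometric (1 / N) (10 * ρ) h1
    (hC.dist_stepPath_succ_le p · ω t)).tendsto_limUnder

lemma norm_stepPath_sub_limitPath_le (hC : IsCascade P X ρ N σ τ A ε i₀ V bad M) (p : Pt d)
    (n : ℕ) (ω : Ω) (t : ℝ) :
    ‖stepPath p ρ i₀ M V n ω t - limitPath p ρ i₀ M V ω t‖ ≤ 20 * (ρ / N ^ n) := by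
  have hN := hC.two_le
  have h1 : 1 / N ≤ 1 / 2 := one_div_le_one_div_of_le (by norm_num) hN
  have h0 : 0 < 1 / N := by positivity
  rw [← dist_eq_norm]
  refine (dist_le_of_le_geometric_of_tendsto (1 / N) (10 * ρ) (by linarith)
    (hC.dist_stepPath_succ_le p · ω t) (hC.tendsto_stepPath p ω t) n).trans ?_
  rw [div_le_iff₀ (by linarith), one_div, inv_pow]
  have h2 := hC.scale_pos n
  rw [div_eq_mul_inv] at h2 ⊢
  rw [one_div] at h1
  nlinarith

lemma limitPath_apply (hC : IsCascade P X ρ N σ τ A ε i₀ V bad M) (hM : 2 ≤ M) (p : Pt d) (ω : Ω)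
    {t : ℝ} (ht : 0 ≤ t) : limitPath p ρ i₀ M V ω t i₀ = p i₀ + t * ρ := by
  have h1 : Filter.Tendsto (fun n => stepPath p ρ i₀ M V n ω t i₀) Filter.atTop
      (nhds (limitPath p ρ i₀ M V ω t i₀)) :=
    ((EuclideanSpace.proj (𝕜 := ℝ) i₀).continuous.tendsto _).comp (hC.tendsto_stepPath p ω t)
  refine tendsto_nhds_unique h1 ?_
  simp only [stepPath, hC.sites_apply]
  refine tendsto_const_nhds.add ?_
  have hM1 : (1 : ℝ) < M := by exact_mod_cast hM
  have h2 : Filter.Tendsto (fun n : ℕ => (⌊t * (M : ℝ) ^ n⌋₊ : ℝ) / M ^ n) Filter.atTop (nhds t) :=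
    (tendsto_nat_floor_mul_div_atTop ht).comp (tendsto_pow_atTop_atTop_of_one_lt hM1)
  refine (h2.mul_const ρ).congr fun n => ?_
  ring

lemma norm_limitPath_sub_le (hC : IsCascade P X ρ N σ τ A ε i₀ V bad M) (p : Pt d) (n : ℕ) (ω : Ω)
    {t t' : ℝ} (ht : 0 ≤ t) (htt' : t ≤ t') (h : t' - t ≤ 1 / M ^ n) :
    ‖limitPath p ρ i₀ M V ω t' - limitPath p ρ i₀ M V ω t‖ ≤ 47 * (ρ / N ^ n) := by
  have hM : (0 : ℝ) < M ^ n := by have := hC.M_pos; positivity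
  have h1 := hC.norm_stepPath_sub_limitPath_le p n ω t
  have h2 := hC.norm_stepPath_sub_limitPath_le p n ω t'
  have h3 : ‖stepPath p ρ i₀ M V n ω t' - stepPath p ρ i₀ M V n ω t‖ ≤ 7 * (ρ / N ^ n) := by
    have hle : ⌊t * (M : ℝ) ^ n⌋₊ ≤ ⌊t' * (M : ℝ) ^ n⌋₊ := Nat.floor_le_floor (by gcongr)
    have hle' : ⌊t' * (M : ℝ) ^ n⌋₊ ≤ ⌊t * (M : ℝ) ^ n⌋₊ + 1 := by
      rw [← Nat.floor_add_one (by positivity)]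
      refine Nat.floor_le_floor ?_
      rw [le_div_iff₀ hM] at h
      linarith
    rcases (by omega : ⌊t' * (M : ℝ) ^ n⌋₊ = ⌊t * (M : ℝ) ^ n⌋₊ ∨
      ⌊t' * (M : ℝ) ^ n⌋₊ = ⌊t * (M : ℝ) ^ n⌋₊ + 1) with h' | h'
    · rw [stepPath, stepPath, h', sub_self, norm_zero]
      have := hC.scale_pos n
      positivity
    · rw [stepPath, stepPath, h']
      exact (hC.norm_sites_sub_le p n _ ω).1
  calc _ = ‖-(stepPath p ρ i₀ M V n ω t' - limitPath p ρ i₀ M V ω t') +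
        (stepPath p ρ i₀ M V n ω t' - stepPath p ρ i₀ M V n ω t) +
        (stepPath p ρ i₀ M V n ω t - limitPath p ρ i₀ M V ω t)‖ := by congr 1; abel
    _ ≤ 20 * (ρ / N ^ n) + 7 * (ρ / N ^ n) + 20 * (ρ / N ^ n) := by
      refine (norm_add₃_le).trans (add_le_add (add_le_add ?_ h3) h1)
      rwa [norm_neg]
    _ = 47 * (ρ / N ^ n) := by ring

lemma continuousOn_limitPath (hC : IsCascade P X ρ N σ τ A ε i₀ V bad M) (p : Pt d) (ω : Ω) :
    ContinuousOn (limitPath p ρ i₀ M V ω) (Set.Ici 0) := by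
  have hN := hC.two_le
  refine Metric.continuousOn_iff.2 fun t ht δ hδ => ?_
  have hlim : Filter.Tendsto (fun n : ℕ => 47 * (ρ / N ^ n)) Filter.atTop (nhds (47 * 0)) :=
    ((tendsto_pow_atTop_atTop_of_one_lt (by linarith)).const_div_atTop ρ).const_mul 47
  rw [mul_zero] at hlim
  obtain ⟨n, hn⟩ := (hlim.eventually (gt_mem_nhds hδ)).exists
  have hM : (0 : ℝ) < M ^ n := by have := hC.M_pos; positivity
  refine ⟨1 / M ^ n, by positivity, fun t' ht' h => ?_⟩
  rw [Real.dist_eq] at h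
  rw [dist_eq_norm]
  refine lt_of_le_of_lt ?_ hn
  rcases le_total t t' with htt' | htt'
  · exact hC.norm_limitPath_sub_le p n ω ht htt' ((le_abs_self _).trans h.le)
  · rw [norm_sub_rev]
    refine hC.norm_limitPath_sub_le p n ω ht' htt' ?_
    rw [abs_sub_comm] at h
    exact (le_abs_self _).trans h.le

lemma norm_limitPath_sub_line_le (hC : IsCascade P X ρ N σ τ A ε i₀ V bad M) (p : Pt d) (ω : Ω)
    {t : ℝ} (ht : 0 ≤ t) :
    ‖limitPath p ρ i₀ M V ω t - (p + EuclideanSpace.single i₀ (t * ρ))‖ ≤ 21 * ρ := by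
  have h1 := hC.norm_stepPath_sub_limitPath_le p 0 ω t
  have h2 : ‖stepPath p ρ i₀ M V 0 ω t - (p + EuclideanSpace.single i₀ (t * ρ))‖ ≤ ρ := by
    have : stepPath p ρ i₀ M V 0 ω t - (p + EuclideanSpace.single i₀ (t * ρ)) =
        EuclideanSpace.single i₀ ((⌊t⌋₊ - t) * ρ) := by
      ext j
      by_cases h : j = i₀ <;> simp [stepPath, sites, h]
      ring
    rw [this, PiLp.norm_single, Real.norm_eq_abs, abs_mul, abs_of_pos hC.ρ_pos]
    refine mul_le_of_le_one_left hC.ρ_pos.le ?_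
    rw [abs_le]
    constructor <;> linarith [Nat.floor_le ht, Nat.lt_floor_add_one t]
  rw [pow_zero, div_one] at h1
  rw [← sub_add_sub_cancel _ (stepPath p ρ i₀ M V 0 ω t) _]
  refine (norm_add_le _ _).trans ?_
  rw [norm_sub_rev]
  linarith

end IsCascade

namespace IsCascade

lemma isCountablyValued_base {d : ℕ} {Ω : Type} {p : Pt d} {ρ : ℝ} {i₀ : Fin d} {M : ℕ}
    {V : ℕ → Pt d → Ω → Pt d} {n : ℕ} {m : MeasurableSpace Ω}
    (h : ∀ i, IsCountablyValued m (sites p ρ i₀ M V n i)) (i : ℕ) :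
    IsCountablyValued m (base p ρ i₀ M V n i) :=
  (h (i / M)).map₂ (h (i / M + 1)) fun x y => x + ((i % M : ℕ) / M : ℝ) • (y - x)

variable {d : ℕ} {Ω : Type} [MeasurableSpace Ω] {P : Measure Ω} {X : ℕ → Pt d → Ω → ℝ}
  {ρ N σ τ A : ℝ} {ε : ENNReal} {i₀ : Fin d} {V : ℕ → Pt d → Ω → Pt d}
  {bad : ℕ → Pt d → Set Ω} {M : ℕ}

lemma isCountablyValued_sites (hC : IsCascade P X ρ N σ τ A ε i₀ V bad M) (p : Pt d) (n i : ℕ) :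
    IsCountablyValued (⨆ k ∈ Set.Iio n, fieldSigma (X k)) (sites p ρ i₀ M V n i) := by
  induction n generalizing i with
  | zero => exact .const _
  | succ n ih =>
    have hle : (⨆ k ∈ Set.Iio n, fieldSigma (X k)) ≤ ⨆ k ∈ Set.Iio (n + 1), fieldSigma (X k) :=
      biSup_mono fun k hk => Nat.lt_succ_of_lt hk
    have hle' : fieldSigma (X n) ≤ ⨆ k ∈ Set.Iio (n + 1), fieldSigma (X k) :=
      le_iSup₂_of_le n (Nat.lt_succ_self n) le_rfl
    exact ((isCountablyValued_base ih i).mono hle).bind (V := fun y ω => y + V n y ω)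
      fun y => (((hC.step n).countablyValued y).mono hle').map (y + ·)

lemma measure_iInter_le [IsProbabilityMeasure P] (hC : IsCascade P X ρ N σ τ A ε i₀ V bad M)
    (p : Pt d) (idx : ℕ → ℕ) (n : ℕ) (T : Finset ℕ) (hT : T ⊆ Finset.range n) :
    P (⋂ k ∈ T, {ω | ω ∈ bad k (base p ρ i₀ M V k (idx k) ω)}) ≤ ε ^ T.card ∧
    MeasurableSet[⨆ k ∈ Set.Iio n, fieldSigma (X k)]
      (⋂ k ∈ T, {ω | ω ∈ bad k (base p ρ i₀ M V k (idx k) ω)}) := by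
  induction n generalizing T with
  | zero =>
    have : T = ∅ := by simpa using hT
    subst this
    simp
  | succ n ih =>
    have hle : (⨆ k ∈ Set.Iio n, fieldSigma (X k)) ≤ ⨆ k ∈ Set.Iio (n + 1), fieldSigma (X k) :=
      biSup_mono fun k hk => Nat.lt_succ_of_lt hk
    have hle' : fieldSigma (X n) ≤ ⨆ k ∈ Set.Iio (n + 1), fieldSigma (X k) :=
      le_iSup₂_of_le n (Nat.lt_succ_self n) le_rfl
    have hle0 : (⨆ k ∈ Set.Iio n, fieldSigma (X k)) ≤ ‹MeasurableSpace Ω› :=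
      iSup₂_le fun k _ => hC.le k
    have hsub : T.erase n ⊆ Finset.range n := by
      intro k hk
      have h1 := Finset.mem_range.1 (hT (Finset.mem_of_mem_erase hk))
      have h2 := Finset.ne_of_mem_erase hk
      rw [Finset.mem_range]
      omega
    obtain ⟨h1, h2⟩ := ih _ hsub
    by_cases hn : n ∈ T
    · have hcv := isCountablyValued_base (fun i => hC.isCountablyValued_sites p n i) (idx n)
      have hTe : T = insert n (T.erase n) := (Finset.insert_erase hn).symm
      have hset : (⋂ k ∈ T, {ω | ω ∈ bad k (base p ρ i₀ M V k (idx k) ω)}) =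
          (⋂ k ∈ T.erase n, {ω | ω ∈ bad k (base p ρ i₀ M V k (idx k) ω)}) ∩
            {ω | ω ∈ bad n (base p ρ i₀ M V n (idx n) ω)} := by
        conv_lhs => rw [hTe]
        rw [Finset.set_biInter_insert, Set.inter_comm]
      rw [hset]
      constructor
      · have hcard : T.card = (T.erase n).card + 1 := (Finset.card_erase_add_one hn).symm
        refine (hcv.measure_inter_le hle0 h2 (ε := ε) fun y E hE => ?_).trans ?_
        · have hind := indep_iSup_of_disjoint hC.le hC.indep (S := Set.Iio n) (T := {n}) (by simp)
          have hn' : fieldSigma (X n) ≤ ⨆ k ∈ ({n} : Set ℕ), fieldSigma (X k) :=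
            le_iSup₂_of_le n rfl le_rfl
          rw [(Indep_iff _ _ _).1 hind _ _ hE (hn' _ ((hC.step n).measurableSet_bad y)), mul_comm]
          gcongr
          exact (hC.step n).measure_bad_le y
        · rw [hcard, pow_succ, mul_comm]
          gcongr
      · exact (hle _ h2).inter ((hcv.mono hle).measurableSet_mem
          fun y => hle' _ ((hC.step n).measurableSet_bad y))
    · rw [Finset.erase_eq_of_notMem hn] at h1 h2
      exact ⟨h1, hle _ h2⟩

lemma le_of_notMem_bad (hC : IsCascade P X ρ N σ τ A ε i₀ V bad M) (p : Pt d) (k : ℕ) {ω : Ω}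
    {t : ℝ} (h : ω ∉ bad k (base p ρ i₀ M V k ⌊t * (M : ℝ) ^ (k + 1)⌋₊ ω)) (x : Pt d)
    (hx : ‖x - limitPath p ρ i₀ M V ω t‖ ≤ σ / 2 * (ρ / N ^ (k + 1))) : A ≤ X k x ω := by
  set i := ⌊t * (M : ℝ) ^ (k + 1)⌋₊ with hi
  refine (hC.step k).high _ ω h x ?_
  rw [← sites_succ]
  have h1 := (hC.step k).close _ ω h _ (hC.norm_sites_sub_le p k i ω).2
  rw [← sites_succ, ← sites_succ] at h1
  have h2 := hC.norm_sites_succ_sub_le p (k + 1) ⌊t * (M : ℝ) ^ (k + 1 + 1)⌋₊ ω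
    (c := σ * (ρ / N ^ (k + 1))) (by rw [floor_mul_pow_succ_div hC.M_pos]; exact h1)
  rw [floor_mul_pow_succ_div hC.M_pos, ← hi] at h2
  have h3 := hC.norm_stepPath_sub_limitPath_le p (k + 1 + 1) ω t
  rw [norm_sub_rev] at h3
  have h4 := norm_add₃_le (a := x - limitPath p ρ i₀ M V ω t)
    (b := limitPath p ρ i₀ M V ω t - stepPath p ρ i₀ M V (k + 1 + 1) ω t)
    (c := stepPath p ρ i₀ M V (k + 1 + 1) ω t - sites p ρ i₀ M V (k + 1) i ω)
  rw [sub_add_sub_cancel, sub_add_sub_cancel] at h4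
  rw [stepPath] at h3 h4
  have h5 := hC.scale_succ (k + 1)
  have h6 := hC.scale_pos (k + 1 + 1)
  have h7 := mul_le_mul_of_nonneg_right hC.le_σ_mul h6.le
  generalize ρ / N ^ (k + 1 + 1) = u at *
  rw [h5] at hx h2 ⊢
  linarith

/-- Almost surely, along the limiting path, all but a fraction `1 / q` of the fields are large. -/
theorem ae_eventually_card_le [IsProbabilityMeasure P]
    (hC : IsCascade P X ρ N σ τ A ε i₀ V bad M) (p : Pt d) (I₀ : ℕ) {q : ℕ} (hq : 0 < q)
    (hε : (4 * M) ^ q * ε ≤ 1) :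
    ∀ᵐ ω ∂P, ∀ᶠ n : ℕ in Filter.atTop, ∀ t : ℝ, 0 ≤ t → t < I₀ →
      ∃ T ⊆ Finset.range n, T.card ≤ n / q ∧ ∀ k < n, k ∉ T → ∀ x,
        ‖x - limitPath p ρ i₀ M V ω t‖ ≤ σ / 2 * (ρ / N ^ (k + 1)) → A ≤ X k x ω := by
  classical
  have hM := hC.M_pos
  let Ev (n i k : ℕ) : Set Ω := {ω | ω ∈ bad k (base p ρ i₀ M V k (i / M ^ (n - (k + 1))) ω)}
  let s (n : ℕ) : Set Ω := ⋃ i ∈ Finset.range (I₀ * M ^ n),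
    ⋃ T ∈ (Finset.range n).powersetCard (n / q + 1), ⋂ k ∈ T, Ev n i k
  have hs (n : ℕ) : P (s n) ≤ I₀ * (2⁻¹ : ENNReal) ^ n := by
    calc P (s n) ≤ ∑ i ∈ Finset.range (I₀ * M ^ n), 2 ^ n * ε ^ (n / q + 1) := by
          refine (measure_biUnion_finset_le _ _).trans (Finset.sum_le_sum fun i _ => ?_)
          have := measure_card_le (P := P) (Finset.range n) (Ev n i) ε (fun T hT =>
            (hC.measure_iInter_le p (fun k => i / M ^ (n - (k + 1))) n T hT).1) (n / q + 1)
          rwa [Finset.card_range] at this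
      _ = I₀ * ((2 * M) ^ n * ε ^ (n / q + 1)) := by
          rw [Finset.sum_const, Finset.card_range, nsmul_eq_mul, mul_pow]
          push_cast
          ring
      _ ≤ I₀ * (2⁻¹ : ENNReal) ^ n := by
          gcongr
          rw [← ENNReal.inv_pow, ENNReal.le_inv_iff_mul_le]
          have h1 : (1 : ENNReal) ≤ 4 * M := by exact_mod_cast (by omega : 1 ≤ 4 * M)
          have h2 : n ≤ q * (n / q + 1) := (Nat.lt_mul_div_succ n hq).le
          calc (2 * M : ENNReal) ^ n * ε ^ (n / q + 1) * 2 ^ n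
              = (4 * M) ^ n * ε ^ (n / q + 1) := by
                rw [mul_right_comm, ← mul_pow]; congr 2; ring
            _ ≤ (4 * M) ^ (q * (n / q + 1)) * ε ^ (n / q + 1) := by
                gcongr
            _ = ((4 * M) ^ q * ε) ^ (n / q + 1) := by rw [pow_mul, ← mul_pow]
            _ ≤ 1 := pow_le_one' hε _
  have hsum : ∑' n, P (s n) ≠ ⊤ := by
    refine ne_top_of_le_ne_top ?_ (ENNReal.tsum_le_tsum hs)
    rw [ENNReal.tsum_mul_left, ENNReal.tsum_geometric]
    simp [ENNReal.mul_eq_top]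
  filter_upwards [ae_eventually_notMem hsum] with ω hω
  filter_upwards [hω] with n hn t ht htI
  set i := ⌊t * (M : ℝ) ^ n⌋₊ with hi
  have hMr : (0 : ℝ) < M := by exact_mod_cast hM
  have hin : i ∈ Finset.range (I₀ * M ^ n) := by
    rw [Finset.mem_range, hi, Nat.floor_lt (by positivity)]
    push_cast
    gcongr
  have hn' : ω ∉ ⋃ T ∈ (Finset.range n).powersetCard (n / q + 1), ⋂ k ∈ T, Ev n i k :=
    fun h => hn (Set.mem_biUnion hin h)
  refine ⟨(Finset.range n).filter fun k => ω ∈ Ev n i k, Finset.filter_subset _ _,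
    Nat.lt_succ_iff.1 (card_filter_lt_of_notMem _ _ hn'), fun k hk hkT => ?_⟩
  have hkE : ω ∉ Ev n i k := fun h => hkT (Finset.mem_filter.2 ⟨Finset.mem_range.2 hk, h⟩)
  have hidx : i / M ^ (n - (k + 1)) = ⌊t * (M : ℝ) ^ (k + 1)⌋₊ := by
    rw [hi, ← Nat.floor_div_natCast]
    congr 1
    push_cast
    rw [div_eq_iff (by positivity), mul_assoc, ← pow_add]
    congr 2
    omega
  refine hC.le_of_notMem_bad p k ?_
  rw [← hidx]
  exact hkE

end IsCascade

section increments

lemma field_sub_mem {d : ℕ} {Ω : Type} {h : ℕ → Pt d → Ω → ℝ} {n m : ℕ}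
    (hn : 1 ≤ n) (hm : 1 ≤ m) (x : Pt d) :
    h m x - h n x ∈ fieldSpan h :=
  (fieldSpan h).sub_mem (mem_fieldSpan hm x) (mem_fieldSpan hn x)

/-- The increments of the field `h` over blocks of `L` consecutive scales. -/
def incr {d : ℕ} {Ω : Type} (h : ℕ → Pt d → Ω → ℝ) (L m₀ k : ℕ) (x : Pt d) : Ω → ℝ :=
  h ((m₀ + k + 1) * L) x - h ((m₀ + k) * L) x

lemma incr_mem {d : ℕ} {Ω : Type} {h : ℕ → Pt d → Ω → ℝ} {L m₀ : ℕ} (hL : 1 ≤ L) (hm₀ : 1 ≤ m₀)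
    (k : ℕ) (x : Pt d) :
    incr h L m₀ k x ∈ fieldSpan h :=
  field_sub_mem (Nat.mul_pos (by omega) hL) (Nat.mul_pos (by omega) hL) x

variable {d : ℕ} {Ω : Type} [MeasurableSpace Ω] {P : Measure Ω} [IsProbabilityMeasure P]
  {h : ℕ → Pt d → Ω → ℝ}

lemma covariance_field_eq (hf : IsWhiteNoiseField d P h) {n m : ℕ} (hn : 1 ≤ n) (hnm : n ≤ m)
    (x y : Pt d) : cov[h n x, h m y; P] = bandKernel d (2 ^ n)⁻¹ 1 (x - y) := by
  rw [covariance_field hf hn (hn.trans hnm), wnKernel_eq, bandKernel_eq_of_norm_eq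
    (norm_sub_rev y x),
    ← Nat.cast_min, min_eq_left hnm, zpow_neg, zpow_natCast]

lemma covariance_field_eq' (hf : IsWhiteNoiseField d P h) {n m : ℕ} (hn : 1 ≤ n) (hnm : n ≤ m)
    (x y : Pt d) : cov[h m x, h n y; P] = bandKernel d (2 ^ n)⁻¹ 1 (x - y) := by
  rw [covariance_comm, covariance_field_eq hf hn hnm, bandKernel_eq_of_norm_eq (norm_sub_rev y x)]

lemma isBandField_field (hf : IsWhiteNoiseField d P h) {n : ℕ} (hn : 1 ≤ n) :
    IsBandField P (fieldSpan h) (h n) (2 ^ n)⁻¹ 1 where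
  space := isGaussianSpace_fieldSpan hf
  mem x := mem_fieldSpan hn x
  cont ω := hf.2.2 ω n
  cov x y := covariance_field_eq hf hn le_rfl x y

lemma covariance_sub_sub (hf : IsWhiteNoiseField d P h) {n m n' m' : ℕ} (hn : 1 ≤ n)
    (hm : 1 ≤ m) (hn' : 1 ≤ n') (hm' : 1 ≤ m') (x y : Pt d) :
    cov[h m x - h n x, h m' y - h n' y; P] =
      cov[h m x, h m' y; P] - cov[h m x, h n' y; P] - cov[h n x, h m' y; P] +
        cov[h n x, h n' y; P] := by
  have hG := isGaussianSpace_fieldSpan hf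
  rw [hG.cov_sub_left (mem_fieldSpan hm x) (mem_fieldSpan hn x) (field_sub_mem hn' hm' y),
    hG.cov_sub_right (mem_fieldSpan hm' y) (mem_fieldSpan hn' y) (mem_fieldSpan hm x),
    hG.cov_sub_right (mem_fieldSpan hm' y) (mem_fieldSpan hn' y) (mem_fieldSpan hn x)]
  ring

lemma isBandField_sub (hf : IsWhiteNoiseField d P h) {n m : ℕ} (hn : 1 ≤ n) (hnm : n ≤ m) :
    IsBandField P (fieldSpan h) (fun x => h m x - h n x) (2 ^ m)⁻¹ (2 ^ n)⁻¹ where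
  space := isGaussianSpace_fieldSpan hf
  mem x := field_sub_mem hn (hn.trans hnm) x
  cont ω := (hf.2.2 ω m).sub (hf.2.2 ω n)
  cov x y := by
    have hm := hn.trans hnm
    rw [covariance_sub_sub hf hn hm hn hm, covariance_field_eq hf hm le_rfl,
      covariance_field_eq hf hn le_rfl, covariance_field_eq hf hn hnm,
      covariance_field_eq' hf hn hnm,
      ← bandKernel_add (s := (2 ^ n)⁻¹) (r := (2 ^ m)⁻¹) (by positivity) (by positivity) one_pos]
    ring

lemma covariance_sub_sub_eq_zero (hf : IsWhiteNoiseField d P h) {n m n' m' : ℕ} (hn : 1 ≤ n)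
    (hnm : n ≤ m) (hmn' : m ≤ n') (hnm' : n' ≤ m') (x y : Pt d) :
    cov[h m x - h n x, h m' y - h n' y; P] = 0 := by
  have hm := hn.trans hnm
  have hn' := hm.trans hmn'
  rw [covariance_sub_sub hf hn hm hn' (hn'.trans hnm'),
    covariance_field_eq hf hm (hmn'.trans hnm'), covariance_field_eq hf hm hmn',
    covariance_field_eq hf hn (hnm.trans (hmn'.trans hnm')),
    covariance_field_eq hf hn (hnm.trans hmn')]
  ring

lemma isBandField_incr (hf : IsWhiteNoiseField d P h) {L m₀ : ℕ} (hL : 1 ≤ L) (hm₀ : 1 ≤ m₀)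
    (k : ℕ) : IsBandField P (fieldSpan h) (incr h L m₀ k) (2 ^ ((m₀ + k + 1) * L))⁻¹
      (2 ^ ((m₀ + k) * L))⁻¹ :=
  isBandField_sub hf (Nat.mul_pos (by omega) hL) (Nat.mul_le_mul_right L (by omega))

lemma covariance_incr_eq_zero (hf : IsWhiteNoiseField d P h) {L m₀ : ℕ} (hL : 1 ≤ L)
    (hm₀ : 1 ≤ m₀) {k k' : ℕ} (hk : k ≠ k') (x y : Pt d) :
    cov[incr h L m₀ k x, incr h L m₀ k' y; P] = 0 := by
  have key {k k' : ℕ} (hk : k < k') (x y : Pt d) :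
      cov[incr h L m₀ k x, incr h L m₀ k' y; P] = 0 :=
    covariance_sub_sub_eq_zero hf (Nat.mul_pos (by omega) hL) (Nat.mul_le_mul_right L (by omega))
      (Nat.mul_le_mul_right L (by omega)) (Nat.mul_le_mul_right L (by omega)) x y
  rcases hk.lt_or_gt with hk | hk
  · exact key hk x y
  · rw [covariance_comm]; exact key hk y x

lemma iIndep_incr (hf : IsWhiteNoiseField d P h) {L m₀ : ℕ} (hL : 1 ≤ L) (hm₀ : 1 ≤ m₀) :
    iIndep (fun k => fieldSigma (incr h L m₀ k)) P :=
  (isGaussianSpace_fieldSpan hf).iIndepFun (fun k x => incr h L m₀ k x)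
    (fun k x => incr_mem hL hm₀ k x) fun _ _ hk x y => covariance_incr_eq_zero hf hL hm₀ hk x y

theorem exists_isCascade (hf : IsWhiteNoiseField d P h) (hd : 16 ≤ d) {L m₀ : ℕ} (hL : 1 ≤ L)
    (hm₀ : 1 ≤ m₀) (hdL : 6 * (d : ℝ) ≤ 2 ^ L) {σ τ A B₁ B₂ : ℝ} {K₁ K₂ M : ℕ}
    (hσ : 0 < σ) (hσ1 : σ ≤ 1 / 2) (hτ : 0 < τ) (hτσ : τ ≤ σ / 2)
    (hA : A = Real.sqrt d / (1024 * L)) (hB₁ : 16 * (d + 1) ≤ B₁)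
    (hB₁' : B₁ ≤ A ^ 2 / (256 * (d * Real.sqrt d) * σ)) (hB₂ : 16 * (d + 1) ≤ B₂)
    (hB₂' : B₂ ≤ (σ / 192) ^ 2 / (128 * (d * Real.sqrt d) * τ)) (hK₁ : 5 ≤ K₁ * (2 * σ))
    (hK₂ : 5 ≤ K₂ * τ) (hM : 0 < M) (hσN : 46 ≤ σ * 2 ^ L) (hτM : 7 * 2 ^ L ≤ τ * M)
    (i₀ : Fin d) :
    ∃ V bad, IsCascade P (incr h L m₀) (2 ^ (m₀ * L))⁻¹ (2 ^ L) σ τ A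
      (stepError d K₁ K₂ B₁ B₂ A L) i₀ V bad M := by
  have hN : (2 : ℝ) ^ ((m₀ * L)) ≠ 0 := by positivity
  have hstep (k : ℕ) : ∃ V bad, IsStepMap P (incr h L m₀ k) ((2 ^ (m₀ * L))⁻¹ / (2 ^ L) ^ (k + 1))
      σ τ A (stepError d K₁ K₂ B₁ B₂ A L) i₀ V bad := by
    have hr : ((2 : ℝ) ^ (m₀ * L))⁻¹ / (2 ^ L) ^ (k + 1) = (2 ^ ((m₀ + k + 1) * L))⁻¹ := by
      rw [← pow_mul, div_eq_mul_inv, ← mul_inv, ← pow_add]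
      congr 2; ring
    have hR : ((2 : ℝ) ^ ((m₀ + k) * L))⁻¹ = 2 ^ L * (2 ^ ((m₀ + k + 1) * L))⁻¹ := by
      rw [add_mul _ 1, one_mul, pow_add]
      field_simp
    rw [hr]
    refine (isBandField_incr hf hL hm₀ k).exists_isStepMap (by positivity) hd ?_ ?_ hσ hσ1 hτ hτσ
      hA hB₁ hB₁' hB₂ hB₂' hK₁ hK₂ i₀
    · rw [hR]; gcongr
    · rw [hR, mul_div_cancel_right₀ _ (by positivity), Real.log_pow]
      have := Real.log_two_lt_d9
      exact mul_le_of_le_one_right (by positivity) (by linarith)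
  choose V bad hVb using hstep
  exact ⟨V, bad, {
    step := hVb
    indep := iIndep_incr hf hL hm₀
    le := fun k => (isBandField_incr hf hL hm₀ k).fieldSigma_le
    ρ_pos := by positivity
    two_le := by
      calc (2 : ℝ) = 2 ^ 1 := by norm_num
        _ ≤ 2 ^ L := by gcongr; norm_num
    M_pos := hM
    σ_pos := hσ
    le_σ_mul := hσN
    le_τ_mul := hτM
    τ_le := by linarith }⟩

end increments

lemma ae_eventually_notMem_of_le {Ω : Type} [MeasurableSpace Ω] {P : Measure Ω} {s : ℕ → Set Ω}
    {C : ENNReal} (hC : C ≠ ⊤) (hs : ∀ᶠ j in Filter.atTop, P (s j) ≤ C * 2⁻¹ ^ j) :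
    ∀ᵐ ω ∂P, ∀ᶠ j in Filter.atTop, ω ∉ s j := by
  obtain ⟨J, hJ⟩ := Filter.eventually_atTop.1 hs
  have hsum : ∑' j, P (s (j + J)) ≠ ⊤ := by
    refine ne_top_of_le_ne_top (b := ∑' j, C * 2⁻¹ ^ J * (2⁻¹ : ENNReal) ^ j) ?_
      (ENNReal.tsum_le_tsum fun j => (hJ _ (Nat.le_add_left _ _)).trans_eq
        (by rw [pow_add]; ring))
    rw [ENNReal.tsum_mul_left, ENNReal.tsum_geometric]
    refine ENNReal.mul_ne_top (ENNReal.mul_ne_top hC ?_) (by simp)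
    exact ENNReal.pow_ne_top (by simp)
  filter_upwards [ae_eventually_notMem hsum] with ω hω
  exact (Filter.eventually_atTop.1 hω).elim fun j hj => Filter.eventually_atTop.2
    ⟨j + J, fun i hi => by
      have := hj (i - J) (by omega)
      rwa [Nat.sub_add_cancel (by omega)] at this⟩

lemma ofReal_exp_neg_le {x : ℝ} {n : ℕ} (h : n ≤ x) :
    ENNReal.ofReal (Real.exp (-x)) ≤ 2⁻¹ ^ n := by
  have h2 : Real.exp (-1) ≤ 2⁻¹ := by
    rw [Real.exp_neg]
    exact inv_anti₀ two_pos (by linarith [Real.add_one_le_exp (1 : ℝ)])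
  have h3 : Real.exp (-x) ≤ 2⁻¹ ^ n := by
    calc Real.exp (-x) ≤ Real.exp (n * (-1)) := Real.exp_le_exp.2 (by linarith)
      _ = Real.exp (-1) ^ n := Real.exp_nat_mul _ _
      _ ≤ 2⁻¹ ^ n := by gcongr
  refine (ENNReal.ofReal_le_ofReal h3).trans_eq ?_
  rw [ENNReal.ofReal_pow (by norm_num), ENNReal.ofReal_inv_of_pos two_pos]
  simp

lemma two_pow_mul_inv_pow_le {a b c : ℕ} (h : a + c ≤ b) :
    (2 : ENNReal) ^ a * 2⁻¹ ^ b ≤ 2⁻¹ ^ c := by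
  obtain ⟨e, rfl⟩ := Nat.exists_eq_add_of_le h
  have h1 : (2⁻¹ : ENNReal) ≤ 1 := by simp
  calc (2 : ENNReal) ^ a * 2⁻¹ ^ (a + c + e) = (2 * 2⁻¹) ^ a * 2⁻¹ ^ c * 2⁻¹ ^ e := by
        rw [pow_add, pow_add, mul_pow]; ring
    _ ≤ 1 * 2⁻¹ ^ c * 1 := by
        rw [ENNReal.mul_inv_cancel (by simp) (by simp), one_pow]
        gcongr
        exact pow_le_one' h1 _
    _ = 2⁻¹ ^ c := by ring

lemma two_pow_mul_exp_neg_le (j a : ℕ) :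
    (2 : ENNReal) ^ (j * a) * ENNReal.ofReal (Real.exp (-(j * (a + 1)))) ≤ 2⁻¹ ^ j := by
  have h : ENNReal.ofReal (Real.exp (-(j * (a + 1)))) ≤ 2⁻¹ ^ (j * (a + 1)) :=
    ofReal_exp_neg_le (by push_cast; rfl)
  calc _ ≤ (2 : ENNReal) ^ (j * a) * 2⁻¹ ^ (j * (a + 1)) := by gcongr
    _ ≤ _ := two_pow_mul_inv_pow_le (by rw [mul_add, mul_one])

lemma box_count_le (d H j : ℕ) :
    ((2 * (H * 2 ^ j) + 1 : ℕ) : ENNReal) ^ d ≤ (2 * H + 1) ^ d * 2 ^ (j * d) := by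
  rw [pow_mul, ← mul_pow]
  gcongr
  have h : 2 * (H * 2 ^ j) + 1 ≤ (2 * H + 1) * 2 ^ j := by
    have := Nat.one_le_two_pow (n := j)
    nlinarith
  exact_mod_cast h

section lattice

variable {d : ℕ}

/-- The largest point of `p + 2⁻ʲ ℤᵈ` below `x`. -/
noncomputable def latticePt (p : Pt d) (j : ℕ) (x : Pt d) : Pt d :=
  WithLp.toLp 2 fun i => p i + ⌊(x i - p i) * 2 ^ j⌋ / 2 ^ j

lemma latticePt_apply (p : Pt d) (j : ℕ) (x : Pt d) (i : Fin d) :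
    latticePt p j x i = p i + ⌊(x i - p i) * 2 ^ j⌋ / 2 ^ j := rfl

lemma abs_sub_latticePt_le (p : Pt d) (j : ℕ) (x : Pt d) (i : Fin d) :
    |x i - latticePt p j x i| ≤ (2 ^ j)⁻¹ := by
  have h : (0 : ℝ) < 2 ^ j := by positivity
  have h1 : x i - latticePt p j x i =
      ((x i - p i) * 2 ^ j - ⌊(x i - p i) * 2 ^ j⌋) * (2 ^ j)⁻¹ := by
    rw [latticePt_apply]
    field_simp
    ring
  rw [h1, abs_mul, abs_of_pos (inv_pos.2 h), Int.self_sub_floor, Int.abs_fract]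
  exact mul_le_of_le_one_left (inv_pos.2 h).le (Int.fract_lt_one _).le

lemma abs_floor_le {p x : Pt d} {H : ℕ} (hx : ∀ i, |x i - p i| ≤ H) (j : ℕ) (i : Fin d) :
    -((H * 2 ^ j : ℕ) : ℤ) ≤ ⌊(x i - p i) * 2 ^ j⌋ ∧
      ⌊(x i - p i) * 2 ^ j⌋ ≤ ((H * 2 ^ j : ℕ) : ℤ) := by
  have h : (0 : ℝ) < 2 ^ j := by positivity
  obtain ⟨h1, h2⟩ := abs_le.1 (hx i)
  constructor
  · rw [Int.le_floor]; push_cast; nlinarith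
  · rw [← Int.cast_le (R := ℝ)]
    refine (Int.floor_le _).trans ?_
    push_cast; nlinarith

lemma abs_latticePt_sub_le {p x : Pt d} {H : ℕ} (hx : ∀ i, |x i - p i| ≤ H) (j : ℕ) (i : Fin d) :
    |latticePt p j x i - p i| ≤ H := by
  have h : (0 : ℝ) < 2 ^ j := by positivity
  obtain ⟨h1, h2⟩ := abs_floor_le hx j i
  rw [latticePt_apply, add_sub_cancel_left, abs_div, abs_of_pos h, div_le_iff₀ h]
  exact abs_le.2 ⟨by exact_mod_cast h1, by exact_mod_cast h2⟩

variable {Ω : Type} [MeasurableSpace Ω] {P : Measure Ω} [IsProbabilityMeasure P]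
  {S : Submodule ℝ (Ω → ℝ)}

lemma IsGaussianSpace.ae_eventually_lattice {ι : Type*} (hG : IsGaussianSpace P S) (p : Pt d)
    (H : ℕ) (s : ℕ → Finset ι) (hs : ∀ j, (s j).card ≤ 2 ^ j) (Y : ℕ → ι → Pt d → Ω → ℝ)
    {c : ℝ} (hc : 0 < c)
    (hY : ∀ᶠ j : ℕ in Filter.atTop, ∀ a ∈ s j, ∀ z, Y j a z ∈ S ∧
      Var[Y j a z; P] ≤ c ^ 2 * j / (2 * (d + 2))) :
    ∀ᵐ ω ∂P, ∀ᶠ j : ℕ in Filter.atTop, ∀ a ∈ s j, ∀ x : Pt d, (∀ i, |x i - p i| ≤ H) →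
      -(c * j) < Y j a (latticePt p j x) ω := by
  classical
  let U (j : ℕ) : Finset (Fin d → ℤ) := Fintype.piFinset fun _ =>
    Finset.Icc (-((H * 2 ^ j : ℕ) : ℤ)) ((H * 2 ^ j : ℕ) : ℤ)
  let z (j : ℕ) (u : Fin d → ℤ) : Pt d := WithLp.toLp 2 fun i => p i + u i / 2 ^ j
  let E (j : ℕ) : Set Ω := ⋃ a ∈ s j, ⋃ u ∈ U j, {ω | Y j a (z j u) ω ≤ -(c * j)}
  have hU (j : ℕ) : (U j).card = (2 * (H * 2 ^ j) + 1) ^ d := by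
    simp only [U, Fintype.card_piFinset, Int.card_Icc, Finset.prod_const, Finset.card_univ,
      Fintype.card_fin]
    congr 1
    omega
  have hE : ∀ᶠ j in Filter.atTop, P (E j) ≤ (2 * H + 1) ^ d * 2⁻¹ ^ j := by
    filter_upwards [hY, Filter.eventually_gt_atTop 0] with j hj hj0
    have hj0' : (0 : ℝ) < j := by exact_mod_cast hj0
    calc P (E j) ≤ ∑ a ∈ s j, ∑ u ∈ U j, ENNReal.ofReal (Real.exp (-(j * ((d + 1 : ℕ) + 1)))) := by
          refine (measure_biUnion_finset_le _ _).trans (Finset.sum_le_sum fun a ha => ?_)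
          refine (measure_biUnion_finset_le _ _).trans (Finset.sum_le_sum fun u hu => ?_)
          obtain ⟨h1, h2⟩ := hj a ha (z j u)
          refine (hG.measure_le_neg_le h1 h2 (by positivity)).trans_eq ?_
          congr 2
          push_cast
          field_simp
          ring
      _ = (s j).card * (((2 * (H * 2 ^ j) + 1 : ℕ) : ENNReal) ^ d *
          ENNReal.ofReal (Real.exp (-(j * ((d + 1 : ℕ) + 1))))) := by
          simp only [Finset.sum_const, nsmul_eq_mul, hU]
          push_cast
          rfl
      _ ≤ 2 ^ j * (((2 * H + 1) ^ d * 2 ^ (j * d)) *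
          ENNReal.ofReal (Real.exp (-(j * ((d + 1 : ℕ) + 1))))) := by
          gcongr
          · exact_mod_cast hs j
          · exact box_count_le d H j
      _ = (2 * H + 1) ^ d * (2 ^ (j * (d + 1)) *
          ENNReal.ofReal (Real.exp (-(j * ((d + 1 : ℕ) + 1))))) := by
          rw [mul_add j d 1, mul_one, pow_add]; ring
      _ ≤ _ := by gcongr; exact two_pow_mul_exp_neg_le j (d + 1)
  have hC : (2 * H + 1 : ENNReal) ^ d ≠ ⊤ := by
    exact_mod_cast ENNReal.natCast_ne_top ((2 * H + 1) ^ d)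
  filter_upwards [ae_eventually_notMem_of_le hC hE] with ω hω
  filter_upwards [hω] with j hj a ha x hx
  by_contra! hcon
  refine hj (Set.mem_biUnion ha (Set.mem_biUnion (x := fun i => ⌊(x i - p i) * 2 ^ j⌋) ?_ hcon))
  rw [Finset.mem_coe, Fintype.mem_piFinset]
  intro i
  rw [Finset.mem_Icc]
  exact abs_floor_le hx j i

lemma IsBandField.ae_eventually_modulus {X : ℕ → Pt d → Ω → ℝ} (hd : 0 < d)
    (hX : ∀ j, 1 ≤ j → IsBandField P S (X j) (2 ^ j)⁻¹ 1) (p : Pt d) (H : ℕ) {c : ℝ}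
    (hc : 0 < c) :
    ∀ᵐ ω ∂P, ∀ᶠ j : ℕ in Filter.atTop, ∀ x y : Pt d, (∀ i, |x i - p i| ≤ H) →
      (∀ i, |y i - p i| ≤ H) → (∀ i, |x i - y i| ≤ (2 ^ j)⁻¹) → |X j x ω - X j y ω| ≤ c * j := by
  have hd' : (0 : ℝ) < d := by exact_mod_cast hd
  have hlarge : ∀ᶠ j : ℕ in Filter.atTop,
      (d + 1 : ℝ) * j + 16 * (d + 1) ≤ (c * j) ^ 2 / (128 * (d * Real.sqrt d)) := by
    have hc' : 0 < c ^ 2 / (128 * (d * Real.sqrt d)) := by positivity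
    filter_upwards [Filter.eventually_ge_atTop 1, tendsto_natCast_atTop_atTop.eventually_ge_atTop
      ((17 * (d + 1)) / (c ^ 2 / (128 * (d * Real.sqrt d))))] with j hj1 hj
    rw [div_le_iff₀ hc'] at hj
    have hj1' : (1 : ℝ) ≤ j := by exact_mod_cast hj1
    have : (c * j) ^ 2 / (128 * (d * Real.sqrt d)) =
      j * (j * (c ^ 2 / (128 * (d * Real.sqrt d)))) := by ring
    rw [this]
    nlinarith
  have hex (j : ℕ) : ∃ bad : Set Ω, (1 ≤ j → (d + 1 : ℝ) * j + 16 * (d + 1) ≤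
      (c * j) ^ 2 / (128 * (d * Real.sqrt d)) →
      P bad ≤ (2 * (H * 2 ^ j) + 1 : ℕ) ^ d * (2 ^ (d + 2) *
        ENNReal.ofReal (Real.exp (-((d + 1 : ℝ) * j + 16 * (d + 1))))) ∧
      ∀ ω ∉ bad, ∀ x y : Pt d, (∀ i, |x i - p i| ≤ H) →
        (∀ i, |y i - p i| ≤ H) → (∀ i, |x i - y i| ≤ (2 ^ j)⁻¹) →
          |X j x ω - X j y ω| ≤ c * j) := by
    by_cases h : 1 ≤ j ∧ (d + 1 : ℝ) * j + 16 * (d + 1) ≤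
      (c * j) ^ 2 / (128 * (d * Real.sqrt d))
    · obtain ⟨h1, h2⟩ := h
      have h1' : (0 : ℝ) < j := by exact_mod_cast h1
      obtain ⟨bad, -, hb, hb'⟩ := exists_modulus_event (P := P) (X := X j) (hX j h1).cont
        (κ := d / (2 ^ j)⁻¹) (w := (2 ^ j)⁻¹) (lam := c * j)
        (B := (d + 1 : ℝ) * j + 16 * (d + 1)) (by positivity) (by positivity) (by positivity)
        ((hX j h1).measure_le_abs_sub (by positivity)
          (inv_le_one_of_one_le₀ (one_le_pow₀ one_le_two))) hd
        (by
          refine h2.trans_eq ?_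
          congr 1
          field_simp) (by nlinarith) p (H * 2 ^ j)
      have hK : ((H * 2 ^ j : ℕ) : ℝ) * (2 ^ j)⁻¹ = H := by push_cast; field_simp
      exact ⟨bad, fun _ _ => ⟨hb, fun ω hω x y hx hy => hb' ω hω x y
        (fun i => (hx i).trans hK.ge) (fun i => (hy i).trans hK.ge)⟩⟩
    · exact ⟨∅, fun h1 h2 => (h ⟨h1, h2⟩).elim⟩
  choose bad hbad using hex
  have hC : (2 * H + 1 : ENNReal) ^ d * 2 ^ (d + 2) ≠ ⊤ := by
    exact_mod_cast ENNReal.natCast_ne_top ((2 * H + 1) ^ d * 2 ^ (d + 2))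
  have hP : ∀ᶠ j in Filter.atTop, P (bad j) ≤ (2 * H + 1 : ENNReal) ^ d * 2 ^ (d + 2) * 2⁻¹ ^
    j := by
    filter_upwards [hlarge, Filter.eventually_ge_atTop 1] with j hj hj1
    calc _ ≤ _ := (hbad j hj1 hj).1
      _ ≤ (2 * H + 1) ^ d * 2 ^ (j * d) *
          (2 ^ (d + 2) * ENNReal.ofReal (Real.exp (-(j * (d + 1))))) := by
          gcongr
          · exact box_count_le d H j
          · nlinarith
      _ = (2 * H + 1) ^ d * 2 ^ (d + 2) *
          (2 ^ (j * d) * ENNReal.ofReal (Real.exp (-(j * (d + 1))))) := by ring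
      _ ≤ _ := by gcongr; exact two_pow_mul_exp_neg_le j d
  filter_upwards [ae_eventually_notMem_of_le hC hP] with ω hω
  filter_upwards [hω, hlarge, Filter.eventually_ge_atTop 1] with j h1 h2 h3
  exact (hbad j h3 h2).2 ω h1

end lattice

/-- The number of blocks of length `L` between the scales `m₀` and `j`, up to a margin. -/
def numBlocks (L m₀ j : ℕ) : ℕ := j / L - (m₀ + 1)

lemma mul_le_of_lt_numBlocks {L m₀ j k : ℕ} (hk : k < numBlocks L m₀ j) :
    (m₀ + k + 2) * L ≤ j := by
  have h1 : m₀ + k + 2 ≤ j / L := by unfold numBlocks at hk; omega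
  exact (Nat.mul_le_mul_right L h1).trans (Nat.div_mul_le_self j L)

lemma sub_le_card_sdiff_mul {L m₀ j q : ℕ} (hL : 1 ≤ L) (hq : 1 ≤ q)
    (hj : q * ((m₀ + 2) * L) ≤ j) {T : Finset ℕ} (hT : T ⊆ Finset.range (numBlocks L m₀ j))
    (hTq : T.card ≤ numBlocks L m₀ j / q) :
    (j : ℝ) - 2 * (j / q) ≤ (Finset.range (numBlocks L m₀ j) \ T).card * L := by
  have hq' : (0 : ℝ) < q := by exact_mod_cast hq
  have h1 : (Finset.range (numBlocks L m₀ j) \ T).card + T.card = numBlocks L m₀ j := by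
    rw [Finset.card_sdiff_add_card_eq_card hT, Finset.card_range]
  have h2 : j ≤ (numBlocks L m₀ j + (m₀ + 2)) * L := by
    have h3 := Nat.div_add_mod j L
    have h4 := Nat.mod_lt j hL
    have h5 : j / L + 1 ≤ numBlocks L m₀ j + (m₀ + 2) := by unfold numBlocks; omega
    have h6 := Nat.mul_le_mul_right L h5
    nlinarith
  have h3 : q * (T.card * L) ≤ j := by
    have h4 : T.card * q ≤ numBlocks L m₀ j := (Nat.le_div_iff_mul_le hq).1 hTq
    have h5 : numBlocks L m₀ j ≤ j / L := Nat.sub_le _ _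
    calc q * (T.card * L) = T.card * q * L := by ring
      _ ≤ j / L * L := Nat.mul_le_mul_right L (h4.trans h5)
      _ ≤ j := Nat.div_mul_le_self j L
  have h3' : (T.card : ℝ) * L ≤ j / q := by
    rw [le_div_iff₀ hq', mul_comm]; exact_mod_cast h3
  have hj' : ((m₀ : ℝ) + 2) * L ≤ j / q := by
    rw [le_div_iff₀ hq', mul_comm]; exact_mod_cast hj
  have h2' : (j : ℝ) ≤ (numBlocks L m₀ j + (m₀ + 2)) * L := by exact_mod_cast h2
  have h1' : ((Finset.range (numBlocks L m₀ j) \ T).card : ℝ) + T.card = numBlocks L m₀ j := by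
    exact_mod_cast h1
  rw [← h1'] at h2'
  linarith

section field

variable {d : ℕ} {Ω : Type} [MeasurableSpace Ω] {P : Measure Ω} [IsProbabilityMeasure P]
  {h : ℕ → Pt d → Ω → ℝ}

lemma variance_field (hf : IsWhiteNoiseField d P h) {j : ℕ} (hj : 1 ≤ j) (z : Pt d) :
    Var[h j z; P] = j * Real.log 2 := by
  have h1 : ((2 : ℝ) ^ j)⁻¹ ≤ 1 := inv_le_one_of_one_le₀ (one_le_pow₀ one_le_two)
  rw [← covariance_self (hf.1 j z).aemeasurable, covariance_field_eq hf hj le_rfl, sub_self,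
    bandKernel_zero (by positivity) h1, one_div, inv_inv, Real.log_pow]

lemma variance_field_sub_sum (hf : IsWhiteNoiseField d P h) {L m₀ : ℕ} (hL : 1 ≤ L)
    (hm₀ : 1 ≤ m₀) {j : ℕ} (F : Finset ℕ) (hj : 1 ≤ j) (hF : ∀ k ∈ F, (m₀ + k + 1) * L ≤ j)
    (z : Pt d) :
    Var[h j z - ∑ k ∈ F, incr h L m₀ k z; P] = (j - F.card * L) * Real.log 2 := by
  have hG := isGaussianSpace_fieldSpan hf
  have hmem (k : ℕ) : incr h L m₀ k z ∈ fieldSpan h := incr_mem hL hm₀ k z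
  have hlog (a : ℕ) : bandKernel d (2 ^ a)⁻¹ 1 (z - z) = a * Real.log 2 := by
    rw [sub_self, bandKernel_zero (by positivity)
      (inv_le_one_of_one_le₀ (one_le_pow₀ one_le_two)), one_div, inv_inv, Real.log_pow]
  have h1 (k : ℕ) (hk : k ∈ F) : cov[h j z, incr h L m₀ k z; P] = L * Real.log 2 := by
    have h2 : (m₀ + k) * L ≤ (m₀ + k + 1) * L := Nat.mul_le_mul_right L (by omega)
    have h3 : 1 ≤ (m₀ + k) * L := Nat.mul_pos (by omega) hL
    rw [incr, hG.cov_sub_right (mem_fieldSpan (h3.trans h2) z) (mem_fieldSpan h3 z)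
      (mem_fieldSpan hj z), covariance_field_eq' hf (h3.trans h2) (hF k hk),
      covariance_field_eq' hf h3 (h2.trans (hF k hk)), hlog, hlog]
    push_cast
    ring
  have h4 (k : ℕ) : cov[incr h L m₀ k z, incr h L m₀ k z; P] = L * Real.log 2 := by
    have h2 : (m₀ + k) * L ≤ (m₀ + k + 1) * L := Nat.mul_le_mul_right L (by omega)
    rw [(isBandField_incr hf hL hm₀ k).cov, sub_self, bandKernel_zero (by positivity)
      (inv_anti₀ (by positivity) (pow_le_pow_right₀ one_le_two h2)), inv_div_inv,
      Real.log_div (by positivity) (by positivity), Real.log_pow, Real.log_pow]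
    push_cast
    ring
  have h5 (k k' : ℕ) : cov[incr h L m₀ k z, incr h L m₀ k' z; P] =
      if k = k' then L * Real.log 2 else 0 := by
    split_ifs with hk
    · rw [← hk, h4]
    · exact covariance_incr_eq_zero hf hL hm₀ hk z z
  rw [variance_sub (hG.memLp (mem_fieldSpan hj z))
      (hG.memLp ((fieldSpan h).sum_mem fun k _ => hmem k)),
    variance_sum' fun k _ => hG.memLp (hmem k),
    covariance_sum_right' (fun k _ => hG.memLp (hmem k)) (hG.memLp (mem_fieldSpan hj z)),
    Finset.sum_congr rfl h1, variance_field hf hj]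
  simp only [h5, Finset.sum_ite_eq, Finset.sum_ite_mem, Finset.inter_self, Finset.sum_const,
    nsmul_eq_mul]
  ring

lemma ae_eventually_field_lt (hf : IsWhiteNoiseField d P h) (p : Pt d) (H : ℕ) :
    ∀ᵐ ω ∂P, ∀ᶠ j : ℕ in Filter.atTop, ∀ x : Pt d, (∀ i, |x i - p i| ≤ H) →
      h j (latticePt p j x) ω < (d + 2) * j := by
  have := (isGaussianSpace_fieldSpan hf).ae_eventually_lattice p H (fun _ => {()})
    (fun j => by simpa using Nat.one_le_two_pow) (fun j _ z => -h j z) (c := d + 2)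
    (by positivity) (by
      filter_upwards [Filter.eventually_ge_atTop 1] with j hj _ _ z
      refine ⟨(fieldSpan h).neg_mem (mem_fieldSpan hj z), ?_⟩
      rw [variance_neg, variance_field hf hj, le_div_iff₀ (by positivity)]
      have h1 := Real.log_two_lt_d9
      have h2 : (j : ℝ) * Real.log 2 ≤ j := mul_le_of_le_one_right (by positivity) (by linarith)
      have h3 : (0 : ℝ) ≤ d * j := by positivity
      nlinarith)
  filter_upwards [this] with ω hω
  filter_upwards [hω] with j hj x hx
  have := hj () (Finset.mem_singleton_self _) x hx
  simp only [Pi.neg_apply] at this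
  linarith

lemma ae_eventually_sum_incr_le (hf : IsWhiteNoiseField d P h) {L m₀ q : ℕ} (hL : 1 ≤ L)
    (hm₀ : 1 ≤ m₀) (hq : 1 ≤ q) {c : ℝ} (hc : 0 < c) (hcq : 4 * (d + 2) ≤ q * c ^ 2) (p : Pt d)
    (H : ℕ) :
    ∀ᵐ ω ∂P, ∀ᶠ j : ℕ in Filter.atTop, ∀ T ⊆ Finset.range (numBlocks L m₀ j),
      T.card ≤ numBlocks L m₀ j / q → ∀ x : Pt d, (∀ i, |x i - p i| ≤ H) →
      ∑ k ∈ Finset.range (numBlocks L m₀ j) \ T, incr h L m₀ k (latticePt p j x) ω - c * j <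
        h j (latticePt p j x) ω := by
  have hG := isGaussianSpace_fieldSpan hf
  have hq' : (0 : ℝ) < q := by exact_mod_cast hq
  have := hG.ae_eventually_lattice p H
    (fun j => (Finset.range (numBlocks L m₀ j)).powerset.filter
      fun T => T.card ≤ numBlocks L m₀ j / q)
    (fun j => by
      refine (Finset.card_filter_le _ _).trans ?_
      rw [Finset.card_powerset, Finset.card_range]
      exact Nat.pow_le_pow_right two_pos ((Nat.sub_le _ _).trans (Nat.div_le_self _ _)))
    (fun j T z => h j z - ∑ k ∈ Finset.range (numBlocks L m₀ j) \ T, incr h L m₀ k z) hc (by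
      filter_upwards [Filter.eventually_ge_atTop 1,
        Filter.eventually_ge_atTop (q * ((m₀ + 2) * L))] with j hj1 hj T hT z
      rw [Finset.mem_filter, Finset.mem_powerset] at hT
      refine ⟨(fieldSpan h).sub_mem (mem_fieldSpan hj1 z)
        ((fieldSpan h).sum_mem fun k _ => incr_mem hL hm₀ k z), ?_⟩
      rw [variance_field_sub_sum hf hL hm₀ _ hj1 fun k hk => ?_]
      · have h1 := sub_le_card_sdiff_mul hL hq hj hT.1 hT.2
        have h2 : (2 : ℝ) * (j / q) ≤ c ^ 2 * j / (2 * (d + 2)) := by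
          rw [le_div_iff₀ (by positivity)]
          have : (2 : ℝ) * (j / q) * (2 * (d + 2)) = 4 * (d + 2) * (j / q) := by ring
          rw [this]
          calc 4 * (d + 2) * ((j : ℝ) / q) ≤ q * c ^ 2 * (j / q) := by gcongr
            _ = c ^ 2 * j := by field_simp
        have h3 := Real.log_two_lt_d9
        have h4 := Real.log_two_gt_d9
        have h5 : (0 : ℝ) ≤ j / q := by positivity
        nlinarith
      · have := mul_le_of_lt_numBlocks (Finset.mem_range.1 (Finset.mem_sdiff.1 hk).1)
        exact (Nat.mul_le_mul_right L (by omega)).trans this)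
  filter_upwards [this] with ω hω
  filter_upwards [hω] with j hj T hT hTq x hx
  have := hj T (Finset.mem_filter.2 ⟨Finset.mem_powerset.2 hT, hTq⟩) x hx
  simp only [Pi.sub_apply, Finset.sum_apply] at this
  linarith

end field

section liminf

variable {d : ℕ} {Ω : Type} [MeasurableSpace Ω] {P : Measure Ω} [IsProbabilityMeasure P]
  {h : ℕ → Pt d → Ω → ℝ}

theorem IsCascade.ae_le_liminf (hf : IsWhiteNoiseField d P h) (hd : 0 < d) {L m₀ M q : ℕ}
    (hL : 1 ≤ L) (hm₀ : 1 ≤ m₀) {σ τ A α : ℝ} {ε : ENNReal} {i₀ : Fin d}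
    {V : ℕ → Pt d → Ω → Pt d} {bad : ℕ → Pt d → Set Ω}
    (hC : IsCascade P (incr h L m₀) (2 ^ (m₀ * L))⁻¹ (2 ^ L) σ τ A ε i₀ V bad M)
    (hσ : Real.sqrt d ≤ σ / 2 * 2 ^ L) (hq : 4 ≤ q) (hε : (4 * M) ^ q * ε ≤ 1) (hA : 0 < A)
    (hqA : 1024 * (d + 2) * L ^ 2 ≤ q * A ^ 2) (hα : 0 < α) (hαA : 8 * α * L ≤ A) (p : Pt d)
    (I₀ : ℕ) :
    ∀ᵐ ω ∂P, ∀ t : ℝ, 0 ≤ t → t < I₀ → α * Real.sqrt (Real.log 2) ≤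
      Filter.liminf (fun n : ℕ => h n (limitPath p (2 ^ (m₀ * L))⁻¹ i₀ M V ω t) ω / n)
        Filter.atTop := by
  set ρ : ℝ := (2 ^ (m₀ * L))⁻¹ with hρ
  have hρ0 : 0 < ρ := by positivity
  have hρ1 : ρ ≤ 1 := inv_le_one_of_one_le₀ (one_le_pow₀ one_le_two)
  have hL' : (1 : ℝ) ≤ L := by exact_mod_cast hL
  have hL0 : (0 : ℝ) < L := by linarith
  set c := A / (16 * L) with hc
  have hc0 : 0 < c := by positivity
  have hcA : A = 16 * L * c := by rw [hc]; field_simp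
  have hq0 : (4 : ℝ) ≤ q := by exact_mod_cast hq
  have hcq : 4 * ((d : ℝ) + 2) ≤ q * c ^ 2 := by
    rw [hcA] at hqA
    have : 256 * (4 * ((d : ℝ) + 2)) * L ^ 2 ≤ 256 * (q * c ^ 2) * L ^ 2 := by linarith
    have := le_of_mul_le_mul_right this (by positivity)
    linarith
  have hphi (ω : Ω) (t : ℝ) (ht : 0 ≤ t) (htI : t < I₀) (i : Fin d) :
      |limitPath p ρ i₀ M V ω t i - p i| ≤ (I₀ + 21 : ℕ) := by
    have h1 := hC.norm_limitPath_sub_line_le p ω ht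
    have h2 : ‖limitPath p ρ i₀ M V ω t - p‖ ≤ 21 * ρ + t * ρ := by
      have : limitPath p ρ i₀ M V ω t - p =
          (limitPath p ρ i₀ M V ω t - (p + EuclideanSpace.single i₀ (t * ρ))) +
            EuclideanSpace.single i₀ (t * ρ) := by abel
      rw [this]
      refine (norm_add_le _ _).trans (add_le_add h1 ?_)
      rw [PiLp.norm_single, Real.norm_of_nonneg (by positivity)]
    have h3 := PiLp.norm_apply_le (limitPath p ρ i₀ M V ω t - p) i
    rw [PiLp.sub_apply, Real.norm_eq_abs] at h3
    push_cast
    nlinarith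
  filter_upwards [hC.ae_eventually_card_le p I₀ (q := q) (by omega) hε,
    ae_eventually_field_lt hf p (I₀ + 21),
    ae_eventually_sum_incr_le hf hL hm₀ (q := q) (by omega) hc0 hcq p (I₀ + 21),
    IsBandField.ae_eventually_modulus hd (fun j hj => isBandField_field hf hj) p (I₀ + 21) hc0]
    with ω hcard hup hlow hmod t ht htI
  set x := limitPath p ρ i₀ M V ω t with hx
  have hxb : ∀ i, |x i - p i| ≤ (I₀ + 21 : ℕ) := hphi ω t ht htI
  have hmod' : ∀ᶠ j : ℕ in Filter.atTop, |h j x ω - h j (latticePt p j x) ω| ≤ c * j := by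
    filter_upwards [hmod] with j hj
    exact hj x _ hxb (abs_latticePt_sub_le hxb j) (abs_sub_latticePt_le p j x)
  have hnum : Filter.Tendsto (numBlocks L m₀) Filter.atTop Filter.atTop :=
    (Filter.tendsto_sub_atTop_nat _).comp (Nat.tendsto_div_const_atTop (by omega))
  have hsqrt : Real.sqrt (Real.log 2) ≤ 1 :=
    Real.sqrt_le_one.2 (by linarith [Real.log_two_lt_d9])
  refine Filter.le_liminf_of_le ?_ ?_
  · refine Filter.IsBoundedUnder.isCoboundedUnder_ge ⟨d + 2 + c, ?_⟩
    rw [Filter.eventually_map]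
    filter_upwards [hup, hmod', Filter.eventually_gt_atTop 0] with j h1 h2 h3
    have h3' : (0 : ℝ) < j := by exact_mod_cast h3
    rw [div_le_iff₀ h3']
    have := h1 x hxb
    have := (abs_le.1 h2).2
    linarith
  · filter_upwards [hnum.eventually hcard, hlow, hmod', Filter.eventually_gt_atTop 0,
      Filter.eventually_ge_atTop (q * ((m₀ + 2) * L))] with j h1 h2 h3 h4 h5
    have h4' : (0 : ℝ) < j := by exact_mod_cast h4
    rw [le_div_iff₀ h4']
    obtain ⟨T, hT, hTq, hgood⟩ := h1 t ht htI
    have h6 := h2 T hT hTq x hxb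
    have h7 : (Finset.range (numBlocks L m₀ j) \ T).card * A ≤
        ∑ k ∈ Finset.range (numBlocks L m₀ j) \ T, incr h L m₀ k (latticePt p j x) ω := by
      rw [← nsmul_eq_mul]
      refine Finset.card_nsmul_le_sum _ _ _ fun k hk => ?_
      rw [Finset.mem_sdiff, Finset.mem_range] at hk
      refine hgood k hk.1 hk.2 _ ?_
      rw [norm_sub_rev]
      have h8 : (2 : ℝ) ^ ((m₀ + k + 1) * L) * 2 ^ L ≤ 2 ^ j := by
        rw [← pow_add]
        refine pow_le_pow_right₀ one_le_two ?_
        have := mul_le_of_lt_numBlocks hk.1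
        linarith
      calc ‖x - latticePt p j x‖ ≤ Real.sqrt d * (2 ^ j)⁻¹ :=
            norm_le_sqrt_mul (by positivity) (abs_sub_latticePt_le p j x)
        _ ≤ σ / 2 * 2 ^ L * (2 ^ ((m₀ + k + 1) * L) * 2 ^ L)⁻¹ := by
            have := hC.σ_pos
            gcongr
        _ = σ / 2 * (ρ / (2 ^ L) ^ (k + 1)) := by
            have : (2 : ℝ) ^ ((m₀ + k + 1) * L) = 2 ^ (m₀ * L) * (2 ^ L) ^ (k + 1) := by
              rw [← pow_mul, ← pow_add]; congr 1; ring
            rw [this, hρ]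
            field_simp
    have h9 := sub_le_card_sdiff_mul hL (by omega) h5 hT hTq
    have h10 : (j : ℝ) / q ≤ j / 4 := by gcongr
    have h11 := (abs_le.1 h3).1
    have h12 : 8 * c * j ≤ (Finset.range (numBlocks L m₀ j) \ T).card * A := by
      rw [hcA]
      have : (j : ℝ) / 2 ≤ (Finset.range (numBlocks L m₀ j) \ T).card * L := by linarith
      nlinarith
    have h13 : α ≤ 2 * c := by
      rw [hcA] at hαA
      have : α * (8 * L) ≤ 2 * c * (8 * L) := by linarith
      exact le_of_mul_le_mul_right this (by positivity)
    have h14 : α * Real.sqrt (Real.log 2) ≤ α := mul_le_of_le_one_right hα.le hsqrt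
    nlinarith

end liminf

lemma exists_crossing {d L : ℕ} (hL : 1 ≤ L) (good : Pt d → Prop) (i₀ : Fin d)
    (hline : ∀ m₀ : ℕ, 1 ≤ m₀ → ∀ (p : Fin d → ℚ) (I₀ : ℕ), ∃ φ : ℝ → Pt d,
      ContinuousOn φ (Set.Ici 0) ∧ (∀ t : ℝ, 0 ≤ t → φ t i₀ = p i₀ + t * (2 ^ (m₀ * L))⁻¹) ∧
      (∀ t : ℝ, 0 ≤ t → ‖φ t - (WithLp.toLp 2 (fun i => (p i : ℝ)) +
        EuclideanSpace.single i₀ (t * (2 ^ (m₀ * L))⁻¹))‖ ≤ 21 * (2 ^ (m₀ * L))⁻¹) ∧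
      ∀ t : ℝ, 0 ≤ t → t < I₀ → good (φ t))
    {a b : Fin d → ℝ} (hab : ∀ i, a i < b i) :
    ∃ φ : ℝ → Pt d, ContinuousOn φ (Set.Icc 0 1) ∧
      (∀ t ∈ Set.Icc (0 : ℝ) 1, (∀ i, φ t i ∈ Set.Icc (a i) (b i)) ∧ good (φ t)) ∧
      φ 0 i₀ = a i₀ ∧ φ 1 i₀ = b i₀ := by
  have : Nonempty (Fin d) := ⟨i₀⟩
  obtain ⟨i₁, hi₁⟩ := Finite.exists_min fun i => b i - a i
  obtain ⟨n, hn⟩ := exists_pow_lt_of_lt_one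
    (div_pos (sub_pos.2 (hab i₁)) (by norm_num : (0 : ℝ) < 44))
    (by norm_num : (2⁻¹ : ℝ) < 1)
  set ρ : ℝ := (2 ^ ((n + 1) * L))⁻¹ with hρ
  have hρ0 : 0 < ρ := by positivity
  have hρn : 44 * ρ ≤ b i₁ - a i₁ := by
    have h1 : ρ ≤ 2⁻¹ ^ n := by
      rw [hρ, inv_pow]
      refine inv_anti₀ (by positivity) (pow_le_pow_right₀ one_le_two ?_)
      nlinarith
    rw [lt_div_iff₀ (by norm_num)] at hn
    linarith
  have hrat (i : Fin d) : ∃ r : ℚ, if i = i₀ then (r : ℝ) < a i else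
      a i + 21 * ρ ≤ r ∧ r ≤ b i - 21 * ρ := by
    split_ifs with h
    · exact exists_rat_lt _
    · have h2 := hi₁ i
      obtain ⟨r, hr, hr'⟩ := exists_rat_btwn (show a i + 21 * ρ < b i - 21 * ρ by linarith)
      exact ⟨r, hr.le, hr'.le⟩
  choose p hp using hrat
  have hp₀ : (p i₀ : ℝ) < a i₀ := by simpa using hp i₀
  have hab₀ := hab i₀
  obtain ⟨I₀, hI₀⟩ := exists_nat_gt ((b i₀ - p i₀) / ρ)
  obtain ⟨φ, hφc, hφ₀, hφ, hφg⟩ := hline (n + 1) (by omega) p I₀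
  have hs (s : ℝ) (hs : s ∈ Set.Icc (0 : ℝ) 1) :
      a i₀ ≤ a i₀ + s * (b i₀ - a i₀) ∧ a i₀ + s * (b i₀ - a i₀) ≤ b i₀ := by
    constructor <;> nlinarith [hs.1, hs.2]
  let γ (s : ℝ) : ℝ := (a i₀ + s * (b i₀ - a i₀) - p i₀) / ρ
  have hγ0 (s : ℝ) (h : s ∈ Set.Icc (0 : ℝ) 1) : 0 ≤ γ s :=
    div_nonneg (by linarith [(hs s h).1]) hρ0.le
  have hγρ (s : ℝ) : p i₀ + γ s * ρ = a i₀ + s * (b i₀ - a i₀) := by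
    simp only [γ]; field_simp; ring
  have hφγ (s : ℝ) (h : s ∈ Set.Icc (0 : ℝ) 1) : φ (γ s) i₀ = a i₀ + s * (b i₀ - a i₀) := by
    rw [hφ₀ _ (hγ0 s h), hγρ]
  refine ⟨fun s => φ (γ s), hφc.comp (by fun_prop) hγ0, fun s h => ⟨fun i => ?_, ?_⟩, ?_, ?_⟩
  · by_cases hi : i = i₀
    · subst hi
      rw [hφγ s h]
      exact hs s h
    · have h1 := hp i
      rw [if_neg hi] at h1
      have h2 := (PiLp.norm_apply_le _ i).trans (hφ _ (hγ0 s h))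
      simp only [PiLp.sub_apply, PiLp.add_apply, PiLp.single_apply, if_neg hi, add_zero,
        Real.norm_eq_abs] at h2
      rw [abs_le] at h2
      constructor <;> linarith [h1.1, h1.2, h2.1, h2.2]
  · refine hφg _ (hγ0 s h) (lt_of_le_of_lt ?_ hI₀)
    exact div_le_div_of_nonneg_right (by linarith [(hs s h).2]) hρ0.le
  · simpa using hφγ 0 (by simp)
  · simpa using hφγ 1 (by simp)

section field

variable {d : ℕ} {Ω : Type} [MeasurableSpace Ω] {P : Measure Ω} [IsProbabilityMeasure P]
  {h : ℕ → Pt d → Ω → ℝ}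

theorem ae_exists_crossing (hf : IsWhiteNoiseField d P h) (hd : 16 ≤ d) {L : ℕ} (hL : 1 ≤ L)
    (hdL : 6 * (d : ℝ) ≤ 2 ^ L) {σ τ A B₁ B₂ α : ℝ} {K₁ K₂ M q : ℕ}
    (hσ : 0 < σ) (hσ1 : σ ≤ 1 / 2) (hτ : 0 < τ) (hτσ : τ ≤ σ / 2)
    (hA : A = Real.sqrt d / (1024 * L)) (hB₁ : 16 * (d + 1) ≤ B₁)
    (hB₁' : B₁ ≤ A ^ 2 / (256 * (d * Real.sqrt d) * σ)) (hB₂ : 16 * (d + 1) ≤ B₂)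
    (hB₂' : B₂ ≤ (σ / 192) ^ 2 / (128 * (d * Real.sqrt d) * τ)) (hK₁ : 5 ≤ K₁ * (2 * σ))
    (hK₂ : 5 ≤ K₂ * τ) (hM : 2 ≤ M) (hσN : 46 ≤ σ * 2 ^ L) (hτM : 7 * 2 ^ L ≤ τ * M)
    (hσd : Real.sqrt d ≤ σ / 2 * 2 ^ L) (hq : 4 ≤ q)
    (hε : (4 * M) ^ q * stepError d K₁ K₂ B₁ B₂ A L ≤ 1)
    (hqA : 1024 * (d + 2) * L ^ 2 ≤ q * A ^ 2) (hα : 0 < α) (hαA : 8 * α * L ≤ A) :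
    ∀ᵐ ω ∂P, ∀ a b : Fin d → ℝ, (∀ i, a i < b i) → ∀ i₀ : Fin d,
      ∃ φ : ℝ → Pt d, ContinuousOn φ (Set.Icc 0 1) ∧
        (∀ t ∈ Set.Icc (0 : ℝ) 1, (∀ i, φ t i ∈ Set.Icc (a i) (b i)) ∧
          α * Real.sqrt (Real.log 2) ≤
            Filter.liminf (fun n : ℕ => h n (φ t) ω / n) Filter.atTop) ∧
        φ 0 i₀ = a i₀ ∧ φ 1 i₀ = b i₀ := by
  have hcas (i₀ : Fin d) (m₀ : {m : ℕ // 1 ≤ m}) :=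
    exists_isCascade hf hd hL m₀.2 hdL hσ hσ1 hτ hτσ hA hB₁ hB₁' hB₂ hB₂' hK₁ hK₂
      (zero_lt_two.trans_le hM) hσN hτM i₀
  choose V bad hC using hcas
  have hA0 : 0 < A := by
    have : (0 : ℝ) < L := by exact_mod_cast hL
    have : (0 : ℝ) < d := by exact_mod_cast (by omega : 0 < d)
    rw [hA]; positivity
  have key : ∀ᵐ ω ∂P, ∀ (i₀ : Fin d) (m₀ : {m : ℕ // 1 ≤ m}) (p : Fin d → ℚ) (I₀ : ℕ) (t : ℝ),
      0 ≤ t → t < I₀ → α * Real.sqrt (Real.log 2) ≤ Filter.liminf (fun n : ℕ =>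
        h n (IsCascade.limitPath (WithLp.toLp 2 fun i => (p i : ℝ)) (2 ^ (m₀ * L))⁻¹ i₀ M (V i₀ m₀)
          ω t) ω / n)
        Filter.atTop := by
    refine ae_all_iff.2 fun i₀ => ae_all_iff.2 fun m₀ => ae_all_iff.2 fun p => ae_all_iff.2
      fun I₀ => ?_
    exact (hC i₀ m₀).ae_le_liminf hf (by omega) hL m₀.2 hσd hq hε hA0 hqA hα hαA _ I₀
  filter_upwards [key] with ω hω a b hab i₀
  refine exists_crossing hL (fun x => α * Real.sqrt (Real.log 2) ≤
    Filter.liminf (fun n : ℕ => h n x ω / n) Filter.atTop) i₀ (fun m₀ hm₀ p I₀ => ?_) hab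
  exact ⟨IsCascade.limitPath (WithLp.toLp 2 fun i => (p i : ℝ)) (2 ^ (m₀ * L))⁻¹ i₀ M
    (V i₀ ⟨m₀, hm₀⟩) ω,
    (hC i₀ ⟨m₀, hm₀⟩).continuousOn_limitPath _ ω,
    fun t ht => (hC i₀ ⟨m₀, hm₀⟩).limitPath_apply hM _ ω ht,
    fun t ht => (hC i₀ ⟨m₀, hm₀⟩).norm_limitPath_sub_line_le _ ω ht,
    hω i₀ ⟨m₀, hm₀⟩ p I₀⟩

end field

lemma stepError_mul_le {d l e : ℕ} (he : 2 * (e + 2) ≤ d) (hd : d ≤ 2 ^ l) (hl : 13 * l + 7 ≤ 2 ^ l)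
    {A Lg : ℝ} (hA : e + 2 ≤ (2 * A) ^ 2 / (2 * Lg)) :
    2 ^ e * stepError d (3 * (2 ^ l) ^ 4) (5 * (2 ^ l) ^ 13) ((2 ^ l) ^ 2) ((2 ^ l) ^ 2) A Lg ≤
      1 := by
  have hD : 1 ≤ 2 ^ l := Nat.one_le_two_pow
  have hdd : d * 2 ^ l ≤ (2 ^ l) ^ 2 := by rw [sq]; exact Nat.mul_le_mul_right _ hd
  have hmod (K : ℕ) (hK : 2 * K + 1 ≤ 2 ^ 4 * (2 ^ l) ^ 13) :
      ((2 * K + 1 : ℕ) : ENNReal) ^ d * (2 ^ (d + 2) *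
        ENNReal.ofReal (Real.exp (-((2 ^ l) ^ 2)))) ≤ 2⁻¹ ^ (e + 2) := by
    have h1 : ENNReal.ofReal (Real.exp (-((2 ^ l) ^ 2))) ≤ 2⁻¹ ^ (d * 2 ^ l) :=
      ofReal_exp_neg_le (by exact_mod_cast hdd)
    have h2 : ((2 * K + 1 : ℕ) : ENNReal) ≤ 2 ^ (13 * l + 4) := by
      have : 2 ^ 4 * (2 ^ l) ^ 13 = 2 ^ (13 * l + 4) := by rw [← pow_mul, ← pow_add]; congr 1; ring
      rw [this] at hK
      exact_mod_cast hK
    calc _ ≤ (2 ^ (13 * l + 4)) ^ d * (2 ^ (d + 2) * (2⁻¹ : ENNReal) ^ (d * 2 ^ l)) := by gcongr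
      _ = 2 ^ ((13 * l + 4) * d + (d + 2)) * 2⁻¹ ^ (d * 2 ^ l) := by
        rw [← mul_assoc, ← pow_mul, ← pow_add]
      _ ≤ _ := two_pow_mul_inv_pow_le (by nlinarith)
  have hpow : (2 ^ l) ^ 4 ≤ (2 ^ l) ^ 13 := Nat.pow_le_pow_right hD (by norm_num)
  have hD13 : 1 ≤ (2 ^ l) ^ 13 := Nat.one_le_pow _ _ hD
  have h1 := hmod (3 * (2 ^ l) ^ 4) (by omega)
  have h2 := hmod (5 * (2 ^ l) ^ 13) (by omega)
  have h3 : (2 : ENNReal) ^ d * ENNReal.ofReal (1 / 12) ^ ((d + 1) / 2) ≤ 2⁻¹ ^ (e + 2) := by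
    have h4 : ENNReal.ofReal (1 / 12) ≤ 2⁻¹ ^ 3 := by
      have : ENNReal.ofReal ((2 : ℝ)⁻¹ ^ 3) = 2⁻¹ ^ 3 := by
        rw [ENNReal.ofReal_pow (by norm_num), ENNReal.ofReal_inv_of_pos two_pos]
        simp
      rw [← this]
      exact ENNReal.ofReal_le_ofReal (by norm_num)
    calc _ ≤ (2 : ENNReal) ^ d * (2⁻¹ ^ 3) ^ ((d + 1) / 2) := by gcongr
      _ = 2 ^ d * 2⁻¹ ^ (3 * ((d + 1) / 2)) := by rw [pow_mul]
      _ ≤ _ := two_pow_mul_inv_pow_le (by omega)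
  have h4 : ENNReal.ofReal (Real.exp (-(2 * A) ^ 2 / (2 * Lg))) ≤ 2⁻¹ ^ (e + 2) := by
    rw [neg_div]
    exact ofReal_exp_neg_le (by exact_mod_cast hA)
  have h5 : stepError d (3 * (2 ^ l) ^ 4) (5 * (2 ^ l) ^ 13) ((2 ^ l) ^ 2) ((2 ^ l) ^ 2) A Lg ≤
      2 ^ 2 * 2⁻¹ ^ (e + 2) := by
    calc _ ≤ (2⁻¹ : ENNReal) ^ (e + 2) + 2⁻¹ ^ (e + 2) + 2⁻¹ ^ (e + 2) + 2⁻¹ ^ (e + 2) :=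
          add_le_add (add_le_add (add_le_add h1 h2) h3) h4
      _ = 2 ^ 2 * 2⁻¹ ^ (e + 2) := by ring
  calc _ ≤ (2 : ENNReal) ^ e * (2 ^ 2 * 2⁻¹ ^ (e + 2)) := by gcongr
    _ = 2 ^ (e + 2) * 2⁻¹ ^ (e + 2) := by ring
    _ ≤ 2⁻¹ ^ 0 := two_pow_mul_inv_pow_le (by omega)
    _ = 1 := pow_zero _

lemma exists_forall_le_two_pow (c : ℝ) (k : ℕ) : ∃ l₀ : ℕ, ∀ l ≥ l₀, c * l ^ k ≤ 2 ^ l := by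
  have h := (tendsto_pow_const_div_const_pow_of_one_lt k (one_lt_two (α := ℝ))).const_mul c
  rw [mul_zero] at h
  obtain ⟨l₀, hl₀⟩ := Filter.eventually_atTop.1 (h.eventually_lt_const one_pos)
  refine ⟨l₀, fun l hl => ?_⟩
  have := (hl₀ l hl).le
  rwa [← mul_div_assoc, div_le_one (by positivity)] at this

/-- For `d ≤ 2 ^ l ≤ 2 * d` with `l` large, the crossing criterion holds with blow-up factor
`2 ^ (6 * l)`. -/
theorem ae_exists_crossing_of_large {d : ℕ} {Ω : Type} [MeasurableSpace Ω] {P : Measure Ω}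
    {h : ℕ → Pt d → Ω → ℝ} [IsProbabilityMeasure P] (hf : IsWhiteNoiseField d P h) {l : ℕ}
    (hl : 1 ≤ l) {α : ℝ} (hα : 0 < α) (H : 2 ^ 76 * (1 + α ^ 2) * (l : ℝ) ^ 8 ≤ 2 ^ l)
    (hdl : d ≤ 2 ^ l) (hld : 2 ^ l ≤ 2 * d) :
    ∀ᵐ ω ∂P, ∀ a b : Fin d → ℝ, (∀ i, a i < b i) → ∀ i₀ : Fin d,
      ∃ φ : ℝ → Pt d, ContinuousOn φ (Set.Icc 0 1) ∧
        (∀ t ∈ Set.Icc (0 : ℝ) 1, (∀ i, φ t i ∈ Set.Icc (a i) (b i)) ∧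
          α * Real.sqrt (Real.log 2) ≤
            Filter.liminf (fun n : ℕ => h n (φ t) ω / n) Filter.atTop) ∧
        φ 0 i₀ = a i₀ ∧ φ 1 i₀ = b i₀ := by
  have hx1 : (1 : ℝ) ≤ l := by exact_mod_cast hl
  have hdD : (d : ℝ) ≤ 2 ^ l := by exact_mod_cast hdl
  have hDd : (2 : ℝ) ^ l ≤ 2 * d := by exact_mod_cast hld
  have hpow {k : ℕ} (hk : k ≤ 8) : (l : ℝ) ^ k ≤ l ^ 8 := pow_le_pow_right₀ hx1 hk
  have hd75 : 2 ^ 75 * (l : ℝ) ^ 8 ≤ d := by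
    have := mul_nonneg (sq_nonneg α) (by positivity : (0 : ℝ) ≤ (l : ℝ) ^ 8)
    linarith
  have hdα : 2 ^ 75 * (α ^ 2 * (l : ℝ) ^ 8) ≤ d := by
    have : (0 : ℝ) ≤ (l : ℝ) ^ 8 := by positivity
    linarith
  have h18 : (1 : ℝ) ≤ (l : ℝ) ^ 8 := one_le_pow₀ hx1
  have hD75 : (2 : ℝ) ^ 75 ≤ 2 ^ l := by linarith
  have hlD : (13 * l + 7 : ℕ) ≤ 2 ^ l := by
    have h1 := hpow (k := 1) (by norm_num)
    have : ((13 * l + 7 : ℕ) : ℝ) ≤ 2 ^ l := by push_cast; linarith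
    exact_mod_cast this
  have hd16 : 16 ≤ d := by
    have : (16 : ℝ) ≤ d := by linarith
    exact_mod_cast this
  set D : ℝ := 2 ^ l with hD
  have hD0 : 0 < D := by positivity
  have hd1 : (1 : ℝ) ≤ d := by linarith
  set S : ℝ := Real.sqrt d with hS
  have hSS : S * S = d := Real.mul_self_sqrt (by linarith)
  have hS1 : 1 ≤ S := Real.one_le_sqrt.2 hd1
  have hSd : S ≤ d := by nlinarith
  have hpL : (2 : ℝ) ^ (6 * l) = D ^ 6 := by rw [hD, ← pow_mul, mul_comm]
  have hA2 : (S / (1024 * (6 * l : ℕ))) ^ 2 = d / (2 ^ 20 * (36 * (l : ℝ) ^ 2)) := by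
    rw [div_pow, sq S, hSS]; push_cast; ring
  have hx2 := hpow (k := 2) (by norm_num)
  have hx4 := hpow (k := 4) (by norm_num)
  have hD2 : 16 * ((d : ℝ) + 1) ≤ D ^ 2 := by nlinarith
  have hDinv : D⁻¹ * D = 1 := inv_mul_cancel₀ hD0.ne'
  have hDi : D⁻¹ ≤ 1 / 2 := by
    rw [one_div]; exact inv_anti₀ two_pos (by linarith)
  have hDi0 : 0 < D⁻¹ := by positivity
  have hσ1 : (D ^ 4)⁻¹ ≤ 1 / 2 := by
    rw [one_div]
    exact inv_anti₀ two_pos ((by linarith : (2 : ℝ) ≤ D).trans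
      (le_self_pow₀ (by linarith) (by norm_num)))
  obtain ⟨q, hq⟩ : ∃ q : ℕ, q = 2 ^ 31 * (6 * l) ^ 4 := ⟨_, rfl⟩
  have hqR : (q : ℝ) = 2 ^ 31 * (6 * l) ^ 4 := by rw [hq]; push_cast; ring
  refine ae_exists_crossing (L := 6 * l) (σ := (D ^ 4)⁻¹) (τ := (D ^ 13)⁻¹) (B₁ := D ^ 2)
    (B₂ := D ^ 2) (K₁ := 3 * (2 ^ l) ^ 4) (K₂ := 5 * (2 ^ l) ^ 13) (M := (2 ^ l) ^ 20)
    (q := q) hf hd16 (by omega) ?_ (by positivity) hσ1 (by positivity) ?_ rfl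
    hD2 ?_ hD2 ?_ ?_ ?_ ?_ ?_ ?_ ?_ ?_ ?_ ?_ hα ?_
  · rw [hpL]
    have : D ^ 2 ≤ D ^ 6 := pow_le_pow_right₀ (by linarith) (by norm_num)
    linarith
  · have : (D ^ 13)⁻¹ * 2 ≤ (D ^ 4)⁻¹ := by
      rw [← div_eq_inv_mul, div_le_iff₀ (by positivity), ← div_eq_inv_mul,
        le_div_iff₀ (by positivity)]
      have : D ^ 5 ≤ D ^ 13 := pow_le_pow_right₀ (by linarith) (by norm_num)
      have h4 : (0 : ℝ) < D ^ 4 := by positivity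
      nlinarith
    linarith
  · rw [hA2, le_div_iff₀ (by positivity), le_div_iff₀ (by positivity)]
    have : D ^ 2 * (256 * (d * S) * (D ^ 4)⁻¹) * (2 ^ 20 * (36 * (l : ℝ) ^ 2)) =
        (256 * 2 ^ 20 * 36 * (l : ℝ) ^ 2 * S) / D ^ 2 * d := by
      field_simp
    rw [this]
    refine mul_le_of_le_one_left (by positivity) ((div_le_one (by positivity)).2 ?_)
    calc _ ≤ D * D := by gcongr <;> linarith
      _ = D ^ 2 := by ring
  · rw [le_div_iff₀ (by positivity)]
    have : D ^ 2 * (128 * (d * S) * (D ^ 13)⁻¹) = (128 * 192 ^ 2 * (d * S) / D ^ 3) *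
        ((D ^ 4)⁻¹ / 192) ^ 2 := by
      field_simp
    rw [this]
    refine mul_le_of_le_one_left (by positivity) ((div_le_one (by positivity)).2 ?_)
    calc _ ≤ D * (D * D) := by gcongr <;> linarith
      _ = D ^ 3 := by ring
  · push_cast
    rw [← hD]
    field_simp
    norm_num
  · push_cast
    rw [← hD]
    field_simp
    norm_num
  · rw [← pow_mul]
    exact (by norm_num : 2 ≤ 2 ^ 1).trans (Nat.pow_le_pow_right two_pos (by omega))
  · rw [hpL]
    have : (D ^ 4)⁻¹ * D ^ 6 = D ^ 2 := by field_simp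
    rw [this]; nlinarith
  · rw [hpL]
    push_cast
    rw [← hD]
    have : (D ^ 13)⁻¹ * D ^ 20 = D * D ^ 6 := by field_simp
    rw [this]
    gcongr
    linarith
  · rw [hpL]
    have : (D ^ 4)⁻¹ / 2 * D ^ 6 = D ^ 2 / 2 := by field_simp
    rw [this]; nlinarith
  · have : 0 < (6 * l) ^ 4 := by positivity
    omega
  · have he : (4 * ((2 ^ l) ^ 20 : ℕ) : ENNReal) ^ q = 2 ^ ((2 + 20 * l) * q) := by
      push_cast
      rw [pow_mul 2 (2 + 20 * l) q, pow_add, ← pow_mul 2 l 20, mul_comm l 20]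
      norm_num
    rw [he]
    have hx3 := hpow (k := 3) (by norm_num)
    have hx5 := hpow (k := 5) (by norm_num)
    have hx7 := hpow (k := 7) (by norm_num)
    refine stepError_mul_le ?_ hdl hlD ?_
    · have : ((2 * ((2 + 20 * l) * q + 2) : ℕ) : ℝ) ≤ d := by
        push_cast
        rw [hqR]
        linarith
      exact_mod_cast this
    · rw [mul_pow 2 (S / _) 2, hA2, mul_div_assoc', div_div, le_div_iff₀ (by positivity)]
      push_cast
      rw [hqR]
      linarith
  · rw [hA2, hqR, mul_div_assoc', le_div_iff₀ (by positivity)]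
    push_cast
    have : 0 ≤ (l : ℝ) ^ 4 * (d - 2) := mul_nonneg (by positivity) (by linarith)
    linarith
  · push_cast
    rw [le_div_iff₀ (by positivity)]
    refine Real.le_sqrt_of_sq_le ?_
    have h48 : α ^ 2 * (l : ℝ) ^ 4 ≤ α ^ 2 * l ^ 8 := by gcongr
    have h0 : 0 ≤ α ^ 2 * (l : ℝ) ^ 8 := by positivity
    linarith

end WhiteNoise

/-- Fix `α > 0`. There exists `C > 0` depending only on `α` such that for
every integer `d ≥ C`, almost surely: for every box `B = Π_i [a_i, b_i]` with `a_i < b_i`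
and every coordinate direction `i₀`, the set `𝒯^W_α ∩ B` contains a continuous path
connecting the two opposite faces of `B` in direction `i₀`. -/
theorem white_noise_thick_points_crossing (α : ℝ) (hα : 0 < α) :
    ∃ C : ℝ, 0 < C ∧
      ∀ d : ℕ, 2 ≤ d → C ≤ (d : ℝ) →
      ∀ (Ω : Type) (_ : MeasurableSpace Ω) (P : Measure Ω), IsProbabilityMeasure P →
      ∀ h : ℕ → EuclideanSpace ℝ (Fin d) → Ω → ℝ, IsWhiteNoiseField d P h →
        ∀ᵐ ω ∂P, ∀ a b : Fin d → ℝ, (∀ i, a i < b i) → ∀ i₀ : Fin d,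
          ∃ φ : ℝ → EuclideanSpace ℝ (Fin d),
            ContinuousOn φ (Set.Icc 0 1) ∧
            (∀ t ∈ Set.Icc (0 : ℝ) 1,
              (∀ i, φ t i ∈ Set.Icc (a i) (b i)) ∧
              α * Real.sqrt (Real.log 2) ≤
                Filter.liminf (fun n : ℕ => h n (φ t) ω / n) Filter.atTop) ∧
            φ 0 i₀ = a i₀ ∧ φ 1 i₀ = b i₀ := by
  obtain ⟨l₀, hl₀⟩ := WhiteNoise.exists_forall_le_two_pow (2 ^ 76 * (1 + α ^ 2)) 8
  refine ⟨2 ^ l₀, by positivity, fun d hd hC Ω _ P _ h hf => ?_⟩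
  have hlog : 1 ≤ Nat.clog 2 d := Nat.clog_pos one_lt_two hd
  refine WhiteNoise.ae_exists_crossing_of_large hf hlog hα (hl₀ _ ?_)
    (Nat.le_pow_clog one_lt_two d) ?_
  · have h1 : 2 ^ l₀ ≤ d := by exact_mod_cast hC
    exact (Nat.pow_le_pow_iff_right one_lt_two).1 (h1.trans (Nat.le_pow_clog one_lt_two d))
  · have := Nat.pow_pred_clog_lt_self one_lt_two hd
    obtain ⟨k, hk⟩ := Nat.exists_eq_add_of_le' hlog
    rw [hk, Nat.pred_succ] at this
    rw [hk, pow_succ]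
    omega
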